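/- Fix an integer d ≥ 2. There exist constants C > 0 and f > 0 such that for every integer N ≥ 2, the number of polynomials p ∈ P_d(N) whose Galois group is not the full symmetric group S_d — that is, for which it is not the case that p has d distinct complex roots (Fintype.card (rootSet) = d) and galActionHom is surjective — is at most C · N^{d-1} · (log N)^f. Equivalently, the Galois group of a random monic polynomial with integer coefficients chosen uniformly from [-N, N] fails to be S_d with probability O((log N)^f / N). -/

import Mathlib

section
open Polynomial

/-- log-like quantity -/
noncomputable def LL (S : ℕ) : ℝ := 1 + Real.log S

lemma LL_ge_one (S : ℕ) : 1 ≤ LL S := by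
  unfold LL
  have := Real.log_natCast_nonneg S
  linarith

lemma sum_omega_div (L S : ℕ) :
    ∑ d ∈ (Finset.Icc 1 S).filter Squarefree, ((L : ℝ) ^ d.primeFactors.card) / d
      ≤ (∑ m ∈ Finset.Icc 1 S, (1 : ℝ) / m) ^ L := by
  classical
  induction L with
  | zero =>
    rw [pow_zero]
    calc ∑ d ∈ (Finset.Icc 1 S).filter Squarefree, (((0:ℕ) : ℝ) ^ d.primeFactors.card) / d
        ≤ ∑ d ∈ ({1} : Finset ℕ), (1:ℝ) := by
          rw [← Finset.sum_subset (s₁ := ((Finset.Icc 1 S).filter Squarefree).filter (fun d => d = 1))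
            (Finset.filter_subset _ _)]
          · calc _ ≤ ∑ d ∈ ((Finset.Icc 1 S).filter Squarefree).filter (fun d => d = 1), (1:ℝ) := by
                  apply Finset.sum_le_sum
                  intro d hd
                  simp only [Finset.mem_filter] at hd
                  rw [hd.2]; simp
              _ ≤ _ := by
                  apply Finset.sum_le_sum_of_subset_of_nonneg
                  · intro d hd
                    simp only [Finset.mem_filter] at hd
                    simp [hd.2]
                  · intros; norm_num
          · intro d hd hd1
            simp only [Finset.mem_filter, Finset.mem_Icc] at hd hd1
            have h1 : d ≠ 1 := fun h => hd1 ⟨hd, h⟩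
            have : d.primeFactors.card ≠ 0 := by
              rw [Finset.card_ne_zero, Nat.nonempty_primeFactors]
              omega
            simp [this]
      _ = 1 := by simp
  | succ L ih =>
    have key : ∀ d ∈ (Finset.Icc 1 S).filter Squarefree,
        (((L+1:ℕ) : ℝ) ^ d.primeFactors.card) / d =
        ∑ U ∈ d.primeFactors.powerset, (L:ℝ) ^ U.card / d := by
      intro d hd
      rw [← Finset.sum_div]
      congr 1
      have := Finset.sum_pow_mul_eq_add_pow (L:ℝ) 1 d.primeFactors
      simp only [one_pow, mul_one] at this
      rw [this]; push_cast; rfl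
    rw [Finset.sum_congr rfl key, pow_succ]
    calc _ ≤ (∑ d ∈ (Finset.Icc 1 S).filter Squarefree, ((L : ℝ) ^ d.primeFactors.card) / d) *
          ∑ m ∈ Finset.Icc 1 S, (1 : ℝ) / m := ?_
      _ ≤ _ := by
        apply mul_le_mul_of_nonneg_right ih
        positivity
    rw [Finset.sum_mul_sum, ← Finset.sum_product', Finset.sum_sigma']
    let i : (Σ _ : ℕ, Finset ℕ) → ℕ × ℕ := fun x => (∏ p ∈ x.2, p, x.1 / ∏ p ∈ x.2, p)
    have hU : ∀ d ∈ (Finset.Icc 1 S).filter Squarefree, ∀ U ∈ d.primeFactors.powerset,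
        (∏ p ∈ U, p) ∣ d ∧ (∏ p ∈ U, p).primeFactors = U := by
      intro d hd U hU
      rw [Finset.mem_powerset] at hU
      simp only [Finset.mem_filter, Finset.mem_Icc] at hd
      refine ⟨?_, ?_⟩
      · calc (∏ p ∈ U, p) ∣ ∏ p ∈ d.primeFactors, p := Finset.prod_dvd_prod_of_subset _ _ _ hU
          _ = d := Nat.prod_primeFactors_of_squarefree hd.2
      · exact Nat.primeFactors_prod (fun p hp => Nat.prime_of_mem_primeFactors (hU hp))
    have hinj : Set.InjOn i (((Finset.Icc 1 S).filter Squarefree).sigma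
        (fun d => d.primeFactors.powerset)) := by
      rintro ⟨d, U⟩ h1 ⟨d', U'⟩ h2 h
      simp only [Finset.coe_sigma, Set.mem_sigma_iff, Finset.mem_coe] at h1 h2
      simp only [i, Prod.mk.injEq] at h
      obtain ⟨ha, hb⟩ := hU d h1.1 U h1.2
      obtain ⟨ha', hb'⟩ := hU d' h2.1 U' h2.2
      have : U = U' := by rw [← hb, ← hb', h.1]
      subst this
      have : d = d' := by
        rw [← Nat.div_mul_cancel ha, ← Nat.div_mul_cancel ha', h.2]
      subst this; rfl
    have himg := Finset.sum_image (f := fun x : ℕ × ℕ => ((L:ℝ) ^ x.1.primeFactors.card / x.1) * (1 / x.2)) (g := i) (s := ((Finset.Icc 1 S).filter Squarefree).sigma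
        (fun d => d.primeFactors.powerset)) hinj
    refine le_trans (le_of_eq ?_) (himg.symm.le.trans ?_)
    · apply Finset.sum_congr rfl
      rintro ⟨d, U⟩ h
      simp only [Finset.mem_sigma] at h
      obtain ⟨ha, hb⟩ := hU d h.1 U h.2
      simp only [Finset.mem_filter, Finset.mem_Icc] at h
      simp only [i]
      rw [hb, Nat.cast_div ha]
      · have : ((∏ p ∈ U, p : ℕ) : ℝ) ≠ 0 := by
          have := Nat.pos_of_dvd_of_pos ha (by omega)
          positivity
        have : (d:ℝ) ≠ 0 := by
          have : 0 < d := by omega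
          positivity
        field_simp
      · have := Nat.pos_of_dvd_of_pos ha (by omega)
        positivity
    · apply Finset.sum_le_sum_of_subset_of_nonneg
      · intro x hx
        simp only [Finset.mem_image, Finset.mem_sigma] at hx
        obtain ⟨⟨d, U⟩, h, rfl⟩ := hx
        obtain ⟨ha, hb⟩ := hU d h.1 U h.2
        simp only [Finset.mem_filter, Finset.mem_Icc] at h
        simp only [i, Finset.mem_product, Finset.mem_filter, Finset.mem_Icc]
        have h0 := Nat.pos_of_dvd_of_pos ha (by omega)
        refine ⟨⟨⟨h0, (Nat.le_of_dvd (by omega) ha).trans h.1.1.2⟩, h.1.2.squarefree_of_dvd ha⟩, ?_, ?_⟩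
        · exact Nat.div_pos (Nat.le_of_dvd (by omega) ha) h0
        · exact (Nat.div_le_self _ _).trans h.1.1.2
      · intros; positivity

lemma sum_omega_div' (L S : ℕ) :
    ∑ d ∈ (Finset.Icc 1 S).filter Squarefree, ((L : ℝ) ^ d.primeFactors.card) / d
      ≤ LL S ^ L := by
  refine (sum_omega_div L S).trans ?_
  gcongr
  have := harmonic_le_one_add_log S
  rw [harmonic_eq_sum_Icc] at this
  unfold LL
  refine le_trans (le_of_eq ?_) this
  push_cast
  simp

lemma exists_small_subset (P : Finset ℕ) (hP : ∀ p ∈ P, 1 ≤ p) (A q : ℕ) (h : (A+1) * q ≤ P.card) :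
    ∃ U ⊆ P, U.card = q ∧ (∏ p ∈ U, p) ^ (A+1) ≤ ∏ p ∈ P, p := by
  classical
  induction A generalizing P with
  | zero =>
    obtain ⟨U, hU, hc⟩ := Finset.exists_subset_card_eq (by simpa using h)
    refine ⟨U, hU, hc, ?_⟩
    rw [zero_add, pow_one]
    exact Finset.prod_le_prod_of_subset_of_one_le' hU (fun p hp _ => hP p hp)
  | succ A ih =>
    obtain ⟨U, hU, hc⟩ := Finset.exists_subset_card_eq (s := P) (n := q) (by nlinarith)
    obtain ⟨V, hV, hVc, hVp⟩ := ih (P \ U) (fun p hp => hP p (Finset.sdiff_subset hp)) (by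
      rw [Finset.card_sdiff_of_subset hU, hc]
      have : (A + 1 + 1) * q = (A+1)*q + q := by ring
      omega)
    have hsplit : ∏ p ∈ P, p = (∏ p ∈ P \ U, p) * ∏ p ∈ U, p := (Finset.prod_sdiff hU).symm
    rcases le_total (∏ p ∈ V, p) (∏ p ∈ U, p) with hle | hle
    · refine ⟨V, hV.trans Finset.sdiff_subset, hVc, ?_⟩
      rw [hsplit, pow_succ]
      exact Nat.mul_le_mul hVp hle
    · refine ⟨U, hU, hc, ?_⟩
      rw [hsplit, pow_succ]
      exact Nat.mul_le_mul ((Nat.pow_le_pow_left hle _).trans hVp) le_rfl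

lemma dvd_sub_of_zmod (d : ℕ) (hd : Squarefree d) (x y : ℤ)
    (h : ∀ p ∈ d.primeFactors, (x : ZMod p) = y) : (d : ℤ) ∣ x - y := by
  have h1 : (d:ℤ) = ∏ p ∈ d.primeFactors, (p:ℤ) := by
    conv_lhs => rw [← Nat.prod_primeFactors_of_squarefree hd]
    push_cast; rfl
  rw [h1]
  apply Finset.prod_dvd_of_coprime
  · intro p hp q hq hpq
    have := (Nat.coprime_primes (Nat.prime_of_mem_primeFactors hp) (Nat.prime_of_mem_primeFactors hq)).2 hpq
    exact Nat.isCoprime_iff_coprime.2 this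
  · intro p hp
    rw [← ZMod.intCast_zmod_eq_zero_iff_dvd]
    push_cast
    rw [h p hp, sub_self]

lemma card_fiber_le (S d : ℕ) (hd : 0 < d) (T : Finset ℤ) (hT : T ⊆ Finset.Icc (-(S:ℤ)) S)
    (h : ∀ x ∈ T, ∀ y ∈ T, (d:ℤ) ∣ x - y) : (T.card : ℝ) ≤ 2 * (S:ℝ) / d + 2 := by
  have hd' : (0:ℤ) < d := by exact_mod_cast hd
  have h1 : T.card ≤ (Finset.Icc ((-(S:ℤ)) / d) ((S:ℤ) / d)).card := by
    apply Finset.card_le_card_of_injOn (fun x => x / (d:ℤ))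
    · intro x hx
      have := Finset.mem_Icc.1 (hT hx)
      simp only [Finset.coe_Icc, Set.mem_Icc]
      exact ⟨Int.ediv_le_ediv hd' this.1, Int.ediv_le_ediv hd' this.2⟩
    · intro x hx y hy hxy
      simp only at hxy
      have h2 := Int.emod_emod_of_dvd x (dvd_refl (d:ℤ))
      have h3 : x % d = y % d := Int.emod_eq_emod_iff_emod_sub_eq_zero.2 (Int.emod_eq_zero_of_dvd (h x hx y hy))
      rw [← Int.mul_ediv_add_emod x d, ← Int.mul_ediv_add_emod y d, hxy, h3]
  rw [Int.card_Icc] at h1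
  have h4 : (-(S:ℤ)) / d ≤ (S:ℤ)/d := Int.ediv_le_ediv hd' (by omega)
  have h5 : ((S:ℤ)/d : ℤ) ≤ (S:ℝ)/d := by
    rw [le_div_iff₀ (by positivity)]
    exact_mod_cast Int.ediv_mul_le (S:ℤ) hd'.ne'
  have h6 : -(S:ℝ)/d - 1 ≤ ((-(S:ℤ)/d : ℤ) : ℝ) := by
    rw [sub_le_iff_le_add, div_le_iff₀ (by positivity)]
    have := Int.lt_ediv_add_one_mul_self (-(S:ℤ)) hd'
    exact_mod_cast this.le
  have h7 : (T.card : ℤ) ≤ (S:ℤ)/d + 1 - (-(S:ℤ))/d := by omega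
  have h8 : (T.card : ℝ) ≤ (((S:ℤ)/d : ℤ):ℝ) + 1 - (((-(S:ℤ))/d : ℤ) : ℝ) := by exact_mod_cast h7
  have h9 : 2 * (S:ℝ) / d = (S:ℝ)/d - (-(S:ℝ)/d) := by ring
  linarith

lemma card_residue_le (S d : ℕ) (hd : Squarefree d) (R : ∀ p : ℕ, Finset (ZMod p)) (T : Finset ℤ)
    (hT : T ⊆ Finset.Icc (-(S:ℤ)) S) (hR : ∀ x ∈ T, ∀ p ∈ d.primeFactors, (x : ZMod p) ∈ R p) :
    (T.card : ℝ) ≤ (∏ p ∈ d.primeFactors, ((R p).card : ℝ)) * (2 * (S:ℝ) / d + 2) := by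
  classical
  let i : ℤ → (∀ p ∈ d.primeFactors, ZMod p) := fun x p _ => (x : ZMod p)
  have h1 : ∀ x ∈ T, i x ∈ d.primeFactors.pi R := by
    intro x hx
    simp only [Finset.mem_pi, i]
    exact fun p hp => hR x hx p hp
  rw [Finset.card_eq_sum_card_fiberwise h1]
  push_cast
  calc _ ≤ ∑ b ∈ d.primeFactors.pi R, (2 * (S:ℝ) / d + 2) := by
        apply Finset.sum_le_sum
        intro b hb
        apply card_fiber_le S d hd.ne_zero.bot_lt
        · exact (Finset.filter_subset _ _).trans hT
        · intro x hx y hy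
          simp only [Finset.mem_filter] at hx hy
          apply dvd_sub_of_zmod d hd
          intro p hp
          have := hx.2.trans hy.2.symm
          exact congrFun (congrFun this p) hp
    _ = _ := by
        rw [Finset.sum_const, Finset.card_pi, nsmul_eq_mul]
        push_cast; rfl

/-- roots of `F` mod `p` -/
noncomputable def rmod (F : ℤ[X]) (M : ℕ) (p : ℕ) : Finset (ZMod p) := by
  classical
  exact if h : p.Prime then
    (haveI := Fact.mk h; if (F.leadingCoeff : ZMod p) = 0 then Finset.univ else
      (F.map (Int.castRingHom (ZMod p))).roots.toFinset) else ∅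

lemma rmod_card (F : ℤ[X]) (M p : ℕ) (h0 : F.leadingCoeff ≠ 0) (h1 : F.natDegree ≤ M)
    (h2 : F.leadingCoeff.natAbs ≤ M) : (rmod F M p).card ≤ M := by
  classical
  unfold rmod
  split_ifs with hp h
  · have := Fact.mk hp
    rw [Finset.card_univ, ZMod.card]
    rw [ZMod.intCast_zmod_eq_zero_iff_dvd] at h
    exact (Nat.le_of_dvd (Int.natAbs_pos.2 h0) (Int.natCast_dvd.1 h)).trans h2
  · have := Fact.mk hp
    exact (Multiset.toFinset_card_le _).trans ((Polynomial.card_roots' _).trans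
      (Polynomial.natDegree_map_le.trans h1))
  · simp

lemma mem_rmod (F : ℤ[X]) (M p : ℕ) (hp : p.Prime) (x : ℤ) (h : (p:ℤ) ∣ F.eval x) :
    (x : ZMod p) ∈ rmod F M p := by
  classical
  unfold rmod
  have := Fact.mk hp
  rw [dif_pos hp]
  split_ifs with h'
  · simp
  · rw [Multiset.mem_toFinset, Polynomial.mem_roots']
    refine ⟨?_, ?_⟩
    · intro h0
      apply h'
      have := congrArg (fun q => q.coeff F.natDegree) h0
      simpa using this
    · rw [Polynomial.IsRoot, Polynomial.eval_intCast_map, eq_intCast]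
      exact (ZMod.intCast_zmod_eq_zero_iff_dvd _ _).2 h

lemma card_dvd_eval_le (F : ℤ[X]) (M S d : ℕ) (hd : Squarefree d) (h0 : F.leadingCoeff ≠ 0)
    (h1 : F.natDegree ≤ M) (h2 : F.leadingCoeff.natAbs ≤ M) (T : Finset ℤ)
    (hT : T ⊆ Finset.Icc (-(S:ℤ)) S) (h : ∀ x ∈ T, (d:ℤ) ∣ F.eval x) :
    (T.card : ℝ) ≤ (M:ℝ) ^ d.primeFactors.card * (2 * (S:ℝ) / d + 2) := by
  refine (card_residue_le S d hd (rmod F M) T hT ?_).trans ?_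
  · intro x hx p hp
    apply mem_rmod _ _ _ (Nat.prime_of_mem_primeFactors hp)
    exact (Int.natCast_dvd_natCast.2 (Nat.dvd_of_mem_primeFactors hp)).trans (h x hx)
  · gcongr
    rw [← Finset.prod_const]
    gcongr with p hp
    exact_mod_cast rmod_card F M p h0 h1 h2

theorem moment (M K A : ℕ) : ∃ c : ℝ, 0 ≤ c ∧ ∃ f : ℕ, ∀ (S : ℕ), 1 ≤ S → ∀ F : ℤ[X],
    F.leadingCoeff ≠ 0 → F.natDegree ≤ M → F.leadingCoeff.natAbs ≤ M →
    (∀ s : ℤ, |s| ≤ S → |F.eval s| ≤ (S:ℤ) ^ (A+1)) →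
    ∑ s ∈ (Finset.Icc (-(S:ℤ)) S).filter (fun s => F.eval s ≠ 0),
      ((K+1 : ℕ) : ℝ) ^ (F.eval s).natAbs.primeFactors.card ≤ c * S * LL S ^ f := by
  classical
  set B : ℕ := (K+1)^(A+1) with hB
  refine ⟨4 * B, by positivity, B * M, ?_⟩
  intro S hS F h0 h1 h2 hF
  have hpt : ∀ s ∈ (Finset.Icc (-(S:ℤ)) S).filter (fun s => F.eval s ≠ 0),
      ((K+1 : ℕ) : ℝ) ^ (F.eval s).natAbs.primeFactors.card ≤
      ∑ d ∈ ((Finset.Icc 1 S).filter Squarefree).filter (fun d : ℕ => (d:ℤ) ∣ F.eval s),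
        (B:ℝ) * (B:ℝ) ^ d.primeFactors.card := by
    intro s hs
    simp only [Finset.mem_filter, Finset.mem_Icc] at hs
    set P := (F.eval s).natAbs.primeFactors with hP
    have hpr : ∀ p ∈ P, p.Prime := fun p hp => Nat.prime_of_mem_primeFactors hp
    obtain ⟨U, hU, hUc, hUp⟩ := exists_small_subset P (fun p hp => (hpr p hp).one_le) A
      (P.card / (A+1)) (Nat.mul_div_le _ _)
    set d := ∏ p ∈ U, p with hd
    have hdpf : d.primeFactors = U := Nat.primeFactors_prod (fun p hp => hpr p (hU hp))
    have hd1 : 1 ≤ d := Finset.one_le_prod' (fun p hp => (hpr p (hU hp)).one_le)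
    have hdF : d ∣ (F.eval s).natAbs :=
      (Finset.prod_dvd_prod_of_subset _ _ _ hU).trans (Nat.prod_primeFactors_dvd _)
    have hdS : d ≤ S := by
      have ha : ∏ p ∈ P, p ≤ S ^ (A+1) := by
        refine (Nat.le_of_dvd (Int.natAbs_pos.2 hs.2) (Nat.prod_primeFactors_dvd _)).trans ?_
        have := hF s (abs_le.2 hs.1)
        zify; exact this
      exact (Nat.pow_le_pow_iff_left (by omega)).1 (hUp.trans ha)
    have hsq : Squarefree d := by
      refine Squarefree.squarefree_of_dvd (Finset.prod_dvd_prod_of_subset _ _ _ hU) ?_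
      exact Nat.squarefree_iff_nodup_primeFactorsList (by
        exact (Finset.prod_pos (fun p hp => (hpr p hp).pos)).ne') |>.2 (by
        have := UniqueFactorizationMonoid.squarefree_radical (a := (F.eval s).natAbs)
        rw [← Nat.squarefree_iff_nodup_primeFactorsList]
        · rw [Nat.radical_eq_prod_primeFactors] at this
          exact this
        · exact (Finset.prod_pos (fun p hp => (hpr p hp).pos)).ne')
    calc ((K+1 : ℕ) : ℝ) ^ P.card ≤ (B:ℝ) * (B:ℝ) ^ d.primeFactors.card := by
          rw [hdpf, hUc, hB]
          push_cast
          rw [← pow_mul, ← pow_add]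
          apply pow_le_pow_right₀
          · have : (0:ℝ) ≤ K := by positivity
            linarith
          · have := Nat.div_add_mod P.card (A+1)
            have := Nat.mod_lt P.card (show A + 1 > 0 by omega)
            omega
      _ ≤ _ := by
          apply Finset.single_le_sum (f := fun d : ℕ => (B:ℝ) * (B:ℝ) ^ d.primeFactors.card)
          · intros; positivity
          · simp only [Finset.mem_filter, Finset.mem_Icc]
            exact ⟨⟨⟨hd1, hdS⟩, hsq⟩, Int.natCast_dvd.2 hdF⟩
  refine (Finset.sum_le_sum hpt).trans ?_
  simp_rw [Finset.sum_filter (s := (Finset.Icc 1 S).filter Squarefree)]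
  rw [Finset.sum_comm]
  have hd : ∀ d ∈ (Finset.Icc 1 S).filter Squarefree,
      (∑ s ∈ (Finset.Icc (-(S:ℤ)) S).filter (fun s => F.eval s ≠ 0),
        if (d:ℤ) ∣ F.eval s then (B:ℝ) * (B:ℝ) ^ d.primeFactors.card else 0) ≤
      (4 * B * S) * (((B * M : ℕ):ℝ) ^ d.primeFactors.card / d) := by
    intro d hd
    simp only [Finset.mem_filter, Finset.mem_Icc] at hd
    rw [← Finset.sum_filter, Finset.sum_const, nsmul_eq_mul]
    have := card_dvd_eval_le F M S d hd.2 h0 h1 h2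
      (((Finset.Icc (-(S:ℤ)) S).filter (fun s => F.eval s ≠ 0)).filter (fun s => (d:ℤ) ∣ F.eval s))
      ((Finset.filter_subset _ _).trans (Finset.filter_subset _ _))
      (fun x hx => (Finset.mem_filter.1 hx).2)
    have hd0 : (0:ℝ) < d := by exact_mod_cast hd.1.1
    have h3 : 2 * (S:ℝ) / d + 2 ≤ 4 * S / d := by
      have : (d:ℝ) ≤ S := by exact_mod_cast hd.1.2
      have h4 : (1:ℝ) ≤ S / d := by rwa [le_div_iff₀ hd0, one_mul]
      have e1 : 2 * (S:ℝ)/d = 2 * (S/d) := by ring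
      have e2 : 4 * (S:ℝ)/d = 4 * (S/d) := by ring
      rw [e1, e2]; linarith
    calc _ ≤ ((M:ℝ) ^ d.primeFactors.card * (4 * S / d)) * ((B:ℝ) * (B:ℝ) ^ d.primeFactors.card) := by
          gcongr
          exact this.trans (by gcongr)
      _ = _ := by push_cast; rw [mul_pow]; ring
  refine (Finset.sum_le_sum hd).trans ?_
  rw [← Finset.mul_sum]
  gcongr
  exact sum_omega_div' _ _
end

section
open Polynomial

def NR (p : ℕ) (h : ℤ[X]) (k : ℕ) : Prop :=
  ∃ (F : Type) (_ : Field F) (_ : CharP F p), ∃ s : Multiset F, ∃ t : Finset F,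
    (∀ a ∈ s, a ∈ t) ∧ t.card ≤ k ∧ h.map (Int.castRingHom F) = (s.map (fun a => X - C a)).prod

noncomputable def HH {R : Type*} [CommRing R] (n : ℕ) (q : R[X]) : R[X] :=
  resultant ((derivative q).map C) (q.map C + C X) (n-1) n

noncomputable def DD {R : Type*} [CommRing R] (n : ℕ) (q : R[X]) : R :=
  resultant (HH n q) (derivative (HH n q)) (n-1) (n-2)

lemma HH_map {R S : Type*} [CommRing R] [CommRing S] (φ : R →+* S) (n : ℕ) (q : R[X]) :
    HH n (q.map φ) = (HH n q).map φ := by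
  unfold HH
  have e := resultant_map_map ((derivative q).map C) (q.map C + C X) (n-1) n (mapRingHom φ)
  rw [coe_mapRingHom] at e
  rw [← e]
  have hc : (mapRingHom φ).comp (C : R →+* R[X]) = (C : S →+* S[X]).comp φ := by ext; simp
  congr 1
  · rw [derivative_map, map_map, map_map, hc]
  · rw [Polynomial.map_add, map_map, map_map, hc]; simp

lemma DD_map {R S : Type*} [CommRing R] [CommRing S] (φ : R →+* S) (n : ℕ) (q : R[X]) :
    DD n (q.map φ) = φ (DD n q) := by
  unfold DD
  rw [HH_map, derivative_map, resultant_map_map]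

lemma HH_add_C {R : Type*} [CommRing R] (n : ℕ) (q : R[X]) (t : R) :
    HH n (q + C t) = (HH n q).comp (X + C t) := by
  unfold HH
  rw [← coe_compRingHom_apply, ← resultant_map_map]
  congr 1
  · simp only [derivative_add, derivative_C, add_zero, map_map]; congr 1; ext; simp
  · simp only [Polynomial.map_add, map_map, map_C, coe_compRingHom_apply, X_comp, C_add]
    rw [show (compRingHom (X + C t)).comp C = (C : R →+* R[X]) by ext; simp]
    ring

lemma natDegree_deriv_eq {K : Type*} [Field K] {n : ℕ} {q : K[X]} (hq : q.Monic)
    (hn : q.natDegree = n) (h1 : 1 ≤ n) (h0 : (n : K) ≠ 0) :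
    (derivative q).natDegree = n - 1 ∧ (derivative q).leadingCoeff = n := by
  have hc : (derivative q).coeff (n-1) = n := by
    rw [coeff_derivative, Nat.sub_add_cancel h1, ← hn, hq.coeff_natDegree, hn, one_mul]
    norm_cast
    rw [Nat.sub_add_cancel h1]
  have hd : (derivative q).natDegree = n - 1 := by
    refine natDegree_eq_of_le_of_coeff_ne_zero ?_ (by rw [hc]; exact h0)
    rw [← hn]; exact natDegree_derivative_le q
  refine ⟨hd, ?_⟩
  rw [leadingCoeff, hd, hc]

lemma HH_splits {K : Type*} [Field K] {n : ℕ} {q : K[X]} (hq : q.Monic)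
    (hn : q.natDegree = n) (h1 : 1 ≤ n) (h0 : (n : K) ≠ 0) (hs : (derivative q).Splits) :
    HH n q = C ((n:K)^n) * ((derivative q).roots.map (fun r => X + C (q.eval r))).prod := by
  obtain ⟨hd, hl⟩ := natDegree_deriv_eq hq hn h1 h0
  unfold HH
  have hdm : ((derivative q).map (C : K →+* K[X])).natDegree = n - 1 := by
    rw [natDegree_map_eq_of_injective C_injective, hd]
  have := resultant_eq_prod_eval ((derivative q).map (C : K →+* K[X])) (q.map C + C X) n
    (natDegree_add_le_of_degree_le (natDegree_map_le.trans hn.le) (by simp)) (hs.map _)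
  rw [hdm] at this
  rw [this, hs.roots_map, leadingCoeff_map_of_injective C_injective, hl, Multiset.map_map]
  congr 1
  · simp
  · congr 1
    apply Multiset.map_congr rfl
    intro r _
    simp [eval_map, eval₂_at_apply, add_comm]

lemma HH_natDegree {K : Type*} [Field K] {n : ℕ} {q : K[X]} (hq : q.Monic)
    (hn : q.natDegree = n) (h1 : 1 ≤ n) (h0 : (n : K) ≠ 0) (hs : (derivative q).Splits) :
    (HH n q).natDegree = n - 1 ∧ (HH n q).leadingCoeff = (n:K)^n := by
  have hm : ((derivative q).roots.map (fun r => X + C (q.eval r))).prod.Monic :=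
    monic_multiset_prod_of_monic _ _ (fun r _ => monic_X_add_C _)
  rw [HH_splits hq hn h1 h0 hs]
  constructor
  · rw [natDegree_C_mul (pow_ne_zero _ h0), natDegree_multiset_prod_of_monic _ (by
      intro f hf; simp only [Multiset.mem_map] at hf; obtain ⟨r, _, rfl⟩ := hf
      exact monic_X_add_C _)]
    simp [Function.comp_def, ← hs.natDegree_eq_card_roots, (natDegree_deriv_eq hq hn h1 h0).1]
  · rw [leadingCoeff_C_mul_of_isUnit (isUnit_iff_ne_zero.2 (pow_ne_zero _ h0)), hm.leadingCoeff,
      mul_one]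

lemma HH_int {n : ℕ} {q : ℤ[X]} (hq : q.Monic) (hn : q.natDegree = n) (h1 : 1 ≤ n) :
    (HH n q).natDegree = n - 1 ∧ (HH n q).leadingCoeff = (n:ℤ)^n := by
  have inj : Function.Injective (Int.castRingHom ℂ) := Int.cast_injective
  have := HH_natDegree (hq.map (Int.castRingHom ℂ))
    (by rw [natDegree_map_eq_of_injective inj, hn]) h1 (by norm_cast; omega)
    (IsAlgClosed.splits _)
  rw [HH_map, natDegree_map_eq_of_injective inj, leadingCoeff_map_of_injective inj] at this
  refine ⟨this.1, ?_⟩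
  have h2 := this.2
  simp only [eq_intCast] at h2
  exact_mod_cast h2

open Classical in
lemma NR_sq_dvd {n : ℕ} (hn3 : 3 ≤ n) {E : Type*} [Field E] [IsAlgClosed E] (h0 : (n:E) ≠ 0)
    (h : E[X]) (hm : h.Monic) (hd : h.natDegree = n) (hr : h.roots.toFinset.card ≤ n - 2) :
    X^2 ∣ HH n h := by
  have hd' : derivative h ≠ 0 := by
    have := (natDegree_deriv_eq hm hd (by omega) h0).1
    intro h; rw [h] at this; simp at this; omega
  rw [HH_splits hm hd (by omega) h0 (IsAlgClosed.splits _)]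
  apply Dvd.dvd.mul_left
  have hcard : h.roots.card = n := by
    rw [← hd]; exact (IsAlgClosed.splits h).natDegree_eq_card_roots.symm
  have hle : h.roots - h.roots.dedup ≤ (derivative h).roots := by
    rw [Multiset.le_iff_count]
    intro a
    rw [Multiset.count_sub, Multiset.count_dedup, count_roots, count_roots]
    by_cases ha : a ∈ h.roots
    · rw [if_pos ha]
      exact rootMultiplicity_sub_one_le_derivative_rootMultiplicity_of_ne_zero _ _ hd'
    · rw [if_neg ha, ← count_roots, Multiset.count_eq_zero_of_notMem ha]; simp
  have hc2 : 2 ≤ (h.roots - h.roots.dedup).card := by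
    rw [Multiset.card_sub (Multiset.dedup_le _), hcard]
    have : Multiset.card h.roots.dedup = h.roots.toFinset.card := rfl
    omega
  refine dvd_trans ?_ (Multiset.prod_dvd_prod_of_le (Multiset.map_le_map hle))
  rw [Multiset.map_congr rfl (g := fun _ => (X:E[X]))]
  · rw [Multiset.map_const', Multiset.prod_replicate]
    exact pow_dvd_pow _ hc2
  · intro a ha
    have : a ∈ h.roots := Multiset.mem_of_le (Multiset.sub_le_self _ _) ha
    rw [mem_roots hm.ne_zero] at this
    rw [this.eq_zero]; simp

lemma NR_dvd {n p : ℕ} (hn3 : 3 ≤ n) (hp : p.Prime) (hpn : n < p) {h0 : ℤ[X]} (hm : h0.Monic)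
    (hd : h0.natDegree = n) (t0 : ℤ) (hNR : NR p (h0 + C t0) (n-2)) :
    (p:ℤ) ∣ (HH n h0).eval t0 ∧ (p:ℤ) ∣ DD n h0 := by
  classical
  obtain ⟨F, _, _, s, t, hst, ht, hfac⟩ := hNR
  let E := AlgebraicClosure F
  haveI : CharP E p := charP_of_injective_algebraMap (algebraMap F E).injective p
  have hnE : (n:E) ≠ 0 := by
    rw [Ne, CharP.cast_eq_zero_iff E p]
    intro h; exact absurd (Nat.le_of_dvd (by omega) h) (by omega)
  set φ := Int.castRingHom E with hφ
  have hm1 : (h0 + C t0).Monic := hm.add_of_left (by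
    rw [degree_eq_natDegree hm.ne_zero, hd]; exact lt_of_le_of_lt degree_C_le (by exact_mod_cast (by omega)))
  have hd1 : (h0 + C t0).natDegree = n := by rw [natDegree_add_C, hd]
  have hfE : (h0 + C t0).map φ = ((s.map (algebraMap F E)).map (fun a => X - C a)).prod := by
    rw [show φ = (algebraMap F E).comp (Int.castRingHom F) from RingHom.ext_int _ _, ← map_map, hfac,
      Polynomial.map_multiset_prod, Multiset.map_map, Multiset.map_map]
    congr 1; apply Multiset.map_congr rfl; intro a _; simp
  have hsq : X^2 ∣ HH n ((h0 + C t0).map φ) := by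
    refine NR_sq_dvd hn3 hnE _ (hm1.map _) (by rw [hm1.natDegree_map, hd1]) ?_
    rw [hfE, roots_multiset_prod_X_sub_C]
    refine le_trans ?_ ht
    refine le_trans (Finset.card_le_card (t := t.image (algebraMap F E)) ?_) Finset.card_image_le
    intro a ha
    simp only [Multiset.mem_toFinset, Multiset.mem_map, Finset.mem_image] at ha ⊢
    obtain ⟨b, hb, rfl⟩ := ha
    exact ⟨b, hst b hb, rfl⟩
  rw [Polynomial.map_add, map_C, HH_add_C, HH_map] at hsq
  have hsq2 : (X - C (φ t0))^2 ∣ (HH n h0).map φ := by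
    obtain ⟨u, hu⟩ := hsq
    refine ⟨u.comp (X - C (φ t0)), ?_⟩
    have := congrArg (fun q => q.comp (X - C (φ t0))) hu
    simpa [comp_assoc, mul_comp] using this
  have he1 : ((HH n h0).map φ).eval (φ t0) = 0 := by
    obtain ⟨u, hu⟩ := hsq2; rw [hu]; simp
  have he2 : (derivative ((HH n h0).map φ)).eval (φ t0) = 0 := by
    obtain ⟨u, hu⟩ := hsq2; rw [hu]; simp [derivative_pow]
  have key : ∀ z : ℤ, φ z = 0 → (p:ℤ) ∣ z := fun z hz => (CharP.intCast_eq_zero_iff E p z).1 hz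
  refine ⟨key _ ?_, key _ ?_⟩
  · rw [eval_map, eval₂_at_apply] at he1; exact he1
  · have hHd := (HH_int hm hd (by omega)).1
    obtain ⟨u, v, _, _, huv⟩ := exists_mul_add_mul_eq_C_resultant (m := n-1) (n := n-2) (HH n h0)
      (derivative (HH n h0)) hHd.le ((natDegree_derivative_le _).trans (by omega)) (by omega)
    have := congrArg (fun q => (q.map φ).eval (φ t0)) huv
    simp only [Polynomial.map_add, Polynomial.map_mul, eval_add, eval_mul, map_C, eval_C,
      ← derivative_map, he1, he2, zero_mul, add_zero] at this
    exact this.symm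
end

section
open Polynomial

noncomputable def FF (n : ℕ) (q : ℤ[X]) : ℤ[X] := DD n (q.map C + C X * X)

lemma FF_eval (n : ℕ) (q : ℤ[X]) (s : ℤ) : (FF n q).eval s = DD n (q + C s * X) := by
  have := DD_map (evalRingHom s) n (q.map C + C X * X)
  rw [coe_evalRingHom] at this
  rw [FF, ← this]
  congr 1
  simp only [Polynomial.map_add, map_map, Polynomial.map_mul, map_C, map_X, coe_evalRingHom, eval_X]
  rw [show (evalRingHom s).comp (C : ℤ →+* ℤ[X]) = RingHom.id ℤ from RingHom.ext_int _ _, map_id]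

lemma deriv_scaleRoots {n : ℕ} (h : ℂ[X]) (hm : h.Monic) (hd : h.natDegree = n) (h1 : 1 ≤ n)
    (l : ℂ) : derivative (h.scaleRoots l) = (derivative h).scaleRoots l := by
  ext i
  rw [coeff_derivative, coeff_scaleRoots, coeff_scaleRoots, coeff_derivative, hd,
    (natDegree_deriv_eq hm hd h1 (by norm_cast; omega)).1]
  rw [show n - 1 - i = n - (i+1) by omega]; ring

lemma deriv_scaleRoots' (h : ℂ[X]) (h0 : h.natDegree ≠ 0)
    (l : ℂ) : derivative (h.scaleRoots l) = (derivative h).scaleRoots l := by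
  ext i
  have : (derivative h).natDegree = h.natDegree - 1 := natDegree_derivative _
  rw [coeff_derivative, coeff_scaleRoots, coeff_scaleRoots, coeff_derivative, this]
  rw [show h.natDegree - 1 - i = h.natDegree - (i+1) by omega]; ring

lemma scaleRoots_prod (m : Multiset ℂ) (μ : ℂ) :
    ((m.map (fun a => X + C a)).prod).scaleRoots μ = (m.map (fun a => X + C (a * μ))).prod := by
  induction m using Multiset.induction with
  | empty => simp
  | cons a s ih =>
    rw [Multiset.map_cons, Multiset.prod_cons, mul_scaleRoots_of_noZeroDivisors, ih,
      X_add_C_scaleRoots, Multiset.map_cons, Multiset.prod_cons]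

lemma HH_scale {n : ℕ} (h : ℂ[X]) (hm : h.Monic) (hd : h.natDegree = n) (h1 : 1 ≤ n)
    (l : ℂ) (hl : l ≠ 0) : HH n (h.scaleRoots l) = (HH n h).scaleRoots (l^n) := by
  have hn : (n:ℂ) ≠ 0 := by norm_cast; omega
  rw [HH_splits ((monic_scaleRoots_iff l).2 hm) (by rw [natDegree_scaleRoots, hd]) h1 hn
    (IsAlgClosed.splits _), HH_splits hm hd h1 hn (IsAlgClosed.splits _),
    mul_scaleRoots_of_noZeroDivisors, scaleRoots_C]
  congr 1
  have e := scaleRoots_prod ((derivative h).roots.map (fun r => h.eval r)) (l^n)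
  rw [Multiset.map_map] at e
  refine Eq.trans ?_ e.symm
  rw [deriv_scaleRoots h hm hd h1, roots_scaleRoots _ (isUnit_iff_ne_zero.2 hl), Multiset.map_map,
    Multiset.map_map]
  congr 1
  apply Multiset.map_congr rfl
  intro r _
  simp only [Function.comp]
  rw [scaleRoots_eval_mul, hd, mul_comm]

lemma DD_scale {n : ℕ} (h : ℂ[X]) (hm : h.Monic) (hd : h.natDegree = n) (h1 : 2 ≤ n)
    (l : ℂ) (hl : l ≠ 0) : DD n (h.scaleRoots l) = (l^(n-1))^(n*(n-2)) * DD n h := by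
  have hn : (n:ℂ) ≠ 0 := by norm_cast; omega
  have hH := (HH_natDegree hm hd (by omega) hn (IsAlgClosed.splits _)).1
  unfold DD
  have e := resultant_scaleRoots (HH n h) (derivative (HH n h)) (l^n)
  have hH' : (derivative (HH n h)).natDegree = n - 2 := by
    rw [natDegree_derivative, hH]; omega
  rw [natDegree_scaleRoots, natDegree_scaleRoots, hH, hH'] at e
  rw [HH_scale h hm hd (by omega) l hl, deriv_scaleRoots' _ (by omega), e]
  ring

lemma HH_coprime {n : ℕ} (h1 : 2 ≤ n) :
    IsCoprime (HH n (X^n + X : ℂ[X])) (derivative (HH n (X^n + X : ℂ[X]))) := by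
  change (HH n (X^n + X : ℂ[X])).Separable
  have hn : (n:ℂ) ≠ 0 := by norm_cast; omega
  have hm : (X^n + X : ℂ[X]).Monic := monic_X_pow_add (by
    rw [degree_X]; exact_mod_cast (by omega : 1 < n))
  have hd : (X^n + X : ℂ[X]).natDegree = n := by
    rw [natDegree_add_eq_left_of_natDegree_lt] <;> simp; omega
  have hH := HH_splits hm hd (by omega) hn (IsAlgClosed.splits _)
  have hne : HH n (X^n + X : ℂ[X]) ≠ 0 := by
    intro h0
    have := (HH_natDegree hm hd (by omega) hn (IsAlgClosed.splits _)).2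
    rw [h0, leadingCoeff_zero] at this; exact pow_ne_zero _ hn this.symm
  rw [← nodup_roots_iff_of_splits hne (IsAlgClosed.splits _), hH, roots_C_mul _ (pow_ne_zero _ hn)]
  have e : ((derivative (X^n + X : ℂ[X])).roots.map (fun r => X + C ((X^n + X : ℂ[X]).eval r)))
    = ((derivative (X^n + X : ℂ[X])).roots.map (fun r => -((X^n + X : ℂ[X]).eval r))).map
      (fun a => X - C a) := by
    rw [Multiset.map_map]; apply Multiset.map_congr rfl; intro r _; simp; ring
  have hder : derivative (X^n + X : ℂ[X]) = C (n:ℂ) * (X^(n-1) - C (-1/(n:ℂ))) := by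
    simp only [derivative_add, derivative_X_pow, derivative_X, mul_sub, ← C_mul]
    rw [show (n:ℂ) * (-1 / n) = -1 by field_simp]; simp
  have hne' : (X^(n-1) - C (-1/(n:ℂ)) : ℂ[X]) ≠ 0 := by
    apply (monic_X_pow_sub_C _ (by omega)).ne_zero
  rw [e, roots_multiset_prod_X_sub_C]
  refine Multiset.Nodup.map_on ?_ ?_
  · intro x hx y hy hxy
    have key : ∀ x ∈ (derivative (X^n + X : ℂ[X])).roots,
        (X^n + X : ℂ[X]).eval x = x * (1 - 1/n) := by
      intro x hx
      rw [hder, roots_C_mul _ hn, mem_roots hne'] at hx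
      have hx' : x^(n-1) = -1/n := by
        have := hx.eq_zero; simp at this; linear_combination this
      simp only [eval_add, eval_pow, eval_X]
      rw [show x^n = x * x^(n-1) by rw [← pow_succ']; congr 1; omega, hx']; ring
    rw [key x hx, key y hy, neg_inj] at hxy
    refine mul_right_cancel₀ ?_ hxy
    have : (n:ℂ) ≠ 1 := by norm_cast; omega
    rw [one_sub_div hn]; exact div_ne_zero (sub_ne_zero.2 this) hn
  · rw [hder, roots_C_mul _ hn]
    exact nodup_roots (separable_X_pow_sub_C _ (by norm_cast; omega) (div_ne_zero (by norm_num) hn))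

lemma c0_ne_zero {n : ℕ} (h1 : 2 ≤ n) : DD n (X^n + X : ℤ[X]) ≠ 0 := by
  have hn : (n:ℂ) ≠ 0 := by norm_cast; omega
  have hm : (X^n + X : ℂ[X]).Monic := monic_X_pow_add (by
    rw [degree_X]; exact_mod_cast (by omega : 1 < n))
  have hd : (X^n + X : ℂ[X]).natDegree = n := by
    rw [natDegree_add_eq_left_of_natDegree_lt] <;> simp; omega
  have hH := (HH_natDegree hm hd (by omega) hn (IsAlgClosed.splits _)).1
  have hH' : (derivative (HH n (X^n + X : ℂ[X]))).natDegree = n - 2 := by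
    rw [natDegree_derivative, hH]; omega
  intro h
  have e := DD_map (Int.castRingHom ℂ) n (X^n + X)
  rw [h] at e
  simp only [Polynomial.map_add, Polynomial.map_pow, map_X, map_zero] at e
  have := resultant_ne_zero _ _ (HH_coprime h1)
  rw [hH, hH'] at this
  exact this e

open Filter Topology in
lemma FF_lead {n : ℕ} (h1 : 2 ≤ n) {q : ℤ[X]} (hm : q.Monic) (hd : q.natDegree = n) :
    (FF n q).natDegree = n*(n-2) ∧ (FF n q).leadingCoeff = DD n (X^n + X : ℤ[X]) := by
  set c0 := DD n (X^n + X : ℤ[X]) with hc0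
  set G : ℤ[X] := DD n ((q.map C).scaleRoots X + X) with hG
  have inj : Function.Injective (Int.castRingHom ℝ) := Int.cast_injective
  have injC : Function.Injective (Int.castRingHom ℂ) := Int.cast_injective
  -- evaluation identities
  have hFe : ∀ s : ℝ, ((((FF n q).map (Int.castRingHom ℝ)).eval s : ℝ) : ℂ)
      = DD n (q.map (Int.castRingHom ℂ) + C (s:ℂ) * X) := by
    intro s
    have := DD_map (eval₂RingHom (Int.castRingHom ℂ) (s:ℂ)) n (q.map C + C X * X)
    simp only [Polynomial.map_add, Polynomial.map_map, Polynomial.map_mul, map_C, map_X, coe_eval₂RingHom,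
      eval₂_X] at this
    rw [show (eval₂RingHom (Int.castRingHom ℂ) (s:ℂ)).comp C = Int.castRingHom ℂ from
      RingHom.ext_int _ _] at this
    rw [this, FF, eval_map, ← Complex.ofRealHom_eq_coe, hom_eval₂]
    congr 1
  have hGe : ∀ s : ℝ, (((G.map (Int.castRingHom ℝ)).eval s : ℝ) : ℂ)
      = DD n ((q.map (Int.castRingHom ℂ)).scaleRoots (s:ℂ) + X) := by
    intro s
    have := DD_map (eval₂RingHom (Int.castRingHom ℂ) (s:ℂ)) n ((q.map C).scaleRoots X + X)
    rw [Polynomial.map_add, map_scaleRoots _ _ _ (by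
      rw [(hm.map C).leadingCoeff]; simp), Polynomial.map_map] at this
    simp only [map_X, coe_eval₂RingHom, eval₂_X] at this
    rw [show (eval₂RingHom (Int.castRingHom ℂ) (s:ℂ)).comp C = Int.castRingHom ℂ from
      RingHom.ext_int _ _] at this
    rw [this, hG, eval_map, ← Complex.ofRealHom_eq_coe, hom_eval₂]
    congr 1
  have hG0 : (G.map (Int.castRingHom ℝ)).eval 0 = c0 := by
    have := hGe 0
    rw [Complex.ofReal_zero, scaleRoots_zero, (hm.map _).leadingCoeff, one_smul,
      hm.natDegree_map, hd] at this
    have e := DD_map (Int.castRingHom ℂ) n (X^n + X)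
    simp only [Polynomial.map_add, Polynomial.map_pow, map_X] at e
    rw [e] at this
    simp only [eq_intCast] at this
    exact_mod_cast this
  have hid : ∀ l : ℝ, 0 < l → ((FF n q).map (Int.castRingHom ℝ)).eval ((l⁻¹)^(n-1)) /
      ((X:ℝ[X])^(n*(n-2))).eval ((l⁻¹)^(n-1)) = (G.map (Int.castRingHom ℝ)).eval l := by
    intro l hl
    have hl' : (l:ℂ) ≠ 0 := by exact_mod_cast hl.ne'
    have hmq : (q.map (Int.castRingHom ℂ) + C ((((l⁻¹)^(n-1) : ℝ)):ℂ) * X).Monic := by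
      refine (hm.map _).add_of_left ?_
      rw [degree_eq_natDegree (hm.map _).ne_zero, hm.natDegree_map, hd]
      exact lt_of_le_of_lt (degree_C_mul_X_le _) (by exact_mod_cast (by omega : 1 < n))
    have hdq : (q.map (Int.castRingHom ℂ) + C ((((l⁻¹)^(n-1) : ℝ)):ℂ) * X).natDegree = n := by
      rw [natDegree_add_eq_left_of_natDegree_lt, hm.natDegree_map, hd]
      rw [hm.natDegree_map, hd]
      exact lt_of_le_of_lt (natDegree_C_mul_le _ _) (by rw [natDegree_X]; omega)
    have h2 := DD_scale _ hmq hdq h1 l hl'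
    rw [← hFe] at h2
    have h3 : (q.map (Int.castRingHom ℂ) + C ((((l⁻¹)^(n-1) : ℝ)):ℂ) * X).scaleRoots l
        = (q.map (Int.castRingHom ℂ)).scaleRoots (l:ℂ) + X := by
      ext i
      rw [coeff_scaleRoots, hdq, coeff_add, coeff_add, coeff_scaleRoots, hm.natDegree_map, hd,
        coeff_C_mul, add_mul]
      congr 1
      by_cases hi : i = 1
      · subst hi; rw [coeff_X_one]; push_cast; rw [mul_one, ← mul_pow, inv_mul_cancel₀ hl', one_pow]
      · rw [coeff_X_of_ne_one hi]; simp
    rw [h3, ← hGe] at h2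
    have h4 : (G.map (Int.castRingHom ℝ)).eval l = (l^(n-1))^(n*(n-2)) *
      ((FF n q).map (Int.castRingHom ℝ)).eval ((l⁻¹)^(n-1)) := by exact_mod_cast h2
    rw [h4, eval_pow, eval_X, inv_pow, inv_pow]
    rw [div_eq_mul_inv, inv_inv, mul_comm]
  have ht1 : Tendsto (fun l : ℝ => (l⁻¹)^(n-1)) (𝓝[>] 0) atTop :=
    (tendsto_pow_atTop (by omega)).comp tendsto_inv_nhdsGT_zero
  have htG : Tendsto (fun l : ℝ => ((FF n q).map (Int.castRingHom ℝ)).eval ((l⁻¹)^(n-1)) /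
      ((X:ℝ[X])^(n*(n-2))).eval ((l⁻¹)^(n-1))) (𝓝[>] 0) (𝓝 (c0:ℝ)) := by
    have hc : Tendsto (fun l : ℝ => (G.map (Int.castRingHom ℝ)).eval l) (𝓝[>] 0) (𝓝 (c0:ℝ)) := by
      rw [← hG0]
      exact ((Polynomial.continuous _).tendsto _).mono_left nhdsWithin_le_nhds
    refine hc.congr' ?_
    filter_upwards [self_mem_nhdsWithin] with l hl
    exact (hid l hl).symm
  have hc0' : (c0:ℝ) ≠ 0 := by exact_mod_cast c0_ne_zero h1
  set P := (FF n q).map (Int.castRingHom ℝ) with hP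
  set Q := ((X:ℝ[X])^(n*(n-2))) with hQ
  have hPd : P.natDegree = (FF n q).natDegree := natDegree_map_eq_of_injective inj _
  have hPl : P.leadingCoeff = (FF n q).leadingCoeff := by
    rw [hP, leadingCoeff_map_of_injective inj]; simp
  have hdeg : P.degree = Q.degree := by
    rcases lt_trichotomy P.degree Q.degree with h | h | h
    · exfalso
      have := (div_tendsto_atTop_zero_of_degree_lt P Q h).comp ht1
      exact hc0' (tendsto_nhds_unique htG this)
    · exact h
    · exfalso
      have hQ0 : Q ≠ 0 := pow_ne_zero _ X_ne_zero
      have := (abs_div_tendsto_atTop_atTop_of_degree_gt P Q h hQ0).comp ht1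
      exact not_tendsto_nhds_of_tendsto_atTop this _ htG.abs
  have hlc := (div_tendsto_atTop_leadingCoeff_div_of_degree_eq P Q hdeg).comp ht1
  have hlc' := tendsto_nhds_unique htG hlc
  constructor
  · rw [← hPd, natDegree_eq_of_degree_eq hdeg, natDegree_X_pow]
  · rw [hPl, hQ, leadingCoeff_X_pow, div_one] at hlc'
    exact_mod_cast hlc'.symm

lemma mv_bound {σ : Type*} (U : MvPolynomial σ ℤ) : ∃ A : ℕ, ∀ B : ℕ, 1 ≤ B → ∀ x : σ → ℤ,
    (∀ i, |x i| ≤ B) → |MvPolynomial.eval x U| ≤ A * (B:ℤ)^A := by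
  refine ⟨(∑ d ∈ U.support, (U.coeff d).natAbs) + U.totalDegree, fun B hB x hx => ?_⟩
  have hB' : (1:ℤ) ≤ B := by exact_mod_cast hB
  rw [MvPolynomial.eval_eq]
  refine (Finset.abs_sum_le_sum_abs _ _).trans ?_
  have h1 : ∀ d ∈ U.support, |U.coeff d * ∏ i ∈ d.support, x i ^ d i| ≤
      ((U.coeff d).natAbs : ℤ) * (B:ℤ)^((∑ d ∈ U.support, (U.coeff d).natAbs) + U.totalDegree) := by
    intro d hd
    rw [abs_mul, Int.natCast_natAbs, Finset.abs_prod]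
    refine mul_le_mul_of_nonneg_left ?_ (abs_nonneg _)
    calc ∏ i ∈ d.support, |x i ^ d i| ≤ ∏ i ∈ d.support, (B:ℤ)^d i := by
          refine Finset.prod_le_prod (fun _ _ => abs_nonneg _) fun i _ => ?_
          rw [abs_pow]; exact pow_le_pow_left₀ (abs_nonneg _) (hx i) _
      _ = (B:ℤ)^(∑ i ∈ d.support, d i) := Finset.prod_pow_eq_pow_sum _ _ _
      _ ≤ _ := by
          apply pow_le_pow_right₀ hB'
          exact (MvPolynomial.le_totalDegree hd).trans (Nat.le_add_left _ _)
  refine (Finset.sum_le_sum h1).trans ?_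
  rw [← Finset.sum_mul]
  refine mul_le_mul_of_nonneg_right ?_ (by positivity)
  push_cast; linarith [Int.natCast_nonneg U.totalDegree]

lemma DD_bound (n : ℕ) : ∃ A : ℕ, ∀ B : ℕ, 1 ≤ B → ∀ h : ℤ[X], h.Monic → h.natDegree = n →
    (∀ i < n, |h.coeff i| ≤ B) → |DD n h| ≤ A * (B:ℤ)^A := by
  obtain ⟨A, hA⟩ := mv_bound (DD n (X^n + ∑ i : Fin n, C (MvPolynomial.X i) * X^(i:ℕ) :
    (MvPolynomial (Fin n) ℤ)[X]))
  refine ⟨A, fun B hB h hm hd hc => ?_⟩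
  have := hA B hB (fun i => h.coeff i) (fun i => hc i i.2)
  rw [← DD_map] at this
  convert this
  conv_lhs => rw [hm.as_sum, hd]
  simp only [Polynomial.map_add, Polynomial.map_pow, map_X, Polynomial.map_sum, Polynomial.map_mul,
    map_C, MvPolynomial.eval_X]
  rw [Fin.sum_univ_eq_sum_range (fun i => C (h.coeff i) * X^i)]
end

section
open Polynomial

noncomputable def polyOf {n : ℕ} (a : Fin n → ℤ) : ℤ[X] := X^n + ∑ i : Fin n, C (a i) * X^(i:ℕ)

lemma polyOf_aux {n : ℕ} (a : Fin n → ℤ) : (∑ i : Fin n, C (a i) * X^(i:ℕ) : ℤ[X]).degree < (n : WithBot ℕ) := by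
  refine lt_of_le_of_lt (degree_sum_le _ _) ?_
  rw [Finset.sup_lt_iff (by exact WithBot.bot_lt_coe n)]
  intro i _
  exact lt_of_le_of_lt (degree_C_mul_X_pow_le _ _) (by exact_mod_cast i.2)

lemma polyOf_monic {n : ℕ} (a : Fin n → ℤ) : (polyOf a).Monic := monic_X_pow_add (polyOf_aux a)

lemma polyOf_natDegree {n : ℕ} (a : Fin n → ℤ) : (polyOf a).natDegree = n := by
  apply natDegree_eq_of_degree_eq_some
  unfold polyOf
  rw [degree_add_eq_left_of_degree_lt, degree_X_pow]
  rw [degree_X_pow]; exact polyOf_aux a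

lemma polyOf_coeff {n : ℕ} (a : Fin n → ℤ) (i : Fin n) : (polyOf a).coeff i = a i := by
  unfold polyOf
  rw [coeff_add, coeff_X_pow, if_neg (by omega), zero_add, finset_sum_coeff]
  rw [Finset.sum_eq_single i]
  · simp
  · intro j _ hj
    rw [coeff_C_mul_X_pow, if_neg]
    intro h; exact hj (Fin.ext h.symm)
  · simp

lemma polyOf_coeff_eq {n : ℕ} {h : ℤ[X]} (hm : h.Monic) (hd : h.natDegree = n) :
    polyOf (fun i : Fin n => h.coeff i) = h := by
  conv_rhs => rw [hm.as_sum, hd]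
  unfold polyOf
  rw [Fin.sum_univ_eq_sum_range (fun i => C (h.coeff i) * X^i)]

lemma polyOf_cons_aux {m : ℕ} (t s : ℤ) (b : Fin m → ℤ) :
    polyOf (Fin.cons t (Fin.cons s b : Fin (m+1) → ℤ) : Fin (m+2) → ℤ) =
    (polyOf (Fin.cons 0 (Fin.cons 0 b : Fin (m+1) → ℤ) : Fin (m+2) → ℤ) + C s * X) + C t := by
  unfold polyOf
  simp only [Fin.sum_univ_succ, Fin.cons_zero, Fin.cons_succ, Fin.val_zero, Fin.val_succ]
  simp
  ring

lemma sum_sqf_dvd_le (M m : ℕ) (D : Finset ℕ) (hD : ∀ d ∈ D, Squarefree d ∧ d.primeFactors ⊆ m.primeFactors) :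
    ∑ d ∈ D, (M:ℝ)^d.primeFactors.card ≤ ((M+1:ℕ):ℝ)^m.primeFactors.card := by
  have := Finset.sum_pow_mul_eq_add_pow (M:ℝ) 1 m.primeFactors
  simp only [one_pow, mul_one] at this
  push_cast
  rw [← this]
  have hinj : Set.InjOn Nat.primeFactors (D : Set ℕ) := by
    intro x hx y hy hxy
    rw [← Nat.prod_primeFactors_of_squarefree (hD x hx).1,
      ← Nat.prod_primeFactors_of_squarefree (hD y hy).1]
    rw [hxy]
  rw [← Finset.sum_image (f := fun U => (M:ℝ)^U.card) hinj]
  apply Finset.sum_le_sum_of_subset_of_nonneg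
  · intro U hU
    obtain ⟨d, hd, rfl⟩ := Finset.mem_image.1 hU
    exact Finset.mem_powerset.2 (hD d hd).2
  · intros; positivity

def GoodC (n : ℕ) (Z : ℝ) (h : ℤ[X]) : Prop :=
  ∃ C : ℕ, Squarefree C ∧ Z ≤ C ∧ ∀ p, p.Prime → p ∣ C → n < p ∧ NR p h (n-2)

/-- count of the last coefficient -/
lemma box_t {m : ℕ} (hm : 1 ≤ m) (S0 : ℕ) (Z : ℝ) (hZ : 0 < Z) (h0 : ℤ[X]) (hmon : h0.Monic)
    (hd : h0.natDegree = m+2) (hF : DD (m+2) h0 ≠ 0) (T : Finset ℤ)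
    (hT : T ⊆ Finset.Icc (-(S0:ℤ)) S0) (h : ∀ t ∈ T, GoodC (m+2) Z (h0 + C t)) :
    (T.card : ℝ) ≤ (((m+2)^(m+2)+1 : ℕ):ℝ)^(DD (m+2) h0).natAbs.primeFactors.card * (2*S0/Z+2) := by
  classical
  set M := (m+2)^(m+2) with hM
  set D := (DD (m+2) h0).natAbs.divisors.filter (fun d : ℕ => Squarefree d ∧ Z ≤ (d:ℝ)) with hD
  have hcov : T ⊆ D.biUnion (fun d => T.filter (fun t => (d:ℤ) ∣ (HH (m+2) h0).eval t)) := by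
    intro t ht
    obtain ⟨C, hC, hZC, hp⟩ := h t ht
    rw [Finset.mem_biUnion]
    have hdv : ∀ z : ℤ, (∀ p, p.Prime → p ∣ C → (p:ℤ) ∣ z) → (C:ℤ) ∣ z := by
      intro z hz
      rw [Int.natCast_dvd]
      rw [← Nat.prod_primeFactors_of_squarefree hC]
      apply Finset.prod_primes_dvd
      · intro p hp; exact (Nat.prime_of_mem_primeFactors hp).prime
      · intro p hp
        exact Int.natCast_dvd.1 (hz p (Nat.prime_of_mem_primeFactors hp) (Nat.dvd_of_mem_primeFactors hp))
    have hdd := fun p hpp hpC => NR_dvd (by omega) hpp (hp p hpp hpC).1 hmon hd t (hp p hpp hpC).2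
    refine ⟨C, ?_, ?_⟩
    · rw [hD, Finset.mem_filter, Nat.mem_divisors]
      refine ⟨⟨Int.natCast_dvd.1 (hdv _ fun p h1 h2 => (hdd p h1 h2).2), by simpa using hF⟩, hC, hZC⟩
    · rw [Finset.mem_filter]
      exact ⟨ht, hdv _ fun p h1 h2 => (hdd p h1 h2).1⟩
  have hHd := HH_int hmon hd (by omega)
  have h1 : ∀ d ∈ D, ((T.filter (fun t => (d:ℤ) ∣ (HH (m+2) h0).eval t)).card : ℝ) ≤
      (M:ℝ)^d.primeFactors.card * (2*S0/Z+2) := by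
    intro d hd
    rw [hD, Finset.mem_filter] at hd
    refine (card_dvd_eval_le (HH (m+2) h0) M S0 d hd.2.1 ?_ ?_ ?_ _
      ((Finset.filter_subset _ _).trans hT) (fun x hx => (Finset.mem_filter.1 hx).2)).trans ?_
    · rw [hHd.2]; positivity
    · rw [hHd.1, hM]
      calc m + 2 - 1 ≤ (m+2)^1 := by rw [pow_one]; omega
        _ ≤ _ := Nat.pow_le_pow_right (by omega) (by omega)
    · rw [hHd.2, hM, Int.natAbs_pow]; exact le_of_eq rfl
    · have : (0:ℝ) < d := lt_of_lt_of_le hZ hd.2.2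
      have := hd.2.2
      gcongr
  calc (T.card : ℝ) ≤ ((D.biUnion (fun d => T.filter (fun t => (d:ℤ) ∣ (HH (m+2) h0).eval t))).card : ℝ) := by
        exact_mod_cast Finset.card_le_card hcov
    _ ≤ ∑ d ∈ D, ((T.filter (fun t => (d:ℤ) ∣ (HH (m+2) h0).eval t)).card : ℝ) := by
        exact_mod_cast Finset.card_biUnion_le
    _ ≤ ∑ d ∈ D, (M:ℝ)^d.primeFactors.card * (2*S0/Z+2) := Finset.sum_le_sum h1
    _ ≤ _ := by
        rw [← Finset.sum_mul]
        refine mul_le_mul_of_nonneg_right ?_ (by positivity)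
        apply sum_sqf_dvd_le
        intro d hd
        rw [hD, Finset.mem_filter, Nat.mem_divisors] at hd
        exact ⟨hd.2.1, Nat.primeFactors_mono hd.1.1 hd.1.2⟩

lemma Icc_card_le (S : ℕ) (hS : 1 ≤ S) : ((Finset.Icc (-(S:ℤ)) S).card : ℝ) ≤ 3 * S := by
  rw [Int.card_Icc]
  have : ((S:ℤ) + 1 - -(S:ℤ)).toNat ≤ 3 * S := by omega
  exact_mod_cast this

theorem boxcount (m : ℕ) (hm : 1 ≤ m) : ∃ c : ℝ, 0 ≤ c ∧ ∃ f : ℕ, ∀ S : Fin (m+2) → ℕ,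
    (∀ i, 1 ≤ S i) → 2 ≤ S 1 → (∀ i, 1 ≤ i → S i ≤ S 1) → ∀ Z : ℝ, 0 < Z →
    ∀ T : Finset (Fin (m+2) → ℤ), (∀ a ∈ T, ∀ i, |a i| ≤ S i) →
    (∀ a ∈ T, GoodC (m+2) Z (polyOf a)) →
    (T.card : ℝ) ≤ c * LL (S 1) ^ f * (∏ i, (S i : ℝ)) * (1/Z + 1/S 0 + 1/S 1) := by
  classical
  obtain ⟨A, hA⟩ := DD_bound (m+2)
  set c0 := (DD (m+2) (X^(m+2) + X : ℤ[X])) with hc0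
  obtain ⟨c, hc, f, hmom⟩ := moment ((m+2)*(m+2-2) + c0.natAbs) ((m+2)^(m+2)) (2*A)
  refine ⟨3^m * (2*c + 3*((m+2)*(m+2-2):ℕ)), by positivity, f, ?_⟩
  intro S hS hS1 hSi Z hZ T hTb hTg
  -- inner count
  have inner : ∀ b : Fin m → ℤ, (∀ i, |b i| ≤ S i.succ.succ) →
      (∑ s ∈ Finset.Icc (-(S 1:ℤ)) (S 1), (((Finset.Icc (-(S 0:ℤ)) (S 0)).filter
        (fun t => (Fin.cons t (Fin.cons s b : Fin (m+1) → ℤ) : Fin (m+2) → ℤ) ∈ T)).card : ℝ)) ≤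
      c * S 1 * LL (S 1)^f * (2*S 0/Z+2) + ((m+2)*(m+2-2):ℕ) * (3 * S 0) := by
    intro b hb
    set q := polyOf (Fin.cons 0 (Fin.cons 0 b : Fin (m+1) → ℤ) : Fin (m+2) → ℤ) with hq
    have hqm : q.Monic := polyOf_monic _
    have hqd : q.natDegree = m+2 := polyOf_natDegree _
    obtain ⟨hFd, hFl⟩ := FF_lead (by omega) hqm hqd
    set F := FF (m+2) q with hF
    have hc0' : c0 ≠ 0 := c0_ne_zero (by omega)
    have hF0 : F ≠ 0 := by rw [← leadingCoeff_ne_zero, hFl]; exact hc0'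
    have hh0 : ∀ s : ℤ, polyOf (Fin.cons 0 (Fin.cons s b : Fin (m+1) → ℤ) : Fin (m+2) → ℤ) = q + C s * X := by
      intro s; rw [polyOf_cons_aux]; simp [hq]
    have hmom1 := hmom (S 1) (hS 1) F (by rw [hFl]; exact hc0') (by rw [hFd]; omega)
      (by rw [hFl]; omega) (by
        intro s hs
        rw [hF, FF_eval, ← hh0]
        refine (hA (S 1) (hS 1) _ (polyOf_monic _) (polyOf_natDegree _) ?_).trans ?_
        · intro i hi
          have := polyOf_coeff (Fin.cons 0 (Fin.cons s b : Fin (m+1) → ℤ) : Fin (m+2) → ℤ) ⟨i, hi⟩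
          simp only at this
          rw [this]
          refine Fin.cases ?_ (fun j => ?_) (⟨i, hi⟩ : Fin (m+2))
          · simp
          · rw [Fin.cons_succ]
            refine Fin.cases ?_ (fun k => ?_) j
            · simpa using hs
            · rw [Fin.cons_succ]
              refine (hb k).trans ?_
              exact_mod_cast hSi _ (by rw [Fin.le_def]; simp)
        · have h2 : (A:ℤ) ≤ (S 1:ℤ)^A := by
            have : A ≤ (S 1)^A := (Nat.lt_two_pow_self).le.trans (Nat.pow_le_pow_left hS1 _)
            exact_mod_cast this
          have h3 : (1:ℤ) ≤ S 1 := by exact_mod_cast hS 1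
          calc (A:ℤ) * (S 1:ℤ)^A ≤ (S 1:ℤ)^A * (S 1:ℤ)^A := by gcongr
            _ = (S 1:ℤ)^(2*A) := by ring
            _ ≤ _ := pow_le_pow_right₀ h3 (by omega))
    rw [← Finset.sum_filter_add_sum_filter_not _ (fun s => F.eval s ≠ 0)]
    apply add_le_add
    · calc _ ≤ ∑ s ∈ (Finset.Icc (-(S 1:ℤ)) (S 1)).filter (fun s => F.eval s ≠ 0),
          (((m+2)^(m+2)+1 : ℕ):ℝ)^(F.eval s).natAbs.primeFactors.card * (2*S 0/Z+2) := by
            apply Finset.sum_le_sum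
            intro s hs
            have hs2 := (Finset.mem_filter.1 hs).2
            rw [hF, FF_eval, ← hh0] at hs2 ⊢
            refine box_t hm (S 0) Z hZ _ (polyOf_monic _) (polyOf_natDegree _) hs2 _
              (Finset.filter_subset _ _) ?_
            intro t ht
            have := hTg _ (Finset.mem_filter.1 ht).2
            rw [polyOf_cons_aux] at this
            rw [hh0]; exact this
        _ ≤ _ := by
            rw [← Finset.sum_mul]
            refine mul_le_mul_of_nonneg_right hmom1 (by positivity)
    · calc _ ≤ ∑ s ∈ (Finset.Icc (-(S 1:ℤ)) (S 1)).filter (fun s => ¬ F.eval s ≠ 0), (3 * S 0 : ℝ) := by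
            apply Finset.sum_le_sum
            intro s hs
            refine le_trans ?_ (Icc_card_le (S 0) (hS 0))
            exact_mod_cast Finset.card_le_card (Finset.filter_subset _ _)
        _ ≤ _ := by
            rw [Finset.sum_const, nsmul_eq_mul]
            refine mul_le_mul_of_nonneg_right ?_ (by positivity)
            rw [← hFd]
            have : ((Finset.Icc (-(S 1:ℤ)) (S 1)).filter (fun s => ¬ F.eval s ≠ 0)).card ≤ F.roots.toFinset.card := by
              apply Finset.card_le_card
              intro s hs
              have := (Finset.mem_filter.1 hs).2
              rw [Multiset.mem_toFinset, mem_roots hF0]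
              simpa using this
            exact_mod_cast this.trans ((Multiset.toFinset_card_le _).trans (card_roots' F))
  -- outer count
  set Bx := Fintype.piFinset (fun i : Fin m => Finset.Icc (-(S i.succ.succ:ℤ)) (S i.succ.succ)) with hBx
  set Y := (Bx ×ˢ Finset.Icc (-(S 1:ℤ)) (S 1)).sigma (fun bs => (Finset.Icc (-(S 0:ℤ)) (S 0)).filter
        (fun t => (Fin.cons t (Fin.cons bs.2 bs.1 : Fin (m+1) → ℤ) : Fin (m+2) → ℤ) ∈ T)) with hY
  have hTY : T.card ≤ Y.card := by
    refine Finset.card_le_card_of_injOn (fun a => ⟨(fun i => a i.succ.succ, a 1), a 0⟩) ?_ ?_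
    · intro a ha
      have hb := hTb a ha
      simp only [hY, hBx, Finset.coe_sigma, Set.mem_sigma_iff, Finset.mem_coe, Finset.mem_product,
        Fintype.mem_piFinset, Finset.mem_Icc, Finset.mem_filter, ← abs_le]
      refine ⟨⟨fun i => hb _, hb _⟩, hb _, ?_⟩
      have ea : (Fin.cons (a 0) (Fin.cons (a 1) (fun i : Fin m => a i.succ.succ) : Fin (m+1) → ℤ) : Fin (m+2) → ℤ) = a := ?_
      · rw [ea]; exact ha
      funext i
      refine Fin.cases rfl (fun j => ?_) i
      refine Fin.cases rfl (fun k => rfl) j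
    · intro a _ a' _ h
      simp only [Sigma.mk.injEq, Prod.mk.injEq, heq_eq_eq] at h
      funext i
      refine Fin.cases h.2 (fun j => ?_) i
      refine Fin.cases h.1.2 (fun k => congrFun h.1.1 k) j
  have hYc : (Y.card : ℝ) ≤ (Bx.card : ℝ) *
      (c * S 1 * LL (S 1)^f * (2*S 0/Z+2) + ((m+2)*(m+2-2):ℕ) * (3 * S 0)) := by
    rw [hY, Finset.card_sigma, Finset.sum_product]
    push_cast
    rw [← nsmul_eq_mul]
    apply Finset.sum_le_card_nsmul
    intro b hb
    have := inner b (fun i => by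
      have := Fintype.mem_piFinset.1 hb i
      rwa [Finset.mem_Icc, ← abs_le] at this)
    push_cast at this
    exact this
  have hBc : (Bx.card : ℝ) ≤ 3^m * ∏ i : Fin m, (S i.succ.succ : ℝ) := by
    rw [hBx, Fintype.card_piFinset]
    push_cast
    calc _ ≤ ∏ i : Fin m, (3 * (S i.succ.succ : ℝ)) :=
          Finset.prod_le_prod (fun _ _ => by positivity) (fun i _ => Icc_card_le _ (hS _))
      _ = _ := by rw [Finset.prod_mul_distrib]; simp
  have hprod : ∏ i, (S i : ℝ) = S 0 * (S 1 * ∏ i : Fin m, (S i.succ.succ : ℝ)) := by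
    rw [Fin.prod_univ_succ, Fin.prod_univ_succ]; rfl
  have hLL := one_le_pow₀ (LL_ge_one (S 1)) (n := f)
  set P := ∏ i : Fin m, (S i.succ.succ : ℝ) with hP
  have hP0 : 0 ≤ P := Finset.prod_nonneg (fun _ _ => by positivity)
  have hS0' : (0:ℝ) < S 0 := by exact_mod_cast hS 0
  have hS1' : (0:ℝ) < S 1 := by exact_mod_cast hS 1
  set L := LL (S 1)^f with hL
  set k : ℝ := (((m+2)*(m+2-2):ℕ):ℝ) with hk
  have hk0 : 0 ≤ k := by positivity
  calc (T.card : ℝ) ≤ Y.card := by exact_mod_cast hTY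
    _ ≤ _ := hYc
    _ ≤ (3^m * P) * (c * S 1 * L * (2*S 0/Z+2) + k * (3 * S 0)) := by
        apply mul_le_mul_of_nonneg_right hBc; positivity
    _ ≤ _ := by
        rw [hprod]
        have e : (S 0:ℝ) * (S 1 * P) * (1/Z+1/S 0 + 1/S 1) = P * (S 1 * (S 0 / Z + 1) + S 0) := by
          field_simp
        have e3 : c * S 1 * L * (2*S 0/Z+2) + k * (3 * S 0) ≤ (2*c+3*k)*(L*(S 1 * (S 0 / Z + 1) + S 0)) := by
          set W := (S 1:ℝ) * (S 0 / Z + 1) with hW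
          have : c * S 1 * L * (2*S 0/Z+2) = 2 * c * L * W := by rw [hW]; ring
          rw [this]
          have h1 : k * S 0 * 1 ≤ k * S 0 * L := by gcongr
          have h2 : 0 ≤ k * L * W := by positivity
          have h3 : 0 ≤ c * L * S 0 := by positivity
          nlinarith
        calc (3^m * P) * (c * S 1 * L * (2*S 0/Z+2) + k * (3 * S 0))
            ≤ (3^m * P) * ((2*c+3*k)*(L*(S 1 * (S 0 / Z + 1) + S 0))) := by
              refine mul_le_mul_of_nonneg_left e3 (by positivity)
          _ = 3^m * (2*c+3*k) * L * (P * (S 1 * (S 0 / Z + 1) + S 0)) := by ring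
          _ = _ := by rw [← e]; ring
end

section
open Polynomial

section
open UniqueFactorizationMonoid

lemma card_nf_le {F : Type*} [Field F] [DecidableEq F] {f : F[X]} (hf : f.Monic) :
    (normalizedFactors f).card ≤ f.natDegree := by
  classical
  have h1 : (normalizedFactors f).prod = f := by
    rw [prod_normalizedFactors_eq hf.ne_zero, hf.normalize_eq_self]
  have hmem := fun q => (Polynomial.mem_normalizedFactors_iff (p := q) hf.ne_zero)
  have h2 : (normalizedFactors f).prod.natDegree = ((normalizedFactors f).map natDegree).sum :=
    natDegree_multiset_prod_of_monic _ (fun q hq => ((hmem q).1 hq).2.1)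
  rw [h1] at h2
  rw [h2]
  have := Multiset.card_nsmul_le_sum (s := (normalizedFactors f).map natDegree) (a := 1) (by
    intro x hx
    obtain ⟨q, hq, rfl⟩ := Multiset.mem_map.1 hx
    exact ((hmem q).1 hq).1.natDegree_pos)
  simpa using this

lemma radical_monic {F : Type*} [Field F] [DecidableEq F] {f : F[X]} (hf : f.Monic) :
    (radical f).Monic := by
  unfold radical
  apply monic_prod_of_monic
  intro q hq
  rw [mem_primeFactors, Polynomial.mem_normalizedFactors_iff hf.ne_zero] at hq
  exact hq.2.1

lemma card_radical_le (p : ℕ) [Fact p.Prime] (n k : ℕ) (T : Finset (ZMod p)[X])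
    (h : ∀ f ∈ T, f.Monic ∧ f.natDegree = n ∧ (radical f).natDegree ≤ k) :
    T.card ≤ 2^(n*n) * ((k+1) * p^k) := by
  classical
  refine (Finset.card_le_mul_card_image (f := radical) T (2^(n*n)) ?_).trans ?_
  · intro r hr
    obtain ⟨f0, hf0, rfl⟩ := Finset.mem_image.1 hr
    have hc : (n • (primeFactors f0).val).powerset.toFinset.card ≤ 2^(n*n) := by
      refine (Multiset.toFinset_card_le _).trans ?_
      rw [Multiset.card_powerset, Multiset.card_nsmul]
      refine Nat.pow_le_pow_right (by norm_num) (Nat.mul_le_mul_left _ ?_)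
      have h1 := card_nf_le (h f0 hf0).1
      rw [(h f0 hf0).2.1] at h1
      refine le_trans ?_ h1
      rw [← toFinset_normalizedFactors]
      exact Multiset.toFinset_card_le _
    refine le_trans (Finset.card_le_card_of_injOn (normalizedFactors) ?_ ?_) hc
    · intro f hf
      simp only [Finset.coe_filter, Set.mem_setOf_eq] at hf
      rw [Finset.mem_coe, Multiset.mem_toFinset, Multiset.mem_powerset]
      have hpf : primeFactors f = primeFactors f0 := by
        rw [← primeFactors_radical, hf.2, primeFactors_radical]
      rw [Multiset.le_iff_count]
      intro q
      rw [Multiset.count_nsmul]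
      by_cases hq : q ∈ normalizedFactors f
      · have : 1 ≤ Multiset.count q (primeFactors f0).val := by
          rw [Multiset.one_le_count_iff_mem, Finset.mem_val, ← hpf, mem_primeFactors]; exact hq
        calc _ ≤ (normalizedFactors f).card := Multiset.count_le_card _ _
          _ ≤ n := by rw [← (h f hf.1).2.1]; exact card_nf_le (h f hf.1).1
          _ = n * 1 := (mul_one n).symm
          _ ≤ _ := Nat.mul_le_mul_left _ this
      · rw [Multiset.count_eq_zero_of_notMem hq]; simp
    · intro f hf g hg hfg
      simp only [Finset.coe_filter, Set.mem_setOf_eq] at hf hg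
      have h1 : (normalizedFactors f).prod = f := by
        rw [prod_normalizedFactors_eq (h f hf.1).1.ne_zero, (h f hf.1).1.normalize_eq_self]
      have h2 : (normalizedFactors g).prod = g := by
        rw [prod_normalizedFactors_eq (h g hg.1).1.ne_zero, (h g hg.1).1.normalize_eq_self]
      rw [← h1, ← h2, hfg]
  · apply Nat.mul_le_mul_left
    have hcard : (Finset.univ : Finset (Fin (k+1) × (Fin k → ZMod p))).card = (k+1) * p^k := by
      simp [ZMod.card]
    rw [← hcard]
    refine Finset.card_le_card_of_injOn (fun r => (Fin.ofNat (k+1) r.natDegree, fun i => r.coeff i))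
      (fun _ _ => Finset.mem_coe.2 (Finset.mem_univ _)) ?_
    intro r hr s hs hrs
    obtain ⟨f, hf, rfl⟩ := Finset.mem_image.1 hr
    obtain ⟨g, hg, rfl⟩ := Finset.mem_image.1 hs
    simp only [Prod.mk.injEq] at hrs
    have hd1 := (h f hf).2.2
    have hd2 := (h g hg).2.2
    have hm1 := radical_monic (h f hf).1
    have hm2 := radical_monic (h g hg).1
    have hd : (radical f).natDegree = (radical g).natDegree := by
      have := congrArg Fin.val hrs.1
      simp only [Fin.ofNat] at this
      rwa [Nat.mod_eq_of_lt (by omega), Nat.mod_eq_of_lt (by omega)] at this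
    ext i
    by_cases hi : i < k
    · exact congrFun hrs.2 ⟨i, hi⟩
    · rcases lt_or_eq_of_le hd1 with h1 | h1
      · rw [coeff_eq_zero_of_natDegree_lt (by omega), coeff_eq_zero_of_natDegree_lt (by omega)]
      · by_cases hik : i = k
        · subst hik
          rw [← h1, hm1.coeff_natDegree, hd, hm2.coeff_natDegree]
        · rw [coeff_eq_zero_of_natDegree_lt (by omega), coeff_eq_zero_of_natDegree_lt (by omega)]

lemma radical_natDegree_le {K F : Type*} [Field K] [DecidableEq K] [PerfectField K] [Field F]
    (φ : K →+* F) {f : K[X]}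
    (hf : f.Monic) (s : Multiset F) (t : Finset F) (k : ℕ) (hst : ∀ a ∈ s, a ∈ t) (ht : t.card ≤ k)
    (hfac : f.map φ = (s.map (fun a => X - C a)).prod) : (radical f).natDegree ≤ k := by
  classical
  have hsep : (radical f).Separable := PerfectField.separable_iff_squarefree.2 squarefree_radical
  have hdvd : (radical f).map φ ∣ f.map φ := Polynomial.map_dvd _ radical_dvd_self
  have hfs : (f.map φ).Splits := by
    rw [hfac]
    apply Splits.multisetProd
    intro q hq
    obtain ⟨a, _, rfl⟩ := Multiset.mem_map.1 hq
    exact Splits.X_sub_C a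
  have hne : f.map φ ≠ 0 := (hf.map φ).ne_zero
  have hrs : ((radical f).map φ).Splits := hfs.of_dvd hne hdvd
  have hnd : ((radical f).map φ).roots.Nodup := nodup_roots (hsep.map)
  have h1 := hrs.natDegree_eq_card_roots
  rw [natDegree_map] at h1
  rw [h1, ← Multiset.toFinset_card_of_nodup hnd]
  refine le_trans (Finset.card_le_card ?_) ht
  intro a ha
  rw [Multiset.mem_toFinset] at ha
  have := Multiset.mem_of_le (roots.le_of_dvd hne hdvd) ha
  rw [hfac, roots_multiset_prod_X_sub_C] at this
  exact hst a this

end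

noncomputable def polyZ {n : ℕ} (p : ℕ) (b : Fin n → ZMod p) : (ZMod p)[X] :=
  X^n + ∑ i : Fin n, C (b i) * X^(i:ℕ)

lemma polyZ_map {n : ℕ} (p : ℕ) (a : Fin n → ℤ) :
    (polyOf a).map (Int.castRingHom (ZMod p)) = polyZ p (fun i => (a i : ZMod p)) := by
  unfold polyOf polyZ
  simp [Polynomial.map_sum]

lemma polyZ_inj {n : ℕ} (p : ℕ) : Function.Injective (polyZ p : (Fin n → ZMod p) → (ZMod p)[X]) := by
  intro b b' h
  unfold polyZ at h
  have h2 := add_left_cancel h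
  funext i
  have := congrArg (fun q => q.coeff i) h2
  simp only [finset_sum_coeff, coeff_C_mul_X_pow, ← Fin.ext_iff] at this
  simpa using this

open Classical in
noncomputable def Rset (n p k : ℕ) : Finset (Fin n → ZMod p) :=
  if h : p.Prime then
    (haveI := Fact.mk h; Finset.univ.filter (fun b => ∃ a : Fin n → ℤ,
      (b = fun i => (a i : ZMod p)) ∧ NR p (polyOf a) k)) else ∅

lemma Rset_card (n p k : ℕ) : (Rset n p k).card ≤ 2^(n*n) * ((k+1) * p^k) := by
  classical
  unfold Rset
  split_ifs with hp
  · have := Fact.mk hp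
    rw [← Finset.card_image_of_injective _ (polyZ_inj p)]
    apply card_radical_le p n k
    intro f hf
    obtain ⟨b, hb, rfl⟩ := Finset.mem_image.1 hf
    obtain ⟨a, rfl, F, _, _, s, t, hst, ht, hfac⟩ := (Finset.mem_filter.1 hb).2
    rw [← polyZ_map]
    have hm := (polyOf_monic a).map (Int.castRingHom (ZMod p))
    refine ⟨hm, by rw [(polyOf_monic a).natDegree_map, polyOf_natDegree], ?_⟩
    refine radical_natDegree_le (ZMod.castHom (dvd_refl p) F) hm s t k hst ht ?_
    rw [← hfac, map_map]
    congr 1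
    exact RingHom.ext_int _ _
  · simp

lemma mem_Rset {n p k : ℕ} (hp : p.Prime) (a : Fin n → ℤ) (h : NR p (polyOf a) k) :
    (fun i => (a i : ZMod p)) ∈ Rset n p k := by
  classical
  haveI := Fact.mk hp
  unfold Rset
  rw [dif_pos hp]
  refine Finset.mem_filter.2 ?_
  exact ⟨Finset.mem_univ _, a, rfl, h⟩

lemma card_vec_residue_le (n S d : ℕ) (hd : Squarefree d) (R : ∀ p : ℕ, Finset (Fin n → ZMod p))
    (T : Finset (Fin n → ℤ)) (hT : ∀ a ∈ T, ∀ i, |a i| ≤ S)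
    (hR : ∀ a ∈ T, ∀ p ∈ d.primeFactors, (fun i => (a i : ZMod p)) ∈ R p) :
    (T.card : ℝ) ≤ (∏ p ∈ d.primeFactors, ((R p).card : ℝ)) * (2 * (S:ℝ) / d + 2)^n := by
  classical
  let i : (Fin n → ℤ) → (∀ p ∈ d.primeFactors, Fin n → ZMod p) := fun x p _ j => (x j : ZMod p)
  have h1 : ∀ x ∈ T, i x ∈ d.primeFactors.pi R := by
    intro x hx
    simp only [Finset.mem_pi, i]
    exact fun p hp => hR x hx p hp
  rw [Finset.card_eq_sum_card_fiberwise h1]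
  push_cast
  calc _ ≤ ∑ b ∈ d.primeFactors.pi R, (2 * (S:ℝ) / d + 2)^n := by
        apply Finset.sum_le_sum
        intro b hb
        set U := T.filter (fun x => i x = b) with hU
        have hc : U.card ≤ (Fintype.piFinset (fun j : Fin n => U.image (fun x => x j))).card := by
          apply Finset.card_le_card
          intro x hx
          rw [Fintype.mem_piFinset]
          exact fun j => Finset.mem_image_of_mem _ hx
        refine le_trans (b := ((Fintype.piFinset (fun j : Fin n => U.image (fun x => x j))).card : ℝ)) (by exact_mod_cast hc) ?_
        rw [Fintype.card_piFinset]
        push_cast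
        refine le_trans (Finset.prod_le_prod (g := fun _ => 2 * (S:ℝ) / d + 2) (fun _ _ => by positivity) ?_) (by simp)
        intro j _
        apply card_fiber_le S d hd.ne_zero.bot_lt
        · intro y hy
          obtain ⟨x, hx, rfl⟩ := Finset.mem_image.1 hy
          rw [Finset.mem_Icc, ← abs_le]
          exact hT x (Finset.mem_filter.1 hx).1 j
        · intro y hy y' hy'
          obtain ⟨x, hx, rfl⟩ := Finset.mem_image.1 hy
          obtain ⟨x', hx', rfl⟩ := Finset.mem_image.1 hy'
          simp only [hU, Finset.mem_filter] at hx hx'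
          apply dvd_sub_of_zmod d hd
          intro p hp
          have := hx.2.trans hx'.2.symm
          exact congrFun (congrFun (congrFun this p) hp) j
    _ = _ := by
        rw [Finset.sum_const, Finset.card_pi, nsmul_eq_mul]
        push_cast; rfl

theorem density (n : ℕ) : ∃ K : ℕ, ∀ N D : ℕ, 1 ≤ N → Squarefree D → D ≤ N → ∀ k : ℕ → ℕ,
    (∀ p ∈ D.primeFactors, k p ≤ n) →
    ∀ T : Finset (Fin n → ℤ), (∀ a ∈ T, ∀ i, |a i| ≤ N) →
    (∀ a ∈ T, ∀ p ∈ D.primeFactors, NR p (polyOf a) (n - k p)) →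
    (T.card : ℝ) ≤ 4^n * N^n * K^D.primeFactors.card / ∏ p ∈ D.primeFactors, (p:ℝ)^(k p) := by
  refine ⟨2^(n*n) * (n+1), fun N D hN hD hDN k hk T hT hNR => ?_⟩
  have h1 := card_vec_residue_le n N D hD (fun p => Rset n p (n - k p)) T hT (fun a ha p hp =>
    mem_Rset (Nat.prime_of_mem_primeFactors hp) a (hNR a ha p hp))
  have hD0 : (0:ℝ) < D := by exact_mod_cast hD.ne_zero.bot_lt
  have hDN' : (D:ℝ) ≤ N := by exact_mod_cast hDN
  have hppos : ∀ p ∈ D.primeFactors, (0:ℝ) < p := fun p hp => by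
    exact_mod_cast (Nat.prime_of_mem_primeFactors hp).pos
  have hDn : (D:ℝ)^n = ∏ p ∈ D.primeFactors, (p:ℝ)^n := by
    rw [Finset.prod_pow]
    congr 1
    conv_lhs => rw [← Nat.prod_primeFactors_of_squarefree hD]
    push_cast; rfl
  refine h1.trans ?_
  calc _ ≤ (∏ p ∈ D.primeFactors, (((2^(n*n) * (n+1) : ℕ):ℝ) * ((p:ℝ)^n / (p:ℝ)^(k p)))) * (4 * N / D)^n := by
        refine mul_le_mul ?_ ?_ (by positivity) (Finset.prod_nonneg fun p hp => by positivity)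
        · refine Finset.prod_le_prod (fun _ _ => by positivity) fun p hp => ?_
          have hb : ((Rset n p (n - k p)).card : ℝ) ≤ ((2^(n*n) * (((n - k p)+1) * p^(n - k p)) : ℕ) : ℝ) := by
            exact_mod_cast Rset_card n p (n - k p)
          refine hb.trans ?_
          rw [div_eq_mul_inv, ← pow_sub₀ _ (hppos p hp).ne' (hk p hp)]
          · push_cast
            rw [mul_assoc]
            have : ((n - k p : ℕ):ℝ) ≤ n := by exact_mod_cast Nat.sub_le _ _
            gcongr
        · refine pow_le_pow_left₀ (by positivity) ?_ _
          rw [le_div_iff₀ hD0, add_mul, div_mul_cancel₀ _ hD0.ne']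
          linarith
    _ = _ := by
        rw [Finset.prod_mul_distrib, Finset.prod_const, Finset.prod_div_distrib, ← hDn]
        rw [div_pow, mul_pow]
        field_simp
end

section
open Polynomial

lemma NR_mono {p : ℕ} {h : ℤ[X]} {k l : ℕ} (hkl : k ≤ l) (H : NR p h k) : NR p h l := by
  obtain ⟨F, i1, i2, s, t, h1, h2, h3⟩ := H
  exact ⟨F, i1, i2, s, t, h1, h2.trans hkl, h3⟩

/-- box of polynomials -/
def InBox (n N : ℕ) (p : ℤ[X]) : Prop := p.Monic ∧ p.natDegree = n ∧ ∀ i < n, |p.coeff i| ≤ (N:ℤ)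

def PL (n : ℕ) (Q : ℕ → ℤ[X] → Prop) : Prop := ∃ C : ℝ, 0 ≤ C ∧ ∃ f : ℕ, ∀ N : ℕ, 2 ≤ N →
  ∀ T : Finset ℤ[X], (∀ p ∈ T, InBox n N p ∧ Q N p) → (T.card : ℝ) ≤ C * (N:ℝ)^(n-1) * LL N ^ f

lemma PL.mono {n : ℕ} {Q R : ℕ → ℤ[X] → Prop} (h : PL n R)
    (hQ : ∀ N p, 2 ≤ N → InBox n N p → Q N p → R N p) : PL n Q := by
  obtain ⟨C, hC, f, h⟩ := h
  exact ⟨C, hC, f, fun N hN T hT => h N hN T fun p hp => ⟨(hT p hp).1, hQ N p hN (hT p hp).1 (hT p hp).2⟩⟩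

lemma PL.or {n : ℕ} {Q R : ℕ → ℤ[X] → Prop} (h : PL n Q) (h' : PL n R) :
    PL n (fun N p => Q N p ∨ R N p) := by
  classical
  obtain ⟨C, hC, f, h⟩ := h
  obtain ⟨C', hC', f', h'⟩ := h'
  refine ⟨C + C', add_nonneg hC hC', f + f', fun N hN T hT => ?_⟩
  have h1 := h N hN (T.filter (fun p => Q N p)) (fun p hp => by
    rw [Finset.mem_filter] at hp
    exact ⟨(hT p hp.1).1, hp.2⟩)
  have h2 := h' N hN (T.filter (fun p => ¬ Q N p)) (fun p hp => by
    rw [Finset.mem_filter] at hp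
    exact ⟨(hT p hp.1).1, (hT p hp.1).2.resolve_left hp.2⟩)
  have h3 : T.card = (T.filter (fun p => Q N p)).card + (T.filter (fun p => ¬ Q N p)).card :=
    (Finset.card_filter_add_card_filter_not _).symm
  rw [h3]
  push_cast
  have hL := LL_ge_one N
  have e1 : LL N ^ f ≤ LL N ^ (f+f') := pow_le_pow_right₀ hL (by omega)
  have e2 : LL N ^ f' ≤ LL N ^ (f+f') := pow_le_pow_right₀ hL (by omega)
  calc _ ≤ C * (N:ℝ)^(n-1) * LL N ^ f + C' * (N:ℝ)^(n-1) * LL N ^ f' := add_le_add h1 h2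
    _ ≤ C * (N:ℝ)^(n-1) * LL N ^ (f+f') + C' * (N:ℝ)^(n-1) * LL N ^ (f+f') := by gcongr
    _ = _ := by ring

/-- transfer to tuples -/
lemma exists_tuples (n N : ℕ) (T : Finset ℤ[X]) (hT : ∀ p ∈ T, InBox n N p) :
    ∃ U : Finset (Fin n → ℤ), U.card = T.card ∧ (∀ a ∈ U, ∀ i, |a i| ≤ (N:ℤ)) ∧ ∀ a ∈ U, polyOf a ∈ T := by
  classical
  refine ⟨T.image (fun h => fun i : Fin n => h.coeff i), ?_, ?_, ?_⟩
  · apply Finset.card_image_of_injOn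
    intro h hh g hg hhg
    rw [← polyOf_coeff_eq (hT h hh).1 (hT h hh).2.1, ← polyOf_coeff_eq (hT g hg).1 (hT g hg).2.1]
    exact congrArg polyOf hhg
  · intro a ha i
    obtain ⟨h, hh, rfl⟩ := Finset.mem_image.1 ha
    exact (hT h hh).2.2 i i.2
  · intro a ha
    obtain ⟨h, hh, rfl⟩ := Finset.mem_image.1 ha
    rw [polyOf_coeff_eq (hT h hh).1 (hT h hh).2.1]; exact hh

lemma count_bigC (m : ℕ) (hm : 1 ≤ m) : PL (m+2) (fun N p => GoodC (m+2) N p) := by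
  obtain ⟨c, hc, f, h⟩ := boxcount m hm
  refine ⟨c * 3, by positivity, f, fun N hN T hT => ?_⟩
  obtain ⟨U, hU, hb, hU2⟩ := exists_tuples (m+2) N T (fun p hp => (hT p hp).1)
  have := h (fun _ => N) (fun _ => by omega) hN (fun _ _ => le_rfl) N (by positivity) U hb
    (fun a ha => (hT _ (hU2 a ha)).2)
  rw [hU] at this
  refine this.trans (le_of_eq ?_)
  have hN0 : (N:ℝ) ≠ 0 := by positivity
  simp only [Finset.prod_const, Finset.card_univ, Fintype.card_fin]
  rw [show m+2-1 = m+1 from rfl, pow_succ (N:ℝ) (m+1)]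
  field_simp
  ring

def SmallC (n N : ℕ) (h : ℤ[X]) : Prop := ∃ C : ℕ, ∃ k : ℕ → ℕ, Squarefree C ∧ C ≤ N ∧
  (∀ p ∈ C.primeFactors, 2 ≤ k p ∧ k p ≤ n ∧ NR p h (n - k p)) ∧ N^2 < ∏ p ∈ C.primeFactors, p^(k p)

lemma count_smallC (n : ℕ) (hn : 1 ≤ n) : PL n (fun N p => SmallC n N p) := by
  classical
  obtain ⟨K, hK⟩ := density n
  refine ⟨4^n, by positivity, (n+1)*K, fun N hN T hT => ?_⟩
  obtain ⟨U, hU, hb, hU2⟩ := exists_tuples n N T (fun p hp => (hT p hp).1)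
  rw [← hU]
  have hN0 : (0:ℝ) < N := by positivity
  -- the index set
  let I := (Finset.Icc 1 N).filter Squarefree
  let J : (C : ℕ) → Finset ((p : ℕ) → p ∈ C.primeFactors → ℕ) := fun C => C.primeFactors.pi (fun _ => Finset.range (n+1))
  let ext : (C : ℕ) → ((p : ℕ) → p ∈ C.primeFactors → ℕ) → ℕ → ℕ :=
    fun C g p => if hp : p ∈ C.primeFactors then g p hp else 0
  let G : (C : ℕ) → ((p : ℕ) → p ∈ C.primeFactors → ℕ) → Prop := fun C g =>
    (∀ p ∈ C.primeFactors, 2 ≤ ext C g p ∧ ext C g p ≤ n) ∧ N^2 < ∏ p ∈ C.primeFactors, p^(ext C g p)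
  let V : (C : ℕ) → ((p : ℕ) → p ∈ C.primeFactors → ℕ) → Finset (Fin n → ℤ) := fun C g =>
    U.filter (fun a => G C g ∧ ∀ p ∈ C.primeFactors, NR p (polyOf a) (n - ext C g p))
  have hsub : U ⊆ I.biUnion (fun C => (J C).biUnion (fun g => V C g)) := by
    intro a ha
    obtain ⟨C, k, h1, h2, h3, h4⟩ := (hT _ (hU2 a ha)).2
    simp only [Finset.mem_biUnion]
    have hext : ∀ p ∈ C.primeFactors, ext C (fun p _ => k p) p = k p := fun p hp => by
      simp only [ext]; rw [dif_pos hp]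
    refine ⟨C, Finset.mem_filter.2 ⟨Finset.mem_Icc.2 ⟨h1.ne_zero.bot_lt, h2⟩, h1⟩, fun p _ => k p, ?_, ?_⟩
    · rw [Finset.mem_pi]
      intro p hp
      rw [Finset.mem_range]
      have := (h3 p hp).2.1
      omega
    · refine Finset.mem_filter.2 ⟨ha, ⟨fun p hp => ?_, ?_⟩, fun p hp => ?_⟩
      · rw [hext p hp]; exact ⟨(h3 p hp).1, (h3 p hp).2.1⟩
      · rwa [Finset.prod_congr rfl (fun p hp => by rw [hext p hp])]
      · rw [hext p hp]; exact (h3 p hp).2.2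
  have hV : ∀ C ∈ I, ∀ g ∈ J C, ((V C g).card : ℝ) ≤ 4^n * (N:ℝ)^(n-1) * ((K:ℝ)^C.primeFactors.card / C) := by
    intro C hC g hg
    obtain ⟨hC1, hsq⟩ := Finset.mem_filter.1 hC
    have hCN := (Finset.mem_Icc.1 hC1).2
    have hC0 : (0:ℝ) < C := by exact_mod_cast (Finset.mem_Icc.1 hC1).1
    by_cases hG : G C g
    · have h1 := hK N C (by omega) hsq hCN (ext C g) (fun p hp => (hG.1 p hp).2) (V C g)
        (fun a ha => hb a (Finset.mem_filter.1 ha).1) (fun a ha => (Finset.mem_filter.1 ha).2.2)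
      refine h1.trans ?_
      have hD1 : (N:ℝ)^2 < ∏ p ∈ C.primeFactors, (p:ℝ)^(ext C g p) := by exact_mod_cast hG.2
      have hD2 : (C:ℝ)^2 ≤ ∏ p ∈ C.primeFactors, (p:ℝ)^(ext C g p) := by
        have : C^2 ≤ ∏ p ∈ C.primeFactors, p^(ext C g p) := by
          conv_lhs => rw [← Nat.prod_primeFactors_of_squarefree hsq]
          rw [← Finset.prod_pow]
          exact Finset.prod_le_prod' fun p hp =>
            Nat.pow_le_pow_right (Nat.prime_of_mem_primeFactors hp).pos (hG.1 p hp).1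
        exact_mod_cast this
      have hD3 : (N:ℝ) * C ≤ ∏ p ∈ C.primeFactors, (p:ℝ)^(ext C g p) := by nlinarith [sq_nonneg ((N:ℝ) - C)]
      calc _ ≤ 4^n * (N:ℝ)^n * (K:ℝ)^C.primeFactors.card / (N * C) := by gcongr
        _ = _ := by
          obtain ⟨m, rfl⟩ : ∃ m, n = m+1 := ⟨n-1, by omega⟩
          rw [show m+1-1 = m from rfl, pow_succ (N:ℝ) m]
          field_simp
    · have : V C g = ∅ := Finset.filter_eq_empty_iff.2 fun a _ h => hG h.1
      rw [this]; simp; positivity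
  calc (U.card:ℝ) ≤ ((I.biUnion (fun C => (J C).biUnion (fun g => V C g))).card : ℝ) := by
        exact_mod_cast Finset.card_le_card hsub
    _ ≤ ∑ C ∈ I, ∑ g ∈ J C, ((V C g).card : ℝ) := by
        exact_mod_cast Finset.card_biUnion_le.trans (Finset.sum_le_sum fun C _ => Finset.card_biUnion_le)
    _ ≤ ∑ C ∈ I, ∑ g ∈ J C, 4^n * (N:ℝ)^(n-1) * ((K:ℝ)^C.primeFactors.card / C) :=
        Finset.sum_le_sum fun C hC => Finset.sum_le_sum fun g hg => hV C hC g hg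
    _ = 4^n * (N:ℝ)^(n-1) * ∑ C ∈ I, (((n+1)*K : ℕ):ℝ)^C.primeFactors.card / C := by
        rw [Finset.mul_sum]
        refine Finset.sum_congr rfl fun C _ => ?_
        rw [Finset.sum_const, Finset.card_pi, nsmul_eq_mul]
        simp only [Finset.card_range, Finset.prod_const]
        push_cast
        rw [mul_pow]; ring
    _ ≤ _ := by
        gcongr
        exact sum_omega_div' _ _
end

section
open Polynomial NumberField

lemma floor_card (B : ℝ) (hB : 1 ≤ B) (U : Finset ℤ) (h : ∀ z ∈ U, ∃ r : ℝ, |r| ≤ B ∧ z = ⌊2*r⌋) :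
    (U.card : ℝ) ≤ 6 * B := by
  have hsub : U ⊆ Finset.Icc ⌊-2*B⌋ ⌊2*B⌋ := by
    intro z hz
    obtain ⟨r, hr, rfl⟩ := h z hz
    rw [abs_le] at hr
    rw [Finset.mem_Icc]
    exact ⟨Int.floor_le_floor (by linarith [hr.1]), Int.floor_le_floor (by linarith [hr.2])⟩
  have h1 := Finset.card_le_card hsub
  rw [Int.card_Icc] at h1
  have h2 : ((⌊2*B⌋ + 1 - ⌊-2*B⌋).toNat : ℝ) ≤ 6 * B := by
    have h3 : ⌊-2*B⌋ ≤ ⌊2*B⌋ := Int.floor_le_floor (by linarith)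
    have : ((⌊2*B⌋ + 1 - ⌊-2*B⌋).toNat : ℝ) = (⌊2*B⌋ : ℝ) + 1 - (⌊-2*B⌋ : ℝ) := by
      have h4 : (((⌊2*B⌋ + 1 - ⌊-2*B⌋).toNat : ℤ) : ℝ) = ((⌊2*B⌋ + 1 - ⌊-2*B⌋ : ℤ) : ℝ) := by
        rw [Int.toNat_of_nonneg (by omega)]
      push_cast at h4
      exact_mod_cast h4
    rw [this]
    have h5 := Int.floor_le (2*B)
    have h6 := Int.lt_floor_add_one (-2*B)
    linarith
  have : (U.card:ℝ) ≤ ((⌊2*B⌋ + 1 - ⌊-2*B⌋).toNat : ℝ) := by exact_mod_cast h1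
  linarith


lemma clog_le_LL (T : ℕ) (hT : 1 ≤ T) : ((Nat.clog 2 T + 1 : ℕ) : ℝ) ≤ 3 * LL T := by
  have h1 : Nat.clog 2 T ≤ Nat.log 2 T + 1 := Nat.clog_le_of_le_pow (Nat.lt_pow_succ_log_self (by norm_num) T).le
  have h2 : (2:ℝ)^(Nat.log 2 T) ≤ T := by exact_mod_cast Nat.pow_log_le_self 2 (by omega)
  have h3 : (Nat.log 2 T : ℝ) * Real.log 2 ≤ Real.log T := by
    rw [← Real.log_pow]
    exact Real.log_le_log (by positivity) h2
  have h4 := Real.log_two_gt_d9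
  have h5 : (Nat.clog 2 T : ℝ) ≤ Nat.log 2 T + 1 := by exact_mod_cast h1
  have h6 : (0:ℝ) ≤ Nat.log 2 T := by positivity
  unfold LL
  push_cast
  nlinarith

section
variable {K : Type*} [Field K] [NumberField K]

lemma nf_eq_zero_of_lt {x : 𝓞 K} (h : ∀ w : InfinitePlace K, w x < 1) : x = 0 := by
  by_contra hx
  obtain ⟨w⟩ := (inferInstance : Nonempty (InfinitePlace K))
  exact absurd (h w) (not_lt.2 (InfinitePlace.one_le_of_lt_one hx (fun {z} _ => h z)))

noncomputable def flr (w : InfinitePlace K) (x : 𝓞 K) : ℤ × ℤ :=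
  (⌊2 * (w.embedding x).re⌋, ⌊2 * (w.embedding x).im⌋)

lemma flr_inj {x y : 𝓞 K} (h : ∀ w, flr w x = flr w y) : x = y := by
  rw [← sub_eq_zero]
  apply nf_eq_zero_of_lt
  intro w
  have h1 := h w
  simp only [flr, Prod.mk.injEq] at h1
  have a1 := Int.abs_sub_lt_one_of_floor_eq_floor h1.1
  have a2 := Int.abs_sub_lt_one_of_floor_eq_floor h1.2
  rw [← InfinitePlace.norm_embedding_eq]
  set u := w.embedding x
  set v := w.embedding y
  have e : w.embedding ((x - y : 𝓞 K) : K) = u - v := by simp [u, v]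
  rw [e]
  have h2 : ‖u - v‖^2 < 1 := by
    rw [Complex.sq_norm, Complex.normSq_apply, Complex.sub_re, Complex.sub_im]
    rw [abs_lt] at a1 a2
    nlinarith [a1.1, a1.2, a2.1, a2.2]
  nlinarith [norm_nonneg (u - v)]

lemma nf_box (B : InfinitePlace K → ℝ) (hB : ∀ w, 1 ≤ B w) (U : Finset (𝓞 K))
    (h : ∀ x ∈ U, ∀ w : InfinitePlace K, w x ≤ B w) :
    (U.card : ℝ) ≤ ∏ w : InfinitePlace K, (6 * B w)^w.mult := by
  classical
  have h1 : U.card ≤ (Fintype.piFinset (fun w => U.image (flr w))).card := by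
    refine Finset.card_le_card_of_injOn (fun x w => flr w x) ?_ ?_
    · intro x hx
      rw [Finset.mem_coe, Fintype.mem_piFinset]
      exact fun w => Finset.mem_image_of_mem _ hx
    · intro x _ y _ hxy
      exact flr_inj (fun w => congrFun hxy w)
  rw [Fintype.card_piFinset] at h1
  calc (U.card:ℝ) ≤ ((∏ w, (U.image (flr w)).card : ℕ) : ℝ) := by exact_mod_cast h1
    _ = ∏ w, ((U.image (flr w)).card : ℝ) := by push_cast; rfl
    _ ≤ _ := by
      refine Finset.prod_le_prod (fun _ _ => by positivity) fun w _ => ?_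
      have hre : ∀ x ∈ U, |(w.embedding x).re| ≤ B w := fun x hx =>
        (Complex.abs_re_le_norm _).trans (by rw [InfinitePlace.norm_embedding_eq]; exact h x hx w)
      have him : ∀ x ∈ U, |(w.embedding x).im| ≤ B w := fun x hx =>
        (Complex.abs_im_le_norm _).trans (by rw [InfinitePlace.norm_embedding_eq]; exact h x hx w)
      have c1 : (((U.image (flr w)).image Prod.fst).card : ℝ) ≤ 6 * B w := by
        apply floor_card _ (hB w)
        intro z hz
        simp only [Finset.mem_image, exists_exists_and_eq_and] at hz
        obtain ⟨x, hx, rfl⟩ := hz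
        exact ⟨_, hre x hx, rfl⟩
      have c2 : (((U.image (flr w)).image Prod.snd).card : ℝ) ≤ 6 * B w := by
        apply floor_card _ (hB w)
        intro z hz
        simp only [Finset.mem_image, exists_exists_and_eq_and] at hz
        obtain ⟨x, hx, rfl⟩ := hz
        exact ⟨_, him x hx, rfl⟩
      rcases w.isReal_or_isComplex with hw | hw
      · rw [hw.mult_eq_one, pow_one]
        refine le_trans (le_of_eq ?_) c1
        congr 1
        symm
        apply Finset.card_image_of_injOn
        intro a ha b hb hab
        obtain ⟨x, hx, rfl⟩ := Finset.mem_image.1 ha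
        obtain ⟨y, hy, rfl⟩ := Finset.mem_image.1 hb
        refine Prod.ext hab ?_
        have : ∀ x : 𝓞 K, (w.embedding x).im = 0 := by
          intro x
          have := InfinitePlace.embedding_of_isReal_apply hw (x : K)
          rw [← this]; exact Complex.ofReal_im _
        simp [flr, this]
      · rw [hw.mult_eq_two, sq]
        have : (U.image (flr w)).card ≤ ((U.image (flr w)).image Prod.fst).card * ((U.image (flr w)).image Prod.snd).card := by
          rw [← Finset.card_product]
          apply Finset.card_le_card
          intro a ha
          rw [Finset.mem_product]
          exact ⟨Finset.mem_image_of_mem _ ha, Finset.mem_image_of_mem _ ha⟩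
        have h2 : ((U.image (flr w)).card : ℝ) ≤ (((U.image (flr w)).image Prod.fst).card:ℝ) * (((U.image (flr w)).image Prod.snd).card : ℝ) := by
          exact_mod_cast this
        refine h2.trans ?_
        have : 0 ≤ B w := by linarith [hB w]
        gcongr

lemma nf_tuples_box (m : ℕ) (B : InfinitePlace K → ℝ) (hB : ∀ w, 1 ≤ B w) (U : Finset (Fin m → 𝓞 K))
    (h : ∀ x ∈ U, ∀ j, ∀ w : InfinitePlace K, w (x j) ≤ B w) :
    (U.card : ℝ) ≤ (∏ w : InfinitePlace K, (6 * B w)^w.mult)^m := by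
  classical
  have h1 : U.card ≤ (Fintype.piFinset (fun j => U.image (fun x => x j))).card := by
    apply Finset.card_le_card
    intro x hx
    rw [Fintype.mem_piFinset]
    exact fun w => Finset.mem_image_of_mem _ hx
  rw [Fintype.card_piFinset] at h1
  calc (U.card:ℝ) ≤ ((∏ j, (U.image (fun x => x j)).card : ℕ) : ℝ) := by exact_mod_cast h1
    _ = ∏ j, ((U.image (fun x => x j)).card : ℝ) := by push_cast; rfl
    _ ≤ ∏ j : Fin m, (∏ w : InfinitePlace K, (6 * B w)^w.mult) := by
      refine Finset.prod_le_prod (fun _ _ => by positivity) fun j _ => ?_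
      apply nf_box B hB
      intro y hy w
      obtain ⟨x, hx, rfl⟩ := Finset.mem_image.1 hy
      exact h x hx j w
    _ = _ := by simp

lemma nf_count (m T : ℕ) (hT : 1 ≤ T) (U : Finset (Fin m → 𝓞 K))
    (h : ∀ x ∈ U, ∃ s : InfinitePlace K → ℝ, (∀ w, 1 ≤ s w) ∧ (∀ w : InfinitePlace K, ∀ j, w (x j) ≤ s w) ∧
      ∏ w : InfinitePlace K, s w ^ w.mult ≤ T) :
    (U.card : ℝ) ≤ (24^(Module.finrank ℚ K) * T)^m * (3 * LL T)^(Module.finrank ℚ K) := by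
  classical
  set n := Module.finrank ℚ K with hn
  have key : ∀ x ∈ U, ∃ e : InfinitePlace K → ℕ, (∀ w, e w ∈ Finset.range (Nat.clog 2 T + 1)) ∧
      (∀ w : InfinitePlace K, ∀ j, w (x j) ≤ 2^(e w)) ∧ ∏ w : InfinitePlace K, ((2:ℝ)^(e w)) ^ w.mult ≤ 4^n * T := by
    intro x hx
    obtain ⟨s, h1, h2, h3⟩ := h x hx
    have hs : ∀ w, s w ≤ T := fun w => by
      refine le_trans ?_ h3
      refine le_trans (le_self_pow₀ (h1 w) (InfinitePlace.mult_ne_zero (w := w))) ?_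
      rw [← Finset.mul_prod_erase _ _ (Finset.mem_univ w)]
      exact le_mul_of_one_le_right (by have := h1 w; positivity) (Finset.prod_induction _ (fun x => 1 ≤ x)
        (fun a b => one_le_mul_of_one_le_of_one_le) le_rfl (fun w _ => one_le_pow₀ (h1 w)))
    have hce : ∀ w, s w ≤ 2^(Nat.clog 2 ⌈s w⌉₊) := fun w => by
      refine (Nat.le_ceil _).trans ?_
      exact_mod_cast Nat.le_pow_clog (by norm_num) _
    refine ⟨fun w => Nat.clog 2 ⌈s w⌉₊, fun w => ?_, fun w j => (h2 w j).trans (hce w), ?_⟩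
    · rw [Finset.mem_range, Nat.lt_succ_iff]
      exact Nat.clog_mono_right _ (Nat.ceil_le.2 (hs w))
    · calc _ ≤ ∏ w : InfinitePlace K, (4 * s w)^w.mult := by
            refine Finset.prod_le_prod (fun _ _ => by positivity) fun w _ => ?_
            refine pow_le_pow_left₀ (by positivity) ?_ _
            show (2:ℝ)^(Nat.clog 2 ⌈s w⌉₊) ≤ 4 * s w
            have h4 : (⌈s w⌉₊ : ℝ) ≤ 2 * s w := by linarith [Nat.ceil_lt_add_one (show 0 ≤ s w by linarith [h1 w]), h1 w]
            by_cases h5 : ⌈s w⌉₊ ≤ 1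
            · have : Nat.clog 2 ⌈s w⌉₊ = 0 := Nat.clog_of_right_le_one h5 2
              rw [this]; linarith [h1 w]
            · have h6 := Nat.pow_pred_clog_lt_self (b := 2) (by norm_num) (x := ⌈s w⌉₊) (by omega)
              have h7 : 0 < Nat.clog 2 ⌈s w⌉₊ := Nat.clog_pos (by norm_num) (by omega)
              have h8 : 2^(Nat.clog 2 ⌈s w⌉₊) ≤ 2 * ⌈s w⌉₊ := by
                obtain ⟨r, hr⟩ : ∃ r, Nat.clog 2 ⌈s w⌉₊ = r + 1 := ⟨_, (Nat.succ_pred_eq_of_pos h7).symm⟩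
                rw [hr] at h6 ⊢
                rw [pow_succ]
                have : 2^r < ⌈s w⌉₊ := h6
                omega
              have h9 : (2:ℝ)^(Nat.clog 2 ⌈s w⌉₊) ≤ 2 * ⌈s w⌉₊ := by exact_mod_cast h8
              linarith
        _ = 4^n * ∏ w : InfinitePlace K, s w^w.mult := by
            simp only [mul_pow]
            rw [Finset.prod_mul_distrib, Finset.prod_pow_eq_pow_sum, InfinitePlace.sum_mult_eq]
        _ ≤ _ := by gcongr
  choose! e he1 he2 he3 using key
  let I := Fintype.piFinset (fun _ : InfinitePlace K => Finset.range (Nat.clog 2 T + 1))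
  rw [Finset.card_eq_sum_card_fiberwise (f := e) (t := I) (by
    intro x hx
    rw [Finset.mem_coe, Fintype.mem_piFinset]
    exact he1 x hx)]
  push_cast
  calc _ ≤ ∑ b ∈ I, ((24:ℝ)^n * T)^m := by
        refine Finset.sum_le_sum fun b hb => ?_
        by_cases hem : (U.filter (fun x => e x = b)) = ∅
        · rw [hem]; simp; positivity
        · obtain ⟨x, hx⟩ := Finset.nonempty_iff_ne_empty.2 hem
          rw [Finset.mem_filter] at hx
          refine (nf_tuples_box m (fun w => 2^(b w)) (fun w => one_le_pow₀ (by norm_num)) _ ?_).trans ?_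
          · intro y hy j w
            rw [Finset.mem_filter] at hy
            rw [← hy.2]; exact he2 y hy.1 w j
          · refine pow_le_pow_left₀ (Finset.prod_nonneg fun _ _ => by positivity) ?_ _
            simp only [mul_pow]
            rw [Finset.prod_mul_distrib, Finset.prod_pow_eq_pow_sum, InfinitePlace.sum_mult_eq, ← hx.2, ← hn]
            calc _ ≤ (6:ℝ)^n * (4^n * T) := by
                  gcongr
                  have := he3 x hx.1
                  simpa using this
              _ = _ := by rw [← mul_assoc, ← mul_pow]; norm_num
    _ = ((24:ℝ)^n * T)^m * ((Nat.clog 2 T + 1 : ℕ):ℝ)^(Fintype.card (InfinitePlace K)) := by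
        rw [Finset.sum_const, Fintype.card_piFinset, nsmul_eq_mul]
        simp only [Finset.card_range, Finset.prod_const, Finset.card_univ]
        push_cast; ring
    _ ≤ ((24:ℝ)^n * T)^m * (3 * LL T)^n := by
        gcongr
        have hL := LL_ge_one T
        calc _ ≤ (3 * LL T)^(Fintype.card (InfinitePlace K)) := by
              gcongr
              exact clog_le_LL T hT
          _ ≤ _ := by
              apply pow_le_pow_right₀ (by linarith)
              rw [hn, ← InfinitePlace.sum_mult_eq]
              rw [← Finset.card_univ, Finset.card_eq_sum_ones]
              exact Finset.sum_le_sum fun w _ => InfinitePlace.mult_pos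

lemma nf_count' (m T : ℕ) (hT : 1 ≤ T) (U : Finset (Fin m → 𝓞 K))
    (h : ∀ x ∈ U, ∏ φ : K →+* ℂ, max 1 ‖fun j => φ (x j)‖ ≤ T) :
    (U.card : ℝ) ≤ (24^(Module.finrank ℚ K) * T)^m * (3 * LL T)^(Module.finrank ℚ K) := by
  classical
  apply nf_count m T hT U
  intro x hx
  refine ⟨fun w => max 1 ‖fun j => w.embedding (x j)‖, fun w => le_max_left _ _, fun w j => ?_, ?_⟩
  · refine le_trans ?_ (le_max_right _ _)
    rw [← InfinitePlace.norm_embedding_eq]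
    exact norm_le_pi_norm (fun j => w.embedding (x j : K)) j
  · refine le_trans (le_of_eq ?_) (h x hx)
    rw [← Finset.prod_fiberwise Finset.univ (fun φ : K →+* ℂ => InfinitePlace.mk φ)]
    refine Finset.prod_congr rfl fun w _ => ?_
    rw [← InfinitePlace.card_filter_mk_eq w, ← Finset.prod_const]
    refine Finset.prod_congr rfl fun φ hφ => ?_
    have hw : InfinitePlace.mk φ = w := (Finset.mem_filter.1 hφ).2
    rw [← InfinitePlace.mk_embedding w, InfinitePlace.mk_eq_iff] at hw
    show max 1 ‖fun j => w.embedding (x j)‖ = _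
    rcases hw with hw | hw
    · rw [hw]
    · rw [← hw]
      congr 1
      have : ∀ j, ‖ComplexEmbedding.conjugate φ (x j : K)‖₊ = ‖φ (x j : K)‖₊ := by
        intro j
        rw [ComplexEmbedding.conjugate_coe_eq]
        simp
      rw [Pi.norm_def, Pi.norm_def]
      simp only [this]
end
end

section
open Polynomial

noncomputable def mM (p : ℤ[X]) : ℝ := (p.map (Int.castRingHom ℂ)).mahlerMeasure

lemma mM_box {n N : ℕ} (hN : 1 ≤ N) {p : ℤ[X]} (h : InBox n N p) : mM p ≤ (n+1) * N := by
  unfold mM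
  refine (mahlerMeasure_le_sum_norm_coeff _).trans ?_
  have hd : (p.map (Int.castRingHom ℂ)).natDegree = n := by rw [h.1.natDegree_map, h.2.1]
  rw [sum_over_range _ (by simp), hd]
  refine (Finset.sum_le_sum (g := fun _ => (N:ℝ)) ?_).trans (by simp)
  intro i hi
  rw [coeff_map, eq_intCast, Complex.norm_intCast]
  rcases Nat.lt_or_ge i n with h1 | h1
  · exact_mod_cast h.2.2 i h1
  · have : i = n := by rw [Finset.mem_range] at hi; omega
    rw [this, ← h.2.1, h.1.coeff_natDegree]
    simp; exact_mod_cast hN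

lemma mM_mul (p q : ℤ[X]) : mM (p*q) = mM p * mM q := by
  unfold mM
  rw [Polynomial.map_mul, mahlerMeasure_mul]

lemma one_le_mM {p : ℤ[X]} (hp : p.Monic) : 1 ≤ mM p := by
  apply one_le_mahlerMeasure_of_one_le_norm_leadingCoeff
  rw [(hp.map _).leadingCoeff]; simp

lemma coeff_le_mM {p : ℤ[X]} {n : ℕ} (hp : p.natDegree ≤ n) (i : ℕ) :
    |(p.coeff i : ℝ)| ≤ 2^n * mM p := by
  have h := norm_coeff_le_choose_mul_mahlerMeasure i (p.map (Int.castRingHom ℂ))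
  rw [coeff_map, eq_intCast, Complex.norm_intCast] at h
  refine h.trans ?_
  have h0 : 0 ≤ mM p := mahlerMeasure_nonneg _
  refine mul_le_mul_of_nonneg_right ?_ h0
  have h1 : (p.map (Int.castRingHom ℂ)).natDegree ≤ n := natDegree_map_le.trans hp
  calc _ ≤ ((2^((p.map (Int.castRingHom ℂ)).natDegree) : ℕ) : ℝ) := by
        exact_mod_cast Nat.choose_le_two_pow _ _
    _ ≤ _ := by
        push_cast
        exact pow_le_pow_right₀ (by norm_num) h1

noncomputable def ibox (m : ℕ) (R : ℝ) : Finset (Fin m → ℤ) :=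
  Fintype.piFinset (fun _ => Finset.Icc (-⌊R⌋) ⌊R⌋)

lemma mem_ibox {m : ℕ} {R : ℝ} {x : Fin m → ℤ} (h : ∀ i, |(x i : ℝ)| ≤ R) : x ∈ ibox m R := by
  unfold ibox
  rw [Fintype.mem_piFinset]
  intro i
  have := abs_le.1 (h i)
  rw [Finset.mem_Icc]
  constructor
  · rw [neg_le, Int.le_floor]; push_cast; linarith [this.1]
  · rw [Int.le_floor]; exact this.2

lemma card_ibox (m : ℕ) {R : ℝ} (hR : 1 ≤ R) : ((ibox m R).card : ℝ) ≤ (3*R)^m := by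
  unfold ibox
  rw [Fintype.card_piFinset]
  simp only [Finset.prod_const, Finset.card_univ, Fintype.card_fin, Int.card_Icc]
  push_cast
  have h0 : 0 ≤ ⌊R⌋ := Int.floor_nonneg.2 (by linarith)
  refine pow_le_pow_left₀ (by positivity) ?_ _
  have : ((⌊R⌋ + 1 - -⌊R⌋).toNat : ℝ) = 2 * (⌊R⌋:ℝ) + 1 := by
    have h4 : (((⌊R⌋ + 1 - -⌊R⌋).toNat : ℤ) : ℝ) = ((⌊R⌋ + 1 - -⌊R⌋ : ℤ) : ℝ) := by
      rw [Int.toNat_of_nonneg (by omega)]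
    push_cast at h4
    rw [show ((⌊R⌋ + 1 - -⌊R⌋).toNat : ℝ) = (⌊R⌋:ℝ) + 1 - -⌊R⌋ by exact_mod_cast h4]
    ring
  rw [this]
  linarith [Int.floor_le R]

lemma card_le_keys {α β : Type*} [DecidableEq β] (T : Finset α) (I : Finset β) (e : α → β) (B : ℝ)
    (h1 : ∀ x ∈ T, e x ∈ I) (h2 : ∀ b ∈ I, ∀ V ⊆ T, (∀ x ∈ V, e x = b) → (V.card : ℝ) ≤ B) :
    (T.card : ℝ) ≤ I.card * B := by
  classical
  rw [Finset.card_eq_sum_card_fiberwise h1]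
  push_cast
  rw [← nsmul_eq_mul]
  apply Finset.sum_le_card_nsmul
  intro b hb
  exact h2 b hb _ (Finset.filter_subset _ _) (fun x hx => (Finset.mem_filter.1 hx).2)

lemma exists_dyadic {s T : ℝ} (h1 : 1 ≤ s) (h2 : s ≤ T) :
    ∃ e ∈ Finset.range (Nat.clog 2 ⌈T⌉₊ + 1), s ≤ (2:ℝ)^e ∧ (2:ℝ)^e ≤ 4 * s := by
  refine ⟨Nat.clog 2 ⌈s⌉₊, ?_, ?_, ?_⟩
  · rw [Finset.mem_range, Nat.lt_succ_iff]
    exact Nat.clog_mono_right _ (Nat.ceil_mono h2)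
  · refine (Nat.le_ceil _).trans ?_
    exact_mod_cast Nat.le_pow_clog (by norm_num) _
  · have h4 : (⌈s⌉₊ : ℝ) ≤ 2 * s := by linarith [Nat.ceil_lt_add_one (show 0 ≤ s by linarith)]
    by_cases h5 : ⌈s⌉₊ ≤ 1
    · have : Nat.clog 2 ⌈s⌉₊ = 0 := Nat.clog_of_right_le_one h5 2
      rw [this]; linarith
    · have h6 := Nat.pow_pred_clog_lt_self (b := 2) (by norm_num) (x := ⌈s⌉₊) (by omega)
      have h7 : 0 < Nat.clog 2 ⌈s⌉₊ := Nat.clog_pos (by norm_num) (by omega)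
      have h8 : 2^(Nat.clog 2 ⌈s⌉₊) ≤ 2 * ⌈s⌉₊ := by
        obtain ⟨r, hr⟩ : ∃ r, Nat.clog 2 ⌈s⌉₊ = r + 1 := ⟨_, (Nat.succ_pred_eq_of_pos h7).symm⟩
        rw [hr] at h6 ⊢
        rw [pow_succ]
        have : 2^r < ⌈s⌉₊ := h6
        omega
      have h9 : (2:ℝ)^(Nat.clog 2 ⌈s⌉₊) ≤ 2 * ⌈s⌉₊ := by exact_mod_cast h8
      linarith

lemma LL_mul_le (c N : ℕ) (hc : 1 ≤ c) (hN : 1 ≤ N) : LL (c*N) ≤ LL c * LL N := by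
  unfold LL
  push_cast
  rw [Real.log_mul (by positivity) (by positivity)]
  have h1 : 0 ≤ Real.log c := Real.log_natCast_nonneg c
  have h2 : 0 ≤ Real.log N := Real.log_natCast_nonneg N
  nlinarith [mul_nonneg h1 h2]

def IsRed (f : ℤ[X]) : Prop := ∃ g h : ℤ[X], g.Monic ∧ h.Monic ∧ 1 ≤ g.natDegree ∧ 1 ≤ h.natDegree ∧ f = g * h

lemma count_reducible (n : ℕ) (hn : 1 ≤ n) : PL n (fun _ f => IsRed f) := by
  classical
  refine ⟨n * (3 * LL (n+1)) * ((3*2^n)^n * (4*(n+1))^(n-1)), by have := LL_ge_one (n+1); positivity, 1, fun N hN T hT => ?_⟩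
  have hN1 : (1:ℝ) ≤ N := by exact_mod_cast (show 1 ≤ N by omega)
  have hkey : ∀ f ∈ T, ∃ g h : ℤ[X], ∃ e ∈ Finset.range (Nat.clog 2 ((n+1)*N) + 1), g.Monic ∧ h.Monic ∧
      1 ≤ g.natDegree ∧ 1 ≤ h.natDegree ∧ g.natDegree + h.natDegree = n ∧ f = g * h ∧
      mM g ≤ 2^e ∧ mM h ≤ 4 * (n+1) * N / 2^e := by
    intro f hf
    obtain ⟨hb, g, h, hg, hh, hgd, hhd, rfl⟩ := hT f hf
    have hM := mM_box (by omega) hb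
    rw [mM_mul] at hM
    have hg1 := one_le_mM hg
    have hh1 := one_le_mM hh
    obtain ⟨e, he, h1, h2⟩ := exists_dyadic hg1 (show mM g ≤ (((n+1)*N : ℕ) : ℝ) by
      push_cast; nlinarith)
    rw [Nat.ceil_natCast] at he
    refine ⟨g, h, e, he, hg, hh, hgd, hhd, ?_, rfl, h1, ?_⟩
    · rw [← hg.natDegree_mul hh, hb.2.1]
    · rw [le_div_iff₀ (by positivity)]
      nlinarith
  choose! g h e he hg hh hgd hhd hsum hfgh hMg hMh using hkey
  have := card_le_keys T ((Finset.range (Nat.clog 2 ((n+1)*N) + 1)) ×ˢ Finset.range n)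
    (fun f => (e f, (g f).natDegree)) ((3*2^n)^n * (4*(n+1)*N)^(n-1)) ?_ ?_
  · refine this.trans ?_
    rw [Finset.card_product, Finset.card_range, Finset.card_range, pow_one, Nat.cast_mul]
    have h1 := clog_le_LL ((n+1)*N) (Nat.mul_pos (by omega) (by omega))
    have h2 := LL_mul_le (n+1) N (by omega) (by omega)
    calc _ ≤ (3 * (LL (n+1) * LL N)) * n * ((3*2^n)^n * (4*(n+1)*(N:ℝ))^(n-1)) := by
          gcongr; exact h1.trans (by linarith)
      _ = _ := by rw [mul_pow (4*((n:ℝ)+1))]; ring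
  · intro f hf
    rw [Finset.mem_product]
    refine ⟨he f hf, ?_⟩
    have := hsum f hf
    have := hhd f hf
    rw [Finset.mem_range]; show (g f).natDegree < n
    omega
  · rintro ⟨e0, a⟩ _ V hV hVe
    rcases V.eq_empty_or_nonempty with rfl | ⟨f0, hf0⟩
    · simp; positivity
    have hf0T := hV hf0
    have hVe' : ∀ f ∈ V, e f = e0 ∧ (g f).natDegree = a := fun f hf => by
      have := hVe f hf; simpa using this
    obtain ⟨h1, h2⟩ := hVe' f0 hf0
    set A : ℝ := 2^e0 with hA
    set B : ℝ := 4 * (n+1) * N / A with hB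
    have hA1 : 1 ≤ A := one_le_pow₀ (by norm_num)
    have hB1 : 1 ≤ B := by
      have := hMh f0 hf0T
      rw [h1] at this
      exact (one_le_mM (hh f0 hf0T)).trans this
    have ha : 1 ≤ a ∧ a + 1 ≤ n := by
      have := hsum f0 hf0T
      have := hhd f0 hf0T
      have := hgd f0 hf0T
      omega
    have h2n : (1:ℝ) ≤ 2^n := one_le_pow₀ (by norm_num)
    have hcard : V.card ≤ (ibox a (2^n * A) ×ˢ ibox (n-a) (2^n*B)).card := by
      refine Finset.card_le_card_of_injOn (fun f => ((fun i => (g f).coeff i), fun i => (h f).coeff i)) ?_ ?_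
      · intro f hf
        have hfT := hV hf
        obtain ⟨h3, h4⟩ := hVe' f hf
        rw [Finset.mem_coe, Finset.mem_product]
        have hs := hsum f hfT
        have m1 := hMg f hfT
        have m2 := hMh f hfT
        rw [h3] at m1 m2
        refine ⟨mem_ibox fun i => ?_, mem_ibox fun i => ?_⟩
        · refine (coeff_le_mM (n := n) (by omega) i).trans ?_
          gcongr
        · refine (coeff_le_mM (n := n) (by omega) i).trans ?_
          gcongr
      · intro f hf f' hf' hff
        simp only [Prod.mk.injEq] at hff
        have hs := hsum f (hV hf)
        have hs' := hsum f' (hV hf')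
        have d := (hVe' f hf).2
        have d' := (hVe' f' hf').2
        have e1 : g f = g f' := by
          rw [← polyOf_coeff_eq (hg f (hV hf)) d, ← polyOf_coeff_eq (hg f' (hV hf')) d']
          exact congrArg polyOf hff.1
        have e2 : h f = h f' := by
          rw [← polyOf_coeff_eq (n := n - a) (hh f (hV hf)) (by omega), ← polyOf_coeff_eq (n := n-a) (hh f' (hV hf')) (by omega)]
          exact congrArg polyOf hff.2
        rw [hfgh f (hV hf), hfgh f' (hV hf'), e1, e2]
    rw [Finset.card_product] at hcard
    have c1 := card_ibox a (one_le_mul_of_one_le_of_one_le h2n hA1)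
    have c2 := card_ibox (n-a) (one_le_mul_of_one_le_of_one_le h2n hB1)
    calc (V.card : ℝ) ≤ ((ibox a (2^n * A)).card : ℝ) * ((ibox (n-a) (2^n*B)).card : ℝ) := by
          rw [← Nat.cast_mul]; exact Nat.cast_le.2 hcard
      _ ≤ (3 * (2^n * A))^a * (3 * (2^n*B))^(n-a) :=
          mul_le_mul c1 c2 (Nat.cast_nonneg _) (pow_nonneg (by linarith [one_le_mul_of_one_le_of_one_le h2n hA1]) _)
      _ = (3*2^n)^n * (A^a * B^(n-a)) := by
          rw [← mul_assoc, ← mul_assoc, mul_pow _ A, mul_pow _ B]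
          have : ((3:ℝ)*2^n)^n = (3*2^n)^a * (3*2^n)^(n-a) := by rw [← pow_add]; congr 1; omega
          rw [this]; ring
      _ ≤ (3*2^n)^n * (A^(n-1) * B^(n-1)) := by
          gcongr
          · omega
          · omega
      _ = _ := by
          rw [← mul_pow, hB]
          congr 2
          field_simp
end

section
open Polynomial NumberField IntermediateField

section
variable {L : IntermediateField ℚ ℂ}

lemma exists_poly_of_mem {α : ℂ} (hα : IsIntegral ℚ α) {x : ℂ} (hx : x ∈ ℚ⟮α⟯) : ∃ P : ℚ[X], aeval α P = x := by
  have h1 : x ∈ (ℚ⟮α⟯).toSubalgebra := hx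
  rw [IntermediateField.adjoin_simple_toSubalgebra_of_isAlgebraic hα.isAlgebraic, Algebra.adjoin_singleton_eq_range_aeval] at h1
  exact h1

lemma minpoly_coprime {α : ℂ} (hα : IsIntegral ℚ α) (hL : L ≤ ℚ⟮α⟯) {φ ψ : L →+* ℂ} (h : φ ≠ ψ) :
    IsCoprime ((minpoly L α).map φ) ((minpoly L α).map ψ) := by
  rw [Polynomial.isCoprime_iff_aeval_ne_zero_of_isAlgClosed (K := ℂ) (k := ℂ)]
  intro γ
  by_contra hcon
  push Not at hcon
  apply h
  ext x
  obtain ⟨P, hP⟩ := exists_poly_of_mem hα (hL x.2)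
  have hdvd : minpoly L α ∣ P.map (algebraMap ℚ L) - C x := by
    apply minpoly.dvd
    simp only [map_sub, aeval_map_algebraMap, aeval_C, hP]
    exact sub_self _
  have key : ∀ θ : L →+* ℂ, aeval γ ((minpoly L α).map θ) = 0 → θ x = aeval γ P := by
    intro θ hθ
    have h1 := Polynomial.map_dvd θ hdvd
    have h2 : aeval γ ((P.map (algebraMap ℚ L) - C x).map θ) = 0 := by
      obtain ⟨q, hq⟩ := h1
      rw [hq, map_mul, hθ, zero_mul]
    rw [Polynomial.map_sub, map_C, Polynomial.map_map, map_sub, aeval_C] at h2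
    have h3 : (θ.comp (algebraMap ℚ L)) = algebraMap ℚ ℂ := RingHom.ext_rat _ _
    rw [h3, aeval_map_algebraMap] at h2
    exact (sub_eq_zero.1 h2).symm
  rw [key φ hcon.1, key ψ hcon.2]

lemma isIntegral_of_root {f : ℤ[X]} (hf : f.Monic) {α : ℂ} (h : aeval α f = 0) : IsIntegral ℤ α :=
  ⟨f, hf, h⟩

lemma minpoly_map_dvd {f : ℤ[X]} {α : ℂ} (h : aeval α f = 0) (φ : L →+* ℂ) :
    (minpoly L α).map φ ∣ f.map (Int.castRingHom ℂ) := by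
  have h1 : minpoly L α ∣ f.map (Int.castRingHom L) := by
    apply minpoly.dvd
    rw [← algebraMap_int_eq, aeval_map_algebraMap, h]
  have := Polynomial.map_dvd φ h1
  rwa [Polynomial.map_map, show φ.comp (Int.castRingHom L) = Int.castRingHom ℂ from RingHom.ext_int _ _] at this

lemma prod_minpoly_dvd [NumberField L] {f : ℤ[X]} (hf : f.Monic) {α : ℂ} (h : aeval α f = 0) (hL : L ≤ ℚ⟮α⟯) :
    ∏ φ : L →+* ℂ, (minpoly L α).map φ ∣ f.map (Int.castRingHom ℂ) := by
  apply Finset.prod_dvd_of_coprime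
  · intro φ _ ψ _ hne
    exact minpoly_coprime (isIntegral_of_root hf h).tower_top hL hne
  · intro φ _
    exact minpoly_map_dvd h φ

lemma int_L {f : ℤ[X]} (hf : f.Monic) {α : ℂ} (h : aeval α f = 0) : IsIntegral L α :=
  (isIntegral_of_root hf h).tower_top

lemma prod_mahler_le [NumberField L] {f : ℤ[X]} (hf : f.Monic) {α : ℂ} (h : aeval α f = 0) (hL : L ≤ ℚ⟮α⟯) :
    ∏ φ : L →+* ℂ, ((minpoly L α).map φ).mahlerMeasure ≤ mM f := by
  obtain ⟨q, hq⟩ := prod_minpoly_dvd hf h hL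
  have hm : (∏ φ : L →+* ℂ, (minpoly L α).map φ).Monic :=
    monic_prod_of_monic _ _ fun φ _ => (minpoly.monic (int_L hf h)).map φ
  have hqm : q.Monic := hm.of_mul_monic_left (by rw [← hq]; exact hf.map _)
  have hmul : ∀ s : Finset (L →+* ℂ), (∏ φ ∈ s, (minpoly L α).map φ).mahlerMeasure = ∏ φ ∈ s, ((minpoly L α).map φ).mahlerMeasure := by
    classical
    intro s
    induction s using Finset.induction_on with
    | empty => simp
    | insert a s ha ih => rw [Finset.prod_insert ha, Finset.prod_insert ha, mahlerMeasure_mul, ih]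
  unfold mM
  rw [hq, mahlerMeasure_mul, hmul]
  refine le_mul_of_one_le_right (Finset.prod_nonneg fun _ _ => mahlerMeasure_nonneg _) ?_
  apply one_le_mahlerMeasure_of_one_le_norm_leadingCoeff
  rw [hqm.leadingCoeff]; simp

lemma card_emb [NumberField L] : Fintype.card (L →+* ℂ) = Module.finrank ℚ L := NumberField.Embeddings.card L ℂ

lemma degree_mul_le [NumberField L] {f : ℤ[X]} (hf : f.Monic) {α : ℂ} (h : aeval α f = 0) (hL : L ≤ ℚ⟮α⟯) :
    Module.finrank ℚ L * (minpoly L α).natDegree ≤ f.natDegree := by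
  have h1 := natDegree_le_of_dvd (prod_minpoly_dvd hf h hL) (hf.map _).ne_zero
  rw [hf.natDegree_map, natDegree_prod_of_monic _ _ (fun φ _ => (minpoly.monic (int_L hf h)).map φ)] at h1
  simp only [(minpoly.monic (int_L hf h)).natDegree_map] at h1
  rw [Finset.sum_const, Finset.card_univ, card_emb] at h1
  exact h1

lemma minpoly_OL [NumberField L] {f : ℤ[X]} (hf : f.Monic) {α : ℂ} (h : aeval α f = 0) :
    minpoly L α = (minpoly (𝓞 L) α).map (algebraMap (𝓞 L) L) :=
  minpoly.isIntegrallyClosed_eq_field_fractions' L ((isIntegral_of_root hf h).tower_top)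

/-- some integer value of the relative minimal polynomial separates embeddings -/
lemma exists_sep [NumberField L] {f : ℤ[X]} (hf : f.Monic) {α : ℂ} (h : aeval α f = 0) (hL : L ≤ ℚ⟮α⟯) :
    ∃ t ∈ Finset.range (f.natDegree^3 + 1), ∀ φ ψ : L →+* ℂ,
      φ ((minpoly L α).eval (t:L)) = ψ ((minpoly L α).eval (t:L)) → φ = ψ := by
  classical
  by_contra hcon
  push Not at hcon
  set G := minpoly L α with hG
  have hGm : G.Monic := minpoly.monic (int_L hf h)
  set n := f.natDegree
  have hdn := degree_mul_le hf h hL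
  have hGd : 1 ≤ G.natDegree := minpoly.natDegree_pos (int_L hf h)
  have hb : 1 ≤ Module.finrank ℚ L := Module.finrank_pos
  have hev : ∀ (φ : L →+* ℂ) (t : ℕ), φ (G.eval (t:L)) = (G.map φ).eval (t:ℂ) := by
    intro φ t
    rw [eval_map, ← eval₂_at_natCast]
  let S : (L →+* ℂ) × (L →+* ℂ) → Finset ℕ := fun x => (Finset.range (n^3+1)).filter
    (fun t => x.1 ≠ x.2 ∧ (G.map x.1).eval (t:ℂ) = (G.map x.2).eval (t:ℂ))
  have hsub : Finset.range (n^3+1) ⊆ (Finset.univ : Finset ((L →+* ℂ) × (L →+* ℂ))).biUnion S := by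
    intro t ht
    obtain ⟨φ, ψ, h1, h2⟩ := hcon t ht
    rw [Finset.mem_biUnion]
    refine ⟨(φ, ψ), Finset.mem_univ _, Finset.mem_filter.2 ⟨ht, h2, ?_⟩⟩
    rw [← hev, ← hev]; exact h1
  have hS : ∀ x, (S x).card ≤ n := by
    intro ⟨φ, ψ⟩
    by_cases hne : φ = ψ
    · have : S (φ, ψ) = ∅ := Finset.filter_eq_empty_iff.2 fun t _ hh => hh.1 hne
      rw [this]; simp
    · have hP : G.map φ - G.map ψ ≠ 0 := by
        intro h0
        have := minpoly_coprime (isIntegral_of_root hf h).tower_top hL hne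
        rw [← hG, sub_eq_zero.1 h0, isCoprime_self] at this
        have h5 := natDegree_eq_zero_of_isUnit this
        rw [hGm.natDegree_map] at h5
        omega
      have hc : (S (φ, ψ)).card ≤ (G.map φ - G.map ψ).roots.toFinset.card := by
        refine Finset.card_le_card_of_injOn (fun t => (t:ℂ)) ?_ (fun a _ b _ hab => Nat.cast_injective hab)
        intro t ht
        have ht' := (Finset.mem_filter.1 ht).2.2
        rw [Finset.mem_coe, Multiset.mem_toFinset, mem_roots hP, IsRoot, eval_sub, ht', sub_self]
      refine hc.trans ((Multiset.toFinset_card_le _).trans ((card_roots' _).trans ?_))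
      refine (natDegree_sub_le _ _).trans ?_
      rw [hGm.natDegree_map, hGm.natDegree_map, max_self]
      nlinarith
  have h1 := (Finset.card_le_card hsub).trans (Finset.card_biUnion_le.trans (Finset.sum_le_card_nsmul _ _ _ (fun x _ => hS x)))
  rw [Finset.card_range, Finset.card_univ, Fintype.card_prod, card_emb, smul_eq_mul] at h1
  have hbn : Module.finrank ℚ L ≤ n := by nlinarith
  have : Module.finrank ℚ L * Module.finrank ℚ L * n ≤ n*n*n := by gcongr
  nlinarith

lemma irr_minpoly {f : ℤ[X]} (hf : f.Monic) (hirr : Irreducible f) {α : ℂ} (h : aeval α f = 0) :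
    minpoly ℚ α = f.map (Int.castRingHom ℚ) := by
  symm
  apply minpoly.eq_of_irreducible_of_monic
  · rw [← algebraMap_int_eq]
    exact (hf.irreducible_iff_irreducible_map_fraction_map).1 hirr
  · rw [← algebraMap_int_eq, aeval_map_algebraMap, h]
  · exact hf.map _

lemma eq_of_minpoly_eq [NumberField L] {f g : ℤ[X]} (hf : f.Monic) (hg : g.Monic) (hfi : Irreducible f) (hgi : Irreducible g)
    {α β : ℂ} (hα : aeval α f = 0) (hβ : aeval β g = 0) (h : minpoly L α = minpoly L β) : f = g := by
  have h1 : minpoly L β ∣ f.map (Int.castRingHom L) := by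
    rw [← h]
    apply minpoly.dvd
    rw [← algebraMap_int_eq, aeval_map_algebraMap, hα]
  have h2 : aeval β f = 0 := by
    obtain ⟨q, hq⟩ := h1
    have : aeval β (f.map (Int.castRingHom L)) = 0 := by rw [hq, map_mul, minpoly.aeval, zero_mul]
    rwa [← algebraMap_int_eq, aeval_map_algebraMap] at this
  have h3 := (irr_minpoly hf hfi h2).symm.trans (irr_minpoly hg hgi hβ)
  exact map_injective _ (Int.cast_injective) h3

lemma norm_coeff_le' {n : ℕ} (p : ℂ[X]) (hp : p.natDegree ≤ n) (i : ℕ) : ‖p.coeff i‖ ≤ 2^n * p.mahlerMeasure := by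
  refine (norm_coeff_le_choose_mul_mahlerMeasure i p).trans ?_
  refine mul_le_mul_of_nonneg_right ?_ (mahlerMeasure_nonneg _)
  calc _ ≤ ((2^(p.natDegree) : ℕ) : ℝ) := by exact_mod_cast Nat.choose_le_two_pow _ _
    _ ≤ _ := by
        push_cast
        exact pow_le_pow_right₀ (by norm_num) hp

lemma one_le_mahler_of_monic {p : ℂ[X]} (hp : p.Monic) : 1 ≤ p.mahlerMeasure := by
  apply one_le_mahlerMeasure_of_one_le_norm_leadingCoeff
  rw [hp.leadingCoeff]; simp

lemma fiber_count [NumberField L] (n a T : ℕ) (ha : 1 ≤ a) (hT : 1 ≤ T) (t : ℕ) (c : L) (V : Finset ℤ[X])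
    (hV : ∀ f ∈ V, f.Monic ∧ f.natDegree = n ∧ Irreducible f ∧ mM f ≤ T ∧ ∃ α : ℂ, aeval α f = 0 ∧ L ≤ ℚ⟮α⟯ ∧
      (minpoly L α).natDegree = a ∧ (minpoly L α).eval (t:L) = c) :
    (V.card : ℝ) ≤ (24^(Module.finrank ℚ L) * ((2^(n*n) * T : ℕ):ℝ))^(a-1) * (3 * LL (2^(n*n) * T))^(Module.finrank ℚ L) := by
  classical
  choose! h1 h2 h3 h4 α h5 h6 h7 h8 using hV
  let x : ℤ[X] → Fin (a-1) → 𝓞 L := fun f j => (minpoly (𝓞 L) (α f)).coeff (j+1)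
  have hcoe : ∀ f ∈ V, ∀ j : Fin (a-1), ((x f j : 𝓞 L) : L) = (minpoly L (α f)).coeff (j+1) := by
    intro f hf j
    rw [minpoly_OL (h1 f hf) (h5 f hf), coeff_map]
  have hinj : Set.InjOn x V := by
    intro f hf g hg hfg
    apply eq_of_minpoly_eq (L := L) (h1 f hf) (h1 g hg) (h3 f hf) (h3 g hg) (h5 f hf) (h5 g hg)
    have m1 := minpoly.monic (int_L (L := L) (h1 f hf) (h5 f hf))
    have m2 := minpoly.monic (int_L (L := L) (h1 g hg) (h5 g hg))
    have hco : ∀ i, 1 ≤ i → (minpoly L (α f)).coeff i = (minpoly L (α g)).coeff i := by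
      intro i hi
      rcases lt_trichotomy i a with hia | hia | hia
      · have e1 := hcoe f hf ⟨i-1, by omega⟩
        have e2 := hcoe g hg ⟨i-1, by omega⟩
        rw [show ((⟨i-1, by omega⟩ : Fin (a-1)) : ℕ) + 1 = i by simp; omega] at e1 e2
        rw [← e1, ← e2, hfg]
      · subst hia
        have e1 := m1.coeff_natDegree
        have e2 := m2.coeff_natDegree
        rw [h7 f hf] at e1
        rw [h7 g hg] at e2
        rw [e1, e2]
      · rw [coeff_eq_zero_of_natDegree_lt (by rw [h7 f hf]; exact hia), coeff_eq_zero_of_natDegree_lt (by rw [h7 g hg]; exact hia)]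
    have hC : minpoly L (α f) - minpoly L (α g) = C ((minpoly L (α f) - minpoly L (α g)).coeff 0) := by
      ext i
      rw [coeff_C]
      split_ifs with hi
      · rw [hi]
      · rw [coeff_sub, hco i (by omega), sub_self]
    have hev := congrArg (eval (t:L)) hC
    rw [eval_sub, h8 f hf, h8 g hg, sub_self, eval_C] at hev
    rw [← hev, C_0, sub_eq_zero] at hC
    exact hC
  rw [← Finset.card_image_of_injOn hinj]
  apply nf_count'
  · exact Nat.mul_pos (by positivity) hT
  intro y hy
  obtain ⟨f, hf, rfl⟩ := Finset.mem_image.1 hy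
  have hm : (minpoly L (α f)).Monic := minpoly.monic (int_L (L := L) (h1 f hf) (h5 f hf))
  have hab := degree_mul_le (h1 f hf) (h5 f hf) (h6 f hf)
  have hb : 1 ≤ Module.finrank ℚ L := Module.finrank_pos
  rw [h2 f hf, h7 f hf] at hab
  have han : a ≤ n := by nlinarith
  have hbn : Module.finrank ℚ L ≤ n := by nlinarith
  have h2n : (1:ℝ) ≤ 2^n := one_le_pow₀ (by norm_num)
  calc _ ≤ ∏ φ : L →+* ℂ, (2^n * ((minpoly L (α f)).map φ).mahlerMeasure) := by
        refine Finset.prod_le_prod (fun _ _ => by positivity) fun φ _ => ?_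
        have hM := one_le_mahler_of_monic (hm.map φ)
        refine max_le (one_le_mul_of_one_le_of_one_le h2n hM) ?_
        rw [pi_norm_le_iff_of_nonneg (by positivity)]
        intro j
        rw [hcoe f hf j, ← coeff_map]
        apply norm_coeff_le'
        rw [hm.natDegree_map, h7 f hf]; exact han
    _ = (2^n)^(Module.finrank ℚ L) * ∏ φ : L →+* ℂ, ((minpoly L (α f)).map φ).mahlerMeasure := by
        rw [Finset.prod_mul_distrib, Finset.prod_const, Finset.card_univ, card_emb]
    _ ≤ (2^n)^n * T := by
        have := (prod_mahler_le (h1 f hf) (h5 f hf) (h6 f hf)).trans (h4 f hf)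
        refine mul_le_mul (pow_le_pow_right₀ h2n hbn) this (Finset.prod_nonneg fun _ _ => mahlerMeasure_nonneg _) (by positivity)
    _ = _ := by push_cast; rw [pow_mul]

end
end

section
open Polynomial NumberField IntermediateField

lemma nf_adjoin {c : ℂ} (hc : IsIntegral ℤ c) : NumberField ℚ⟮c⟯ := by
  have : FiniteDimensional ℚ ℚ⟮c⟯ := adjoin.finiteDimensional hc.tower_top
  exact ⟨⟩

lemma minpoly_self {L : IntermediateField ℚ ℂ} (x : L) : minpoly L (x:ℂ) = X - C x :=
  minpoly.eq_X_sub_C ℂ x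

lemma mM_minpoly {c : ℂ} (hc : IsIntegral ℤ c) [NumberField ℚ⟮c⟯] :
    mM (minpoly ℤ c) = ∏ φ : ℚ⟮c⟯ →+* ℂ, max 1 ‖φ (AdjoinSimple.gen ℚ c)‖ := by
  have hm := minpoly.monic hc
  have h0 := minpoly.aeval ℤ c
  have e : minpoly ℚ⟮c⟯ c = X - C (AdjoinSimple.gen ℚ c) := minpoly_self (AdjoinSimple.gen ℚ c)
  have hd := prod_minpoly_dvd (L := ℚ⟮c⟯) hm h0 le_rfl
  simp only [e, Polynomial.map_sub, map_X, map_C] at hd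
  have hmP : (∏ φ : ℚ⟮c⟯ →+* ℂ, (X - C (φ (AdjoinSimple.gen ℚ c)))).Monic :=
    monic_prod_of_monic _ _ fun φ _ => monic_X_sub_C _
  have hdeg : (minpoly ℤ c).natDegree = Module.finrank ℚ ℚ⟮c⟯ := by
    rw [adjoin.finrank hc.tower_top, minpoly.isIntegrallyClosed_eq_field_fractions' ℚ hc, hm.natDegree_map]
  have heq : (minpoly ℤ c).map (Int.castRingHom ℂ) = ∏ φ : ℚ⟮c⟯ →+* ℂ, (X - C (φ (AdjoinSimple.gen ℚ c))) := by
    refine (eq_of_monic_of_dvd_of_natDegree_le hmP (hm.map _) hd ?_)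
    rw [hm.natDegree_map, hdeg, natDegree_prod_of_monic _ _ (fun φ _ => monic_X_sub_C _)]
    simp only [natDegree_X_sub_C, Finset.sum_const, Finset.card_univ, card_emb, smul_eq_mul, mul_one, le_refl]
  unfold mM
  rw [heq]
  have hmul : ∀ s : Finset (ℚ⟮c⟯ →+* ℂ), (∏ φ ∈ s, (X - C (φ (AdjoinSimple.gen ℚ c)))).mahlerMeasure
      = ∏ φ ∈ s, max 1 ‖φ (AdjoinSimple.gen ℚ c)‖ := by
    classical
    intro s
    induction s using Finset.induction_on with
    | empty => simp
    | insert a s ha ih => rw [Finset.prod_insert ha, Finset.prod_insert ha, mahlerMeasure_mul, ih, mahlerMeasure_X_sub_C]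
  exact hmul _

lemma natDegree_minpolyZ {c : ℂ} (hc : IsIntegral ℤ c) : (minpoly ℤ c).natDegree = Module.finrank ℚ ℚ⟮c⟯ := by
  rw [adjoin.finrank hc.tower_top, minpoly.isIntegrallyClosed_eq_field_fractions' ℚ hc, (minpoly.monic hc).natDegree_map]

/-- few polynomials per field -/
lemma field_count (n T : ℕ) (hT : 1 ≤ T) (L : IntermediateField ℚ ℂ) (V : Finset ℤ[X])
    (hV : ∀ f ∈ V, f.Monic ∧ f.natDegree = n ∧ Irreducible f ∧ mM f ≤ T ∧ ∃ α : ℂ, aeval α f = 0 ∧ ℚ⟮α⟯ = L) :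
    (V.card : ℝ) ≤ 24^n * T * (3 * LL T)^n := by
  classical
  rcases V.eq_empty_or_nonempty with rfl | ⟨f0, hf0⟩
  · have := LL_ge_one T
    simp; positivity
  have hL : NumberField L ∧ Module.finrank ℚ L = n := by
    obtain ⟨h1, h2, h3, -, α, h5, rfl⟩ := hV f0 hf0
    have hi := isIntegral_of_root h1 h5
    refine ⟨nf_adjoin hi, ?_⟩
    rw [adjoin.finrank hi.tower_top, irr_minpoly h1 h3 h5, h1.natDegree_map, h2]
  obtain ⟨hnf, hfr⟩ := hL
  choose! h1 h2 h3 h4 α h5 h6 using hV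
  have hmem : ∀ f ∈ V, α f ∈ L := fun f hf => by rw [← h6 f hf]; exact mem_adjoin_simple_self ℚ _
  have hex : ∀ f ∈ V, ∃ y : Fin 1 → 𝓞 L, ∀ j, ((y j : L) : ℂ) = α f := fun f hf =>
    ⟨fun _ => ⟨⟨α f, hmem f hf⟩, by
      have := isIntegral_of_root (h1 f hf) (h5 f hf)
      exact (isIntegral_algHom_iff (L.val.restrictScalars ℤ) L.val.injective).1 this⟩, fun _ => rfl⟩
  choose! y hy using hex
  have hinj : Set.InjOn y V := by
    intro f hf g hg hfg
    have e : α f = α g := by rw [← hy f hf 0, ← hy g hg 0, hfg]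
    have h7 := (irr_minpoly (h1 f hf) (h3 f hf) (h5 f hf)).symm.trans ((congrArg (minpoly ℚ) e).trans (irr_minpoly (h1 g hg) (h3 g hg) (h5 g hg)))
    exact map_injective _ (Int.cast_injective) h7
  have := nf_count' (K := L) 1 T hT (V.image y) ?_
  · rw [Finset.card_image_of_injOn hinj, hfr, pow_one] at this
    exact this
  intro z hz
  obtain ⟨f, hf, rfl⟩ := Finset.mem_image.1 hz
  refine le_trans (le_of_eq ?_) ((prod_mahler_le (L := L) (h1 f hf) (h5 f hf) (h6 f hf).ge).trans (h4 f hf))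
  refine Finset.prod_congr rfl fun φ _ => ?_
  rw [← hy f hf 0, minpoly_self, Polynomial.map_sub, map_X, map_C, mahlerMeasure_X_sub_C]
  congr 1
  simp [Pi.norm_def]

noncomputable def Cset (b : ℕ) (R : ℝ) : Finset ℂ := by
  classical
  exact (ibox b R).biUnion (fun a => ((polyOf a).map (Int.castRingHom ℂ)).roots.toFinset)

lemma card_Cset (b : ℕ) {R : ℝ} (hR : 1 ≤ R) : ((Cset b R).card : ℝ) ≤ (3*R)^b * b := by
  classical
  have h : (Cset b R).card ≤ (ibox b R).card * b := by
    unfold Cset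
    refine Finset.card_biUnion_le_card_mul _ _ _ fun a _ => ?_
    refine (Multiset.toFinset_card_le _).trans ((card_roots' _).trans ?_)
    rw [(polyOf_monic a).natDegree_map, polyOf_natDegree]
  have h2 := card_ibox b hR
  calc ((Cset b R).card : ℝ) ≤ ((ibox b R).card : ℝ) * b := by exact_mod_cast h
    _ ≤ _ := by gcongr

lemma mem_Cset {b : ℕ} {R : ℝ} {c : ℂ} (hc : IsIntegral ℤ c) (hb : (minpoly ℤ c).natDegree = b)
    (hR : 2^b * mM (minpoly ℤ c) ≤ R) : c ∈ Cset b R := by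
  classical
  unfold Cset
  rw [Finset.mem_biUnion]
  refine ⟨fun i => (minpoly ℤ c).coeff i, mem_ibox fun i => (coeff_le_mM hb.le i).trans hR, ?_⟩
  rw [polyOf_coeff_eq (minpoly.monic hc) hb, Multiset.mem_toFinset, mem_roots ((minpoly.monic hc).map _).ne_zero, IsRoot,
    eval_map, ← algebraMap_int_eq]
  exact minpoly.aeval ℤ c

def IsImprim (f : ℤ[X]) : Prop := Irreducible f ∧ ∃ α : ℂ, aeval α f = 0 ∧ ∃ L : IntermediateField ℚ ℂ,
  L ≤ ℚ⟮α⟯ ∧ L ≠ ⊥ ∧ L ≠ ℚ⟮α⟯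

lemma gen_of_sep {L : IntermediateField ℚ ℂ} [NumberField L] (c : L) (h : ∀ φ ψ : L →+* ℂ, φ c = ψ c → φ = ψ) :
    ℚ⟮(c:ℂ)⟯ = L := by
  have h1 : ℚ⟮c⟯ = ⊤ := by
    rw [Field.primitive_element_iff_algHom_eq_of_eval' ℚ ℂ (fun x => IsAlgClosed.splits _)]
    intro φ ψ hφ
    have := h (φ : L →+* ℂ) (ψ : L →+* ℂ) hφ
    exact AlgHom.coe_ringHom_injective this
  have h2 : adjoin ℚ (L.val '' {c}) = L := by
    rw [← IntermediateField.adjoin_map]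
    conv_rhs => rw [← L.fieldRange_val, AlgHom.fieldRange_eq_map]
    congr 1
  rwa [Set.image_singleton] at h2

lemma imprim_struct {n N : ℕ} (hN : 1 ≤ N) {f : ℤ[X]} (hb : InBox n N f) (hf : IsImprim f) :
    ∃ t ∈ Finset.range (n^3+1), ∃ c : ℂ, IsIntegral ℤ c ∧ 2 ≤ (minpoly ℤ c).natDegree ∧
      mM (minpoly ℤ c) ≤ ((n+1) * 2^n * (n^3)^n)^n * ((n+1) * N) ∧
      ∃ α : ℂ, aeval α f = 0 ∧ ℚ⟮c⟯ ≤ ℚ⟮α⟯ ∧ 2 ≤ (minpoly ℚ⟮c⟯ α).natDegree ∧ 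
        (minpoly ℤ c).natDegree * (minpoly ℚ⟮c⟯ α).natDegree ≤ n ∧
        (minpoly ℚ⟮c⟯ α).eval (t:ℚ⟮c⟯) = AdjoinSimple.gen ℚ c := by
  obtain ⟨hirr, α, hα, L, hLα, hLb, hLn⟩ := hf
  have hm := hb.1
  have hi := isIntegral_of_root hm hα
  have hfd : FiniteDimensional ℚ ℚ⟮α⟯ := adjoin.finiteDimensional hi.tower_top
  have hnfL : NumberField L := by
    have : FiniteDimensional ℚ L := Module.Finite.of_injective (inclusion hLα).toLinearMap (inclusion hLα).injective
    exact ⟨⟩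
  obtain ⟨t, ht, hsep⟩ := exists_sep hm hα hLα
  have hL := gen_of_sep _ hsep
  set c : ℂ := (((minpoly L α).eval (t:L) : L) : ℂ) with hc
  clear_value c
  subst hL
  have hcg : (minpoly ℚ⟮c⟯ α).eval (t:ℚ⟮c⟯) = AdjoinSimple.gen ℚ c := Subtype.ext hc.symm
  have hci : IsIntegral ℤ c := by
    have h1 := minpoly_OL (L := ℚ⟮c⟯) hm hα
    have h2 : AdjoinSimple.gen ℚ c = algebraMap (𝓞 ℚ⟮c⟯) ℚ⟮c⟯ ((minpoly (𝓞 ℚ⟮c⟯) α).eval (t : 𝓞 ℚ⟮c⟯)) := by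
      rw [← hcg, h1, eval_map, ← eval₂_at_natCast]
    have h3 : IsIntegral ℤ (AdjoinSimple.gen ℚ c) := by rw [h2]; exact RingOfIntegers.isIntegral_coe _
    exact h3.map (ℚ⟮c⟯.val.restrictScalars ℤ)
  rw [hb.2.1] at ht
  have hdeg := degree_mul_le (L := ℚ⟮c⟯) hm hα hLα
  rw [hb.2.1, ← natDegree_minpolyZ hci] at hdeg
  have hGm : (minpoly ℚ⟮c⟯ α).Monic := minpoly.monic (int_L hm hα)
  have hGp : 1 ≤ (minpoly ℚ⟮c⟯ α).natDegree := minpoly.natDegree_pos (int_L hm hα)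
  have hcp : 1 ≤ (minpoly ℤ c).natDegree := minpoly.natDegree_pos hci
  have ha : 2 ≤ (minpoly ℚ⟮c⟯ α).natDegree := by
    by_contra hlt
    apply hLn
    apply le_antisymm hLα
    rw [adjoin_simple_le_iff]
    have h1 : (minpoly ℚ⟮c⟯ α).degree = 1 := by
      rw [degree_eq_natDegree hGm.ne_zero]; norm_cast; omega
    obtain ⟨y, hy⟩ := minpoly.mem_range_of_degree_eq_one ℚ⟮c⟯ α h1
    rw [← hy]; exact y.2
  have hb2 : 2 ≤ (minpoly ℤ c).natDegree := by
    by_contra hlt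
    apply hLb
    rw [← IntermediateField.finrank_eq_one_iff, ← natDegree_minpolyZ hci]
    omega
  refine ⟨t, ht, c, hci, hb2, ?_, α, hα, hLα, ha, hdeg, hcg⟩
  have han : (minpoly ℚ⟮c⟯ α).natDegree ≤ n := by nlinarith
  have hn1 : 1 ≤ n := by omega
  have hbn : Fintype.card (ℚ⟮c⟯ →+* ℂ) ≤ n := by rw [card_emb, ← natDegree_minpolyZ hci]; nlinarith
  have htn : (t:ℝ) ≤ (n:ℝ)^3 := by
    rw [Finset.mem_range] at ht
    exact_mod_cast (show t ≤ n^3 by omega)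
  have hn3 : (1:ℝ) ≤ (n:ℝ)^3 := one_le_pow₀ (by exact_mod_cast hn1)
  have h2n : (1:ℝ) ≤ 2^n := one_le_pow₀ (by norm_num)
  set E : ℝ := (n+1) * 2^n * (n^3)^n with hE
  have hE1 : 1 ≤ E := by
    have h1 : (1:ℝ) ≤ (n:ℝ) + 1 := by linarith [(Nat.cast_nonneg n : (0:ℝ) ≤ n)]
    exact one_le_mul_of_one_le_of_one_le (one_le_mul_of_one_le_of_one_le h1 h2n) (one_le_pow₀ hn3)
  rw [mM_minpoly hci]
  calc _ ≤ ∏ φ : ℚ⟮c⟯ →+* ℂ, (E * ((minpoly ℚ⟮c⟯ α).map φ).mahlerMeasure) := by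
        refine Finset.prod_le_prod (fun _ _ => by positivity) fun φ _ => ?_
        have hM := one_le_mahler_of_monic (hGm.map φ)
        refine max_le (one_le_mul_of_one_le_of_one_le hE1 hM) ?_
        rw [← hcg, show φ ((minpoly ℚ⟮c⟯ α).eval (t:ℚ⟮c⟯)) = ((minpoly ℚ⟮c⟯ α).map φ).eval (t:ℂ) by
          rw [eval_map, ← eval₂_at_natCast]]
        rw [eval_eq_sum_range' (n := n+1) (by rw [hGm.natDegree_map]; omega)]
        refine (norm_sum_le _ _).trans ?_
        calc _ ≤ ∑ i ∈ Finset.range (n+1), (2^n * ((minpoly ℚ⟮c⟯ α).map φ).mahlerMeasure) * ((n:ℝ)^3)^n := by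
              refine Finset.sum_le_sum fun i hi => ?_
              rw [norm_mul, norm_pow, Complex.norm_natCast]
              rw [Finset.mem_range] at hi
              have h5 := norm_coeff_le' (n := n) ((minpoly ℚ⟮c⟯ α).map φ) (by rw [hGm.natDegree_map]; exact han) i
              refine mul_le_mul h5 ?_ (by positivity) (by positivity)
              calc (t:ℝ)^i ≤ ((n:ℝ)^3)^i := by gcongr
                _ ≤ _ := pow_le_pow_right₀ hn3 (by omega)
          _ = _ := by
              rw [Finset.sum_const, Finset.card_range, nsmul_eq_mul, hE]; push_cast; ring
    _ = E^(Fintype.card (ℚ⟮c⟯ →+* ℂ)) * ∏ φ : ℚ⟮c⟯ →+* ℂ, ((minpoly ℚ⟮c⟯ α).map φ).mahlerMeasure := by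
        rw [Finset.prod_mul_distrib, Finset.prod_const, Finset.card_univ]
    _ ≤ E^n * ((n+1) * N) := by
        have := (prod_mahler_le hm hα hLα).trans (mM_box hN hb)
        exact mul_le_mul (pow_le_pow_right₀ hE1 hbn) this (Finset.prod_nonneg fun _ _ => mahlerMeasure_nonneg _) (by positivity)

lemma count_imprim (n : ℕ) : PL n (fun _ f => IsImprim f) := by
  classical
  set E : ℝ := (n+1) * 2^n * (n^3)^n with hE
  set R0 : ℝ := 2^n * (E^n * (n+1)) + 1 with hR0
  set Q : ℕ := 2^(n*n) * (n+1) with hQ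
  have hE0 : 0 ≤ E := by positivity
  have hR1 : 1 ≤ R0 := by rw [hR0]; linarith [show 0 ≤ 2^n * (E^n * (n+1)) by positivity]
  have hQ1 : 1 ≤ Q := Nat.mul_pos (by positivity) (by omega)
  have hLQ := LL_ge_one Q
  refine ⟨(n^3+1) * (n+1) * (n+1) * ((3*R0)^n * n) * ((24^n * Q)^n * (3*LL Q)^n), by positivity, n, fun N hN T hT => ?_⟩
  have hN1 : (1:ℝ) ≤ N := by exact_mod_cast (show 1 ≤ N by omega)
  have hstr := fun f (hf : f ∈ T) => imprim_struct (n := n) (N := N) (by omega) (hT f hf).1 (hT f hf).2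
  choose! t ht c hc hc2 hcM α h1 h2 h3 h4 h5 using hstr
  set K1 := Finset.range (n^3+1) ×ˢ (Finset.range (n+1) ×ˢ Finset.range (n+1)) with hK1
  have main := card_le_keys T K1 (fun f => (t f, (minpoly ℤ (c f)).natDegree, (minpoly ℚ⟮c f⟯ (α f)).natDegree))
    (((3*R0)^n * n) * (((24^n * Q)^n * (3*LL Q)^n)) * (N:ℝ)^(n-1) * LL N^n) ?_ ?_
  · refine main.trans (le_of_eq ?_)
    rw [hK1]
    simp only [Finset.card_product, Finset.card_range]
    push_cast
    ring
  · intro f hf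
    have := h4 f hf
    have := hc2 f hf
    have := h3 f hf
    rw [hK1]
    simp only [Finset.mem_product]
    refine ⟨ht f hf, ?_, ?_⟩
    · rw [Finset.mem_range]; nlinarith
    · rw [Finset.mem_range]; nlinarith
  rintro ⟨t0, b, a⟩ _ V hVT hV
  have hV1 : ∀ f ∈ V, t f = t0 ∧ (minpoly ℤ (c f)).natDegree = b ∧ (minpoly ℚ⟮c f⟯ (α f)).natDegree = a := by
    intro f hf
    have := hV f hf
    simpa using this
  rcases V.eq_empty_or_nonempty with rfl | ⟨f0, hf0⟩
  · have := LL_ge_one N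
    simp; positivity
  have hab : 2 ≤ a ∧ 2 ≤ b ∧ b * a ≤ n := by
    have e := hV1 f0 hf0
    have := h4 f0 (hVT hf0)
    have := hc2 f0 (hVT hf0)
    have := h3 f0 (hVT hf0)
    rw [e.2.1, e.2.2] at *
    rw [e.2.1] at *
    exact ⟨by assumption, by assumption, by assumption⟩
  obtain ⟨ha, hb, hban⟩ := hab
  have hbn : b ≤ n := by nlinarith
  have hsum : b + (a-1) ≤ n-1 := by
    obtain ⟨a', rfl⟩ : ∃ a', a = a'+2 := ⟨a-2, by omega⟩
    obtain ⟨b', rfl⟩ : ∃ b', b = b'+2 := ⟨b-2, by omega⟩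
    have : b' + 2 + (a' + 2) ≤ n := by nlinarith
    omega
  have han : a - 1 ≤ n := by omega
  have hRN : 1 ≤ R0 * N := one_le_mul_of_one_le_of_one_le hR1 hN1
  have hQN : (1:ℝ) ≤ 24^n * Q := one_le_mul_of_one_le_of_one_le (one_le_pow₀ (by norm_num)) (by exact_mod_cast hQ1)
  have main2 := card_le_keys V (Cset b (R0*N)) c ((24^n * (Q*N))^(a-1) * (3*(LL Q * LL N))^n) ?_ ?_
  · refine main2.trans ?_
    have c1 := card_Cset b hRN
    have hLN := LL_ge_one N
    calc _ ≤ ((3*(R0*N))^b * b) * ((24^n * (Q*N))^(a-1) * (3*(LL Q * LL N))^n) := by gcongr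
      _ = ((3*R0)^b * b) * ((24^n * Q)^(a-1) * (3 * LL Q)^n) * (N:ℝ)^(b+(a-1)) * LL N^n := by
          rw [← mul_assoc 3, ← mul_assoc ((24:ℝ)^n), ← mul_assoc 3, mul_pow _ (N:ℝ), mul_pow _ (N:ℝ), mul_pow _ (LL N), pow_add]
          ring
      _ ≤ _ := by
          have e1 : (3*R0)^b ≤ (3*R0)^n := pow_le_pow_right₀ (by linarith) hbn
          have e2 : ((24:ℝ)^n * Q)^(a-1) ≤ (24^n * Q)^n := pow_le_pow_right₀ hQN han
          have e3 : (N:ℝ)^(b+(a-1)) ≤ (N:ℝ)^(n-1) := pow_le_pow_right₀ hN1 hsum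
          have e4 : (b:ℝ) ≤ n := by exact_mod_cast hbn
          gcongr
  · intro f hf
    have e := hV1 f hf
    apply mem_Cset (hc f (hVT hf)) e.2.1
    have := hcM f (hVT hf)
    calc _ ≤ 2^n * (E^n * ((n+1) * N)) := by
          gcongr
          · exact mahlerMeasure_nonneg _
          · norm_num
      _ ≤ _ := by rw [hR0]; nlinarith
  intro c0 _ W hWV hW
  rcases W.eq_empty_or_nonempty with rfl | ⟨f1, hf1⟩
  · have := LL_ge_one N
    simp; positivity
  have hc0 : IsIntegral ℤ c0 := by rw [← hW f1 hf1]; exact hc f1 (hVT (hWV hf1))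
  have hfr : Module.finrank ℚ ℚ⟮c0⟯ = b := by
    rw [← natDegree_minpolyZ hc0, ← hW f1 hf1]; exact (hV1 f1 (hWV hf1)).2.1
  haveI := nf_adjoin hc0
  have hfc := fiber_count (L := ℚ⟮c0⟯) n a ((n+1)*N) (by omega) (Nat.mul_pos (by omega) (by omega)) t0 (AdjoinSimple.gen ℚ c0) W ?_
  · refine hfc.trans ?_
    rw [hfr, ← mul_assoc, ← hQ]
    have e1 := LL_mul_le Q N hQ1 (by omega)
    have e3 := LL_ge_one (Q*N)
    have hLN := LL_ge_one N
    calc _ ≤ (24^n * ((Q*N : ℕ):ℝ))^(a-1) * (3 * LL (Q*N))^n := by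
          gcongr
          · norm_num
          · linarith
      _ ≤ _ := by push_cast; gcongr
  · intro f hf
    have hfT := hVT (hWV hf)
    refine ⟨(hT f hfT).1.1, (hT f hfT).1.2.1, (hT f hfT).2.1, ?_, α f, h1 f hfT, ?_, ?_, ?_⟩
    · have := mM_box (by omega) (hT f hfT).1
      push_cast; exact this
    · rw [← hW f hf]; exact h2 f hfT
    · rw [← hW f hf]; exact (hV1 f (hWV hf)).2.2
    · have e := hW f hf
      have h5a := h5 f hfT
      rw [(hV1 f (hWV hf)).1] at h5a
      subst e
      exact h5a
end

section
open Polynomial NumberField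

lemma trace_idem {R ι : Type*} [CommRing R] [IsLocalRing R] [Fintype ι] [DecidableEq ι]
    (f : (ι → R) →ₗ[R] (ι → R)) (h : IsIdempotentElem f) :
    ∃ r ≤ Fintype.card ι, LinearMap.trace R _ f = (r : R) ∧ (r = 0 → f = 0) := by
  obtain ⟨m, hm⟩ := f.isProj_iff_isIdempotentElem.mpr h
  have hc : IsCompl m (LinearMap.ker f) := hm.isCompl
  have p1 : Module.Projective R m := Module.Projective.of_split m.subtype hm.codRestrict (by
    ext x; simp [hm.codRestrict_apply_cod])
  have f1 : Module.Finite R m := Module.Finite.of_surjective hm.codRestrict (fun x => ⟨x, hm.codRestrict_apply_cod x⟩)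
  have hk : ∀ x, (LinearMap.id - f : (ι → R) →ₗ[R] (ι → R)) x ∈ LinearMap.ker f := fun x => by
    have := congrArg (fun g => g x) h
    simp at this
    simp [this]
  have hk2 : ∀ x : LinearMap.ker f, LinearMap.codRestrict (LinearMap.ker f) (LinearMap.id - f) hk x = x := by
    intro x; ext1; simp
  have p2 : Module.Projective R (LinearMap.ker f) := Module.Projective.of_split (LinearMap.ker f).subtype
    (LinearMap.codRestrict _ (LinearMap.id - f) hk) (by ext1 x; exact hk2 x)
  have f2 : Module.Finite R (LinearMap.ker f) := Module.Finite.of_surjective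
    (LinearMap.codRestrict (LinearMap.ker f) (LinearMap.id - f) hk) (fun x => ⟨x, hk2 x⟩)
  have g1 : Module.Free R m := Module.free_of_flat_of_isLocalRing
  have g2 : Module.Free R (LinearMap.ker f) := Module.free_of_flat_of_isLocalRing
  refine ⟨Module.finrank R m, ?_, hm.trace, ?_⟩
  · rw [← Module.finrank_pi R (ι := ι)]
    exact LinearMap.finrank_le_finrank_of_injective m.subtype_injective
  · intro h0
    refine LinearMap.ext fun x => ?_
    have := (Module.finBasis R m).ext_elem (x := ⟨f x, hm.map_mem x⟩) (y := 0) (fun i => (by rw [h0] at i; exact i.elim0))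
    simpa using congrArg Subtype.val this

lemma zmod_local {p k : ℕ} (hp : p.Prime) (hk : 1 < p^k) : IsLocalRing (ZMod (p^k)) := by
  haveI := Fact.mk hp
  haveI : Fact (1 < p^k) := ⟨hk⟩
  exact IsLocalRing.of_surjective' (PadicInt.toZModPow (p := p) k) (ZMod.ringHom_surjective _)

lemma not_dvd_diff (K : Type) [Field K] [NumberField K] {p k : ℕ} (hp : p.Prime) (hk : Module.finrank ℚ K < p^k)
    (P Q : Ideal (𝓞 K)) (hPQ : IsCoprime P Q) (hP1 : P ≠ ⊤)
    (hmul : P * Q = Ideal.span {((p^k : ℤ) : 𝓞 K)}) : ¬ P ∣ differentIdeal ℤ (𝓞 K) := by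
  have hn : 0 < Module.finrank ℚ K := Module.finrank_pos
  have hk1 : 1 < p^k := by omega
  haveI := zmod_local hp hk1
  obtain ⟨a, ha, q, hq, haq⟩ := Submodule.mem_sup.mp ((Ideal.eq_top_iff_one _).mp (Ideal.isCoprime_iff_sup_eq.mp hPQ))
  have hidem : q * q - q ∈ P * Q := by
    have : q * q - q = - (a * q) := by rw [← sub_eq_of_eq_add' haq.symm]; ring
    rw [this]; exact (P * Q).neg_mem (Ideal.mul_mem_mul ha hq)
  have hqn : q ∉ P := fun h => hP1 ((Ideal.eq_top_iff_one _).mpr (haq ▸ P.add_mem ha h))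
  rw [hmul, Ideal.mem_span_singleton] at hidem
  obtain ⟨z, hz⟩ := hidem
  apply not_dvd_differentIdeal_of_intTrace_not_mem ℤ (p := Ideal.span {((p:ℤ)^k)}) P Q _ q hq
  · rw [Algebra.intTrace_eq_trace]
    let b := RingOfIntegers.basis K
    let A := Algebra.leftMulMatrix b q
    let Am : Matrix _ _ (ZMod (p^k)) := A.map (Int.castRingHom _)
    have hA : Am * Am = Am := by
      have h1 : Algebra.leftMulMatrix b (q*q) = Algebra.leftMulMatrix b (q + (p^k:ℤ) • z) := by
        rw [zsmul_eq_mul, ← hz]; ring_nf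
      rw [map_mul, map_add, map_zsmul] at h1
      have h2 := congrArg (fun B => B.map (Int.castRingHom (ZMod (p^k)))) h1
      simp only [Matrix.map_mul] at h2
      refine h2.trans ?_
      ext i j
      have h3 : ((p:ZMod (p^k)))^k = 0 := by exact_mod_cast ZMod.natCast_self (p^k)
      simp only [Matrix.map_apply, Matrix.add_apply, Matrix.smul_apply, smul_eq_mul, Int.coe_castRingHom, Int.cast_add,
        Int.cast_mul, Int.cast_pow, Int.cast_natCast, h3, zero_mul, add_zero, Am, A]
    obtain ⟨r, hr, htr, hr0⟩ := trace_idem (Matrix.toLin' Am) (by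
      rw [IsIdempotentElem, Module.End.mul_eq_comp, ← Matrix.toLin'_mul, hA])
    have hcard : Fintype.card (Module.Free.ChooseBasisIndex ℤ (𝓞 K)) = Module.finrank ℚ K := by
      rw [← RingOfIntegers.rank, Module.finrank_eq_card_chooseBasisIndex]
    rw [hcard] at hr
    rw [Ideal.mem_span_singleton, Algebra.trace_eq_matrix_trace b]
    intro hd
    have h1 : ((r:ℕ) : ZMod (p^k)) = 0 := by
      rw [← htr, Matrix.trace_toLin'_eq]
      have : Am.trace = ((A.trace : ℤ) : ZMod (p^k)) := by
        simp [Am, Matrix.trace]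
      rw [this, ZMod.intCast_zmod_eq_zero_iff_dvd]
      exact_mod_cast hd
    rw [ZMod.natCast_eq_zero_iff] at h1
    have h2 : r = 0 := Nat.eq_zero_of_dvd_of_lt h1 (by omega)
    have h3 := hr0 h2
    rw [LinearEquiv.map_eq_zero_iff] at h3
    apply hqn
    have h4 : ∀ i, ((p^k : ℕ):ℤ) ∣ b.repr q i := by
      intro i
      rw [← ZMod.intCast_zmod_eq_zero_iff_dvd]
      have := Algebra.leftMulMatrix_mulVec_repr b q 1
      have h5 := congrFun this i
      rw [mul_one] at h5
      rw [← h5, Matrix.mulVec, dotProduct, Int.cast_sum]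
      apply Finset.sum_eq_zero
      intro j _
      have := congrFun (congrFun h3 i) j
      have h8 : ((A i j : ℤ) : ZMod (p^k)) = 0 := this
      rw [Int.cast_mul]
      exact mul_eq_zero_of_left h8 _
    choose w hw using h4
    have h6 : q = ((p^k:ℤ):𝓞 K) * ∑ i, w i • b i := by
      rw [← b.sum_repr q, Finset.mul_sum]
      refine Finset.sum_congr rfl fun i _ => ?_
      rw [hw i]; simp [mul_assoc]
    have h7 : q ∈ P * Q := by rw [hmul, Ideal.mem_span_singleton]; exact ⟨_, h6⟩
    exact Ideal.mul_le_left h7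
  · rw [hmul, Ideal.map_span]; simp
end

section
open Polynomial NumberField

lemma emul_diff_lt (K : Type) [Field K] [NumberField K] {p k : ℕ} (hp : p.Prime) (hk : Module.finrank ℚ K < p^k)
    (P : Ideal (𝓞 K)) (hP : Prime P) (hpP : (p : 𝓞 K) ∈ P) :
    emultiplicity P (differentIdeal ℤ (𝓞 K)) + 1 ≤ emultiplicity P (Ideal.span {((p^k : ℤ) : 𝓞 K)}) := by
  have hne : Ideal.span {((p^k : ℤ) : 𝓞 K)} ≠ 0 := by
    rw [Ideal.zero_eq_bot, Ne, Ideal.span_singleton_eq_bot]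
    have : p ≠ 0 := hp.ne_zero
    push_cast; positivity
  have hfin : FiniteMultiplicity P (Ideal.span {((p^k : ℤ) : 𝓞 K)}) :=
    FiniteMultiplicity.of_prime_left hP hne
  obtain ⟨Q, hQ, hPQ⟩ := hfin.exists_eq_pow_mul_and_not_dvd
  set m := multiplicity P (Ideal.span {((p^k : ℤ) : 𝓞 K)}) with hm
  have hk0 : k ≠ 0 := by
    rintro rfl
    have : 0 < Module.finrank ℚ K := Module.finrank_pos
    simp at hk; omega
  have hmpos : m ≠ 0 := by
    intro h0
    apply (multiplicity_eq_zero.mp h0)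
    rw [Ideal.dvd_span_singleton]
    push_cast
    exact P.pow_mem_of_mem hpP k (by omega)
  haveI hmax : P.IsMaximal := (Ideal.isPrime_of_prime hP).isMaximal hP.ne_zero
  have hcop : IsCoprime (P^m) Q := by
    apply IsCoprime.pow_left
    rw [Ideal.isCoprime_iff_sup_eq]
    by_contra hne
    have h2 : P ⊔ Q = P := (hmax.eq_of_le hne le_sup_left).symm
    exact hPQ (Ideal.dvd_iff_le.mpr (sup_eq_left.mp h2))
  have := not_dvd_diff K hp hk (P^m) Q hcop (by
    intro h
    have h2 : P ^ m ≤ P := Ideal.pow_le_self hmpos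
    rw [h] at h2
    exact hmax.ne_top (top_le_iff.mp h2)) hQ.symm
  rw [hfin.emultiplicity_eq_multiplicity, ← hm]
  rw [← emultiplicity_lt_iff_not_dvd] at this
  exact Order.add_one_le_of_lt this

lemma emul_radical_le {K : Type} [Field K] [NumberField K] {P R : Ideal (𝓞 K)} (hP : Prime P) (hR0 : R ≠ 0)
    (hR : ∀ x, x * x ∈ R → x ∈ R) : emultiplicity P R ≤ 1 := by
  by_contra hlt
  have h2 : (2:ℕ) ≤ emultiplicity P R := by
    rw [not_le] at hlt
    exact Order.add_one_le_of_lt hlt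
  obtain ⟨J, hJ⟩ := pow_dvd_of_le_emultiplicity h2
  have hJ0 : P * J ≠ 0 := by
    intro h0; apply hR0; rw [hJ, pow_two, mul_assoc, h0, mul_zero]
  have h3 : P * J ≤ R := by
    intro x hx
    apply hR
    have : R = P * J * P := by rw [hJ]; ring
    rw [this]
    exact Ideal.mul_mem_mul hx (Ideal.mul_le_left hx)
  have h4 : R ∣ P * J := Ideal.dvd_iff_le.mpr h3
  have h5 : P * J * P ∣ P * J * 1 := by rw [mul_one]; convert h4 using 1; rw [hJ]; ring
  exact hP.not_unit (isUnit_of_dvd_one ((mul_dvd_mul_iff_left hJ0).mp h5))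

lemma disc_bound (K : Type) [Field K] [NumberField K] (S : Finset ℕ)
    (hS : ∀ p, p ∈ S ↔ p.Prime ∧ Module.finrank ℚ K < p ∧ p ∣ (discr K).natAbs)
    (R : ℕ → Ideal (𝓞 K)) (hRp : ∀ p ∈ S, (p : 𝓞 K) ∈ R p) (hR : ∀ p ∈ S, ∀ x, x * x ∈ R p → x ∈ R p) :
    (discr K).natAbs * ∏ p ∈ S, Ideal.absNorm (R p) ∣
      ((Nat.factorial (Module.finrank ℚ K))^(Module.finrank ℚ K) * ∏ p ∈ S, p)^(Module.finrank ℚ K) := by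
  set n := Module.finrank ℚ K with hn
  set c : ℕ := (Nat.factorial n)^n * ∏ p ∈ S, p with hc
  have hc0 : c ≠ 0 := by
    rw [hc, mul_ne_zero_iff]
    exact ⟨pow_ne_zero _ (Nat.factorial_ne_zero _), Finset.prod_ne_zero_iff.mpr fun p hp => ((hS p).mp hp).1.ne_zero⟩
  have hRne : ∀ p ∈ S, R p ≠ 0 := by
    intro p hp h0
    have h1 := hRp p hp
    rw [h0] at h1
    have h2 : (p : 𝓞 K) = 0 := h1
    exact ((hS p).mp hp).1.ne_zero (by exact_mod_cast h2)
  have hD0 : differentIdeal ℤ (𝓞 K) ≠ 0 := differentIdeal_ne_bot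
  have key : differentIdeal ℤ (𝓞 K) * ∏ p ∈ S, R p ∣ Ideal.span {(c : 𝓞 K)} := by
    rw [UniqueFactorizationMonoid.dvd_iff_emultiplicity_le (mul_ne_zero hD0 (Finset.prod_ne_zero_iff.mpr hRne))]
    intro P hP
    haveI hPp := Ideal.isPrime_of_prime hP
    obtain ⟨p, hp, hpP⟩ : ∃ p : ℕ, p.Prime ∧ (p : 𝓞 K) ∈ P := by
      have h1 : Ideal.absNorm P ≠ 1 := by rw [Ne, Ideal.absNorm_eq_one_iff]; exact hPp.ne_top
      have h2 : ((Ideal.absNorm P : ℕ) : 𝓞 K) ∈ P := Ideal.absNorm_mem P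
      have h3 : Ideal.absNorm P ≠ 0 := by rw [Ne, Ideal.absNorm_eq_zero_iff]; exact hP.ne_zero
      rw [← Nat.prod_factorization_pow_eq_self h3, Finsupp.prod, Nat.cast_prod, hPp.prod_mem_iff] at h2
      obtain ⟨p, hp, hpP⟩ := h2
      rw [Nat.cast_pow] at hpP
      exact ⟨p, Nat.prime_of_mem_primeFactors hp, hPp.mem_of_pow_mem _ hpP⟩
    have hother : ∀ q ∈ S, q ≠ p → emultiplicity P (R q) = 0 := by
      intro q hq hqp
      rw [emultiplicity_eq_zero, Ideal.dvd_iff_le]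
      intro hle
      have h1 := hle (hRp q hq)
      have h2 : IsCoprime (q:ℤ) (p:ℤ) := Nat.isCoprime_iff_coprime.mpr ((Nat.coprime_primes ((hS q).mp hq).1 hp).mpr hqp)
      obtain ⟨a, b, hab⟩ := h2
      apply hPp.ne_top
      rw [Ideal.eq_top_iff_one]
      have h3 := congrArg (fun z : ℤ => (z : 𝓞 K)) hab
      simp only [Int.cast_add, Int.cast_mul, Int.cast_natCast, Int.cast_one] at h3
      rw [← h3]
      exact P.add_mem (P.mul_mem_left _ h1) (P.mul_mem_left _ hpP)
    have hmono : ∀ m : ℕ, m ∣ c → emultiplicity P (Ideal.span {((m:ℤ) : 𝓞 K)}) ≤ emultiplicity P (Ideal.span {(c : 𝓞 K)}) := by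
      intro m hm
      apply emultiplicity_le_emultiplicity_of_dvd_right
      rw [Ideal.dvd_span_singleton, Ideal.mem_span_singleton]
      obtain ⟨t, ht⟩ := hm
      exact ⟨t, by rw [ht]; push_cast; ring⟩
    rw [emultiplicity_mul hP, Finset.emultiplicity_prod hP]
    by_cases hpn : p ≤ n
    · rw [Finset.sum_eq_zero (fun q hq => hother q hq (fun h => by have := ((hS q).mp hq).2.1; omega)), add_zero]
      have h1 := emul_diff_lt K hp (k := n) (Nat.lt_pow_self hp.one_lt) P hP hpP
      refine (le_self_add.trans h1).trans ?_
      have := hmono (p^n) (Dvd.dvd.mul_right (pow_dvd_pow_of_dvd ((hp.dvd_factorial).mpr hpn) n) _)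
      exact_mod_cast this
    · by_cases hpS : p ∈ S
      · rw [Finset.sum_eq_single p hother (fun h => absurd hpS h)]
        have h1 := emul_diff_lt K hp (k := 1) (by rw [pow_one]; omega) P hP hpP
        refine (add_le_add_right (emul_radical_le hP (hRne p hpS) (hR p hpS)) _).trans (h1.trans ?_)
        have := hmono p (Dvd.dvd.mul_left (Finset.dvd_prod_of_mem _ hpS) _)
        rw [pow_one]
        exact this
      · rw [Finset.sum_eq_zero (fun q hq => hother q hq (fun h => hpS (h ▸ hq))), add_zero]
        have : emultiplicity P (differentIdeal ℤ (𝓞 K)) = 0 := by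
          rw [emultiplicity_eq_zero]
          intro hd
          apply hpS
          rw [hS]
          refine ⟨hp, by omega, ?_⟩
          rw [← absNorm_differentIdeal K (𝓞 K)]
          refine dvd_trans ?_ (map_dvd Ideal.absNorm hd)
          have h2 : P.absNorm ∣ p^n := by
            have := map_dvd Ideal.absNorm (Ideal.dvd_span_singleton.mpr hpP)
            rwa [Ideal.absNorm_span_natCast, RingOfIntegers.rank] at this
          obtain ⟨j, hj, hj2⟩ := (Nat.dvd_prime_pow hp).mp h2
          rw [hj2]
          apply dvd_pow_self
          rintro rfl
          rw [pow_zero, Ideal.absNorm_eq_one_iff] at hj2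
          exact hPp.ne_top hj2
        rw [this]; exact zero_le
  have h1 := map_dvd Ideal.absNorm key
  rw [map_mul, map_prod, absNorm_differentIdeal K (𝓞 K), Ideal.absNorm_span_natCast, RingOfIntegers.rank] at h1
  exact h1
end

section
open Polynomial NumberField
open scoped Pointwise

abbrev mR {K M : Type} [Field K] [Field M] (φ : K →+* M) : 𝓞 K →+* 𝓞 M := RingOfIntegers.mapRingHom φ

lemma inertia_exists {K M : Type} [Field K] [NumberField K] [Field M] [NumberField M] [IsGalois ℚ M]
    (P : Ideal (𝓞 M)) [hP : P.IsPrime] (φ₁ φ₂ : K →+* M) (h : ∀ x : 𝓞 K, mR φ₁ x - mR φ₂ x ∈ P) :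
    ∃ σ : M ≃+* M, (∀ x, σ (φ₁ x) = φ₂ x) ∧ ∀ x : 𝓞 M, mR (σ : M →+* M) x - x ∈ P := by
  letI : Algebra K M := φ₁.toAlgebra
  haveI : IsGalois K M := IsGalois.tower_top_of_isGalois ℚ K M
  obtain ⟨τ, hτ⟩ : ∃ τ : M ≃+* M, ∀ x, τ (φ₁ x) = φ₂ x := by
    let t := (RingHom.toRatAlgHom φ₂).liftNormal M
    have ht : Function.Bijective t := AlgHom.normal_bijective ℚ M M t
    refine ⟨RingEquiv.ofBijective t ht, fun x => ?_⟩
    exact AlgHom.liftNormal_commutes (RingHom.toRatAlgHom φ₂) M x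
  set P2 : Ideal (𝓞 M) := P.comap (mR (τ : M →+* M)) with hP2
  have e1 : ∀ x : 𝓞 K, mR (τ : M →+* M) (algebraMap (𝓞 K) (𝓞 M) x) = mR φ₂ x := by
    intro x
    apply RingOfIntegers.ext
    exact hτ x
  have e2 : ∀ x : 𝓞 K, algebraMap (𝓞 K) (𝓞 M) x = mR φ₁ x := fun x => rfl
  have hunder : P.under (𝓞 K) = P2.under (𝓞 K) := by
    ext x
    rw [Ideal.under_def, Ideal.under_def, Ideal.mem_comap, Ideal.mem_comap, hP2, Ideal.mem_comap, e1, e2]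
    constructor
    · intro hx
      have := P.sub_mem hx (h x)
      rwa [sub_sub_cancel] at this
    · intro hx
      have := P.add_mem (h x) hx
      rwa [sub_add_cancel] at this
  obtain ⟨g, hg⟩ := Algebra.IsInvariant.exists_smul_of_under_eq (𝓞 K) (𝓞 M) (M ≃ₐ[K] M) P P2 hunder
  let τ1 : M ≃+* M := (g : M ≃+* M).trans τ
  have hg1 : ∀ x : 𝓞 M, mR (τ1 : M →+* M) x = mR (τ : M →+* M) (g • x) := fun x => rfl
  have hτ1 : ∀ x : 𝓞 M, mR (τ1 : M →+* M) x ∈ P ↔ x ∈ P := by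
    intro x
    rw [hg1, ← Ideal.mem_comap, ← hP2, hg]
    exact Ideal.smul_mem_pointwise_smul_iff
  have hτ1K : ∀ x, τ1 (φ₁ x) = φ₂ x := by
    intro x
    have : g (φ₁ x) = φ₁ x := g.commutes x
    change τ (g (φ₁ x)) = φ₂ x
    rw [this, hτ]
  let q := P.under (𝓞 K)
  let E := RingOfIntegers.mapRingEquiv τ1
  have hE : P = Ideal.map (E : 𝓞 M →+* 𝓞 M) P := by
    ext x
    rw [Ideal.mem_map_iff_of_surjective (E : 𝓞 M →+* 𝓞 M) E.surjective]
    constructor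
    · intro hx
      refine ⟨E.symm x, ?_, E.apply_symm_apply x⟩
      rw [← hτ1]
      have : mR (τ1 : M →+* M) (E.symm x) = E (E.symm x) := rfl
      rw [this, E.apply_symm_apply]; exact hx
    · rintro ⟨y, hy, rfl⟩
      exact (hτ1 y).mpr hy
  let F : (𝓞 M ⧸ P) ≃+* (𝓞 M ⧸ P) := Ideal.quotientEquiv P P E hE
  let F' : (𝓞 M ⧸ P) ≃ₐ[𝓞 K ⧸ q] (𝓞 M ⧸ P) := AlgEquiv.ofRingEquiv (f := F) (by
    intro x
    obtain ⟨x, rfl⟩ := Ideal.Quotient.mk_surjective x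
    change F (Ideal.Quotient.mk P (algebraMap (𝓞 K) (𝓞 M) x)) = Ideal.Quotient.mk P (algebraMap (𝓞 K) (𝓞 M) x)
    change Ideal.Quotient.mk P (E (algebraMap (𝓞 K) (𝓞 M) x)) = _
    have e3 : E (algebraMap (𝓞 K) (𝓞 M) x) = mR φ₂ x := RingOfIntegers.ext (hτ1K x)
    rw [e3, e2, eq_comm, Ideal.Quotient.eq]
    exact h x)
  obtain ⟨⟨s, hs⟩, hsF⟩ := Ideal.Quotient.stabilizerHom_surjective (M ≃ₐ[K] M) q P F'
  have hs1 : ∀ x : 𝓞 M, s • x - mR (τ1 : M →+* M) x ∈ P := by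
    intro x
    rw [← Ideal.Quotient.eq]
    have := congrArg (fun a => a (Ideal.Quotient.mk P x)) hsF
    exact this
  refine ⟨(s⁻¹ : M ≃ₐ[K] M).toRingEquiv.trans τ1, fun x => ?_, fun x => ?_⟩
  · have : (s⁻¹ : M ≃ₐ[K] M) (φ₁ x) = φ₁ x := (s⁻¹ : M ≃ₐ[K] M).commutes x
    change τ1 ((s⁻¹ : M ≃ₐ[K] M) (φ₁ x)) = _
    rw [this, hτ1K]
  · have h1 := hs1 (s⁻¹ • x)
    rw [smul_inv_smul] at h1
    have h2 := P.neg_mem h1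
    rw [neg_sub] at h2
    exact h2

section
variable {K M : Type} [Field K] [NumberField K] [Field M] [NumberField M]

noncomputable def rd (P : Ideal (𝓞 M)) (φ : K →+* M) : 𝓞 K →+* 𝓞 M ⧸ P := (Ideal.Quotient.mk P).comp (mR φ)

open Classical in
noncomputable def oP (K : Type) [Field K] [NumberField K] (P : Ideal (𝓞 M)) : ℕ :=
  ((Finset.univ : Finset (K →+* M)).image (rd P)).card

open Classical in
lemma swap_of_oP [IsGalois ℚ M] (P : Ideal (𝓞 M)) [P.IsPrime] (ho : oP K P + 1 = Fintype.card (K →+* M)) :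
    ∃ a b : K →+* M, a ≠ b ∧ ∃ σ : M ≃+* M, ∀ φ : K →+* M, (σ : M →+* M).comp φ = Equiv.swap a b φ := by
  obtain ⟨a, b, hab, hne⟩ : ∃ a b : K →+* M, rd P a = rd P b ∧ a ≠ b := by
    by_contra hcon
    push Not at hcon
    have := Finset.card_image_of_injective (Finset.univ : Finset (K →+* M)) (f := rd P) hcon
    rw [Finset.card_univ] at this
    unfold oP at ho; omega
  have hinj : Set.InjOn (rd P) (((Finset.univ : Finset (K →+* M)).erase b : Finset (K →+* M)) : Set (K →+* M)) := by
    rw [← Finset.card_image_iff, Finset.card_erase_of_mem (Finset.mem_univ b), Finset.card_univ]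
    have : ((Finset.univ : Finset (K →+* M)).erase b).image (rd P) = (Finset.univ : Finset (K →+* M)).image (rd P) := by
      apply Finset.Subset.antisymm (Finset.image_subset_image (Finset.erase_subset _ _))
      intro y hy
      obtain ⟨c, _, rfl⟩ := Finset.mem_image.mp hy
      by_cases hc : c = b
      · exact Finset.mem_image.mpr ⟨a, by simp [hne], by rw [hab, hc]⟩
      · exact Finset.mem_image.mpr ⟨c, by simp [hc], rfl⟩
    rw [this]; unfold oP at ho; omega
  have hpair : ∀ c d, rd P c = rd P d → c = d ∨ (c = a ∧ d = b) ∨ (c = b ∧ d = a) := by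
    intro c d hcd
    by_cases hc : c = b <;> by_cases hd : d = b
    · left; rw [hc, hd]
    · right; right
      exact ⟨hc, hinj (by simpa using hd) (by simpa using hne) (by rw [← hcd, hab, hc])⟩
    · right; left
      exact ⟨hinj (by simpa using hc) (by simpa using hne) (by rw [hcd, hab, hd]), hd⟩
    · left; exact hinj (by simpa using hc) (by simpa using hd) hcd
  obtain ⟨σ, hσ, hσP⟩ := inertia_exists P a b (fun x => by
    rw [← Ideal.Quotient.eq]; exact congrArg (fun f => f x) hab)
  refine ⟨a, b, hne, σ, fun φ => ?_⟩
  have h1 : rd P ((σ : M →+* M).comp φ) = rd P φ := by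
    ext1 x
    change Ideal.Quotient.mk P _ = Ideal.Quotient.mk P _
    rw [Ideal.Quotient.eq]
    exact hσP (mR φ x)
  have h2 : (σ : M →+* M).comp a = b := RingHom.ext hσ
  have hσi : ∀ c d : K →+* M, (σ : M →+* M).comp c = (σ : M →+* M).comp d → c = d := by
    intro c d hcd
    ext1 x
    exact σ.injective (congrArg (fun f => f x) hcd)
  by_cases ha : φ = a
  · rw [ha, h2, Equiv.swap_apply_left]
  by_cases hb : φ = b
  · subst hb
    rw [Equiv.swap_apply_right]
    rcases hpair _ _ h1 with h | h | h
    · exact absurd (hσi _ _ (h2.trans h.symm)) hne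
    · exact h.1
    · exact absurd h.2 ha
  · rw [Equiv.swap_apply_of_ne_of_ne ha hb]
    rcases hpair _ _ h1 with h | h | h
    · exact h
    · exact absurd h.2 hb
    · exact absurd h.2 ha

lemma NR_oP {p : ℕ} (hp : p.Prime) (P : Ideal (𝓞 M)) [P.IsMaximal] (hpP : (p : 𝓞 M) ∈ P) (θ : 𝓞 K) (h : ℤ[X])
    (hh : h.map (algebraMap ℤ M) = ∏ φ : K →+* M, (X - C (φ θ))) : NR p h (oP K P) := by
  classical
  letI := Ideal.Quotient.field P
  have hch : CharP (𝓞 M ⧸ P) p := by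
    have : (p : 𝓞 M ⧸ P) = 0 := by
      have := Ideal.Quotient.eq_zero_iff_mem.mpr hpP
      rwa [map_natCast] at this
    exact (CharP.charP_iff_prime_eq_zero hp).mpr this
  have h1 : h.map (algebraMap ℤ (𝓞 M)) = ∏ φ : K →+* M, (X - C (mR φ θ)) := by
    apply Polynomial.map_injective (algebraMap (𝓞 M) M) RingOfIntegers.coe_injective
    rw [Polynomial.map_map, ← IsScalarTower.algebraMap_eq, hh, Polynomial.map_prod]
    refine Finset.prod_congr rfl fun φ _ => ?_
    simp only [Polynomial.map_sub, map_X, map_C]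
    rfl
  refine ⟨𝓞 M ⧸ P, inferInstance, hch, (Finset.univ : Finset (K →+* M)).val.map (fun φ => rd P φ θ),
    ((Finset.univ : Finset (K →+* M)).image (rd P)).image (fun f => f θ), ?_, Finset.card_image_le, ?_⟩
  · intro a ha
    simp only [Multiset.mem_map] at ha
    obtain ⟨φ, _, rfl⟩ := ha
    exact Finset.mem_image_of_mem _ (Finset.mem_image_of_mem _ (Finset.mem_univ φ))
  · have h2 := congrArg (Polynomial.map (Ideal.Quotient.mk P)) h1
    rw [Polynomial.map_map, Polynomial.map_prod] at h2
    rw [show Int.castRingHom (𝓞 M ⧸ P) = (Ideal.Quotient.mk P).comp (algebraMap ℤ (𝓞 M)) from RingHom.ext_int _ _, h2,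
      Multiset.map_map]
    refine Finset.prod_congr rfl fun φ _ => ?_
    simp only [Polynomial.map_sub, map_X, map_C, Function.comp]
    rfl

noncomputable def rK (K : Type) [Field K] [NumberField K] (P : Ideal (𝓞 M)) : Ideal (𝓞 K) := ⨅ φ : K →+* M, RingHom.ker (rd P φ)

lemma mem_rK (P : Ideal (𝓞 M)) (x : 𝓞 K) : x ∈ rK K P ↔ ∀ φ : K →+* M, rd P φ x = 0 := by
  simp [rK, Ideal.mem_iInf, RingHom.mem_ker]

lemma rK_rad (P : Ideal (𝓞 M)) [P.IsPrime] (x : 𝓞 K) (h : x * x ∈ rK K P) : x ∈ rK K P := by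
  rw [mem_rK] at *
  intro φ
  have := h φ
  rw [map_mul] at this
  exact mul_self_eq_zero.mp this

lemma rK_p {p : ℕ} (P : Ideal (𝓞 M)) (hpP : (p : 𝓞 M) ∈ P) : (p : 𝓞 K) ∈ rK K P := by
  rw [mem_rK]
  intro φ
  rw [map_natCast]
  have := Ideal.Quotient.eq_zero_iff_mem.mpr hpP
  rwa [map_natCast] at this

lemma exists_gen0 {p : ℕ} [Fact p.Prime] {V : Type} [AddCommGroup V] [Finite V] [Module (ZMod p) V] :
    ∃ (m : ℕ) (b : Fin m → V), Nat.card V = p ^ m ∧ ∀ v, ∃ c : Fin m → ℕ, v = ∑ i, c i • b i := by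
  have b := Module.finBasis (ZMod p) V
  refine ⟨_, b, by rw [Module.natCard_eq_pow_finrank (K := ZMod p), Nat.card_zmod], fun v => ⟨fun i => (b.repr v i).val, ?_⟩⟩
  conv_lhs => rw [← b.sum_repr v]
  refine Finset.sum_congr rfl fun i _ => ?_
  rw [← Nat.cast_smul_eq_nsmul (ZMod p), ZMod.natCast_zmod_val]

lemma exists_gen {p : ℕ} (hp : p.Prime) {V : Type} [AddCommGroup V] [Finite V] (h : ∀ x : V, p • x = 0) :
    ∃ (m : ℕ) (b : Fin m → V), Nat.card V = p ^ m ∧ ∀ v, ∃ c : Fin m → ℕ, v = ∑ i, c i • b i := by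
  haveI := Fact.mk hp
  letI : Module (ZMod p) V := AddCommGroup.zmodModule h
  exact exists_gen0

lemma rK_norm {p : ℕ} (hp : p.Prime) (P : Ideal (𝓞 M)) [P.IsMaximal] (hpP : (p : 𝓞 M) ∈ P) :
    p ^ oP K P ∣ Ideal.absNorm (rK K P) := by
  classical
  letI := Ideal.Quotient.field P
  set R := rK K P
  haveI := Fact.mk hp
  have hRp : (p : 𝓞 K) ∈ R := rK_p P hpP
  have hR0 : R ≠ ⊥ := by
    intro h0
    rw [h0] at hRp
    exact hp.ne_zero (by exact_mod_cast (show (p : 𝓞 K) = 0 from hRp))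
  haveI : Finite (𝓞 K ⧸ R) := Ideal.finiteQuotientOfFreeOfNeBot R hR0
  obtain ⟨m, b, hcard, hspan⟩ := exists_gen hp (V := 𝓞 K ⧸ R) (fun x => by
    have := Ideal.Quotient.eq_zero_iff_mem.mpr hRp
    rw [map_natCast] at this
    rw [nsmul_eq_mul, this, zero_mul])
  have hno : Ideal.absNorm R = Nat.card (𝓞 K ⧸ R) := rfl
  rw [hno, hcard]
  apply pow_dvd_pow
  choose s hs using fun i => Ideal.Quotient.mk_surjective (b i)
  set I := (Finset.univ : Finset (K →+* M)).image (rd P) with hI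
  have hli : LinearIndependent (𝓞 M ⧸ P) (fun f : I => (f.1 : 𝓞 K → 𝓞 M ⧸ P)) := by
    have := (linearIndependent_monoidHom (𝓞 K) (𝓞 M ⧸ P)).comp (fun f : I => (f.1 : 𝓞 K →* 𝓞 M ⧸ P)) (by
      intro f g hfg
      apply Subtype.ext
      ext x
      exact congrArg (fun F : 𝓞 K →* 𝓞 M ⧸ P => F x) hfg)
    exact this
  have hli2 : LinearIndependent (𝓞 M ⧸ P) (fun (f : I) (i : Fin m) => f.1 (s i)) := by
    rw [Fintype.linearIndependent_iff] at hli ⊢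
    intro g hg
    apply hli g
    let H : 𝓞 K →+ 𝓞 M ⧸ P := ∑ f : I, (AddMonoidHom.mulLeft (g f)).comp (f.1 : 𝓞 K →+ 𝓞 M ⧸ P)
    have hH : ∀ x, H x = ∑ f : I, g f * f.1 x := fun x => by simp [H]
    have hHR : ∀ x ∈ R, H x = 0 := by
      intro x hx
      rw [hH]
      apply Finset.sum_eq_zero
      intro f _
      obtain ⟨φ, _, hφ⟩ := Finset.mem_image.mp f.2
      rw [← hφ, (mem_rK P x).mp hx φ, mul_zero]
    have hHs : ∀ i, H (s i) = 0 := by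
      intro i
      rw [hH]
      have := congrFun hg i
      simpa using this
    funext x
    have hx : H x = 0 := by
      obtain ⟨c, hc⟩ := hspan (Ideal.Quotient.mk R x)
      have h1 : x - ∑ i, c i • s i ∈ R := by
        rw [← Ideal.Quotient.eq, hc, map_sum]
        refine Finset.sum_congr rfl fun i _ => ?_
        rw [map_nsmul, hs]
      have h2 := hHR _ h1
      rw [map_sub, map_sum, Finset.sum_eq_zero (fun i _ => by rw [map_nsmul, hHs, smul_zero]), sub_zero] at h2
      exact h2
    rw [hH] at hx
    simpa using hx
  have := hli2.fintype_card_le_finrank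
  rw [Module.finrank_fin_fun, Fintype.card_coe] at this
  exact this
end
end

section
open Polynomial NumberField

lemma map_eq_prod {K M : Type} [Field K] [NumberField K] [Field M] [CharZero M] {h : ℤ[X]} (hm : h.Monic) (θ : 𝓞 K) (hd : h.natDegree = Fintype.card (K →+* M))
    (h0 : aeval (θ : K) h = 0) (hinj : Function.Injective fun φ : K →+* M => φ θ) :
    h.map (algebraMap ℤ M) = ∏ φ : K →+* M, (X - C (φ θ)) := by
  have hm2 : (∏ φ : K →+* M, (X - C (φ θ))).Monic := monic_prod_of_monic _ _ fun φ _ => monic_X_sub_C _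
  refine eq_of_monic_of_dvd_of_natDegree_le hm2 (hm.map _) ?_ ?_
  · apply Finset.prod_dvd_of_coprime
    · intro φ _ ψ _ hne
      exact pairwise_coprime_X_sub_C hinj hne
    · intro φ _
      rw [dvd_iff_isRoot, IsRoot, eval_map_algebraMap]
      have := congrArg φ h0
      rw [map_zero] at this
      rw [← this, aeval_def, aeval_def, hom_eval₂]
      congr 1
      exact RingHom.ext_int _ _
  · rw [natDegree_prod_of_monic _ _ fun φ _ => monic_X_sub_C _]
    simp [hm.natDegree_map, hd]

section
variable {K M : Type} [Field K] [NumberField K] [Field M] [NumberField M]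

open Classical in
lemma K_struct [IsGalois ℚ M] (n : ℕ) (hK : Module.finrank ℚ K = n) (hX : Fintype.card (K →+* M) = n)
    (hns : ∀ a b : K →+* M, a ≠ b → ¬ ∃ σ : M ≃+* M, ∀ φ : K →+* M, (σ : M →+* M).comp φ = Equiv.swap a b φ) :
    ∃ (S : Finset ℕ) (k : ℕ → ℕ), (∀ p ∈ S, p.Prime ∧ n < p ∧ 2 ≤ k p ∧ k p ≤ n - 1 ∧
      ∀ (θ : 𝓞 K) (h : ℤ[X]), h.Monic → h.natDegree = n → aeval (θ : K) h = 0 →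
        (Function.Injective fun φ : K →+* M => φ θ) → NR p h (n - k p)) ∧
      (discr K).natAbs ∣ ((Nat.factorial n)^n)^n * ∏ p ∈ S, p ^ (k p) := by
  have hD0 : (discr K).natAbs ≠ 0 := Int.natAbs_ne_zero.mpr (discr_ne_zero K)
  set S := (discr K).natAbs.primeFactors.filter (n < ·) with hSdef
  have hS : ∀ p, p ∈ S ↔ p.Prime ∧ Module.finrank ℚ K < p ∧ p ∣ (discr K).natAbs := by
    intro p; rw [hSdef, Finset.mem_filter, Nat.mem_primeFactors, hK]; tauto
  have hex : ∀ p : ℕ, ∃ P : Ideal (𝓞 M), p.Prime → P.IsMaximal ∧ (p : 𝓞 M) ∈ P := by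
    intro p
    by_cases hp : p.Prime
    · have : Ideal.span {(p : 𝓞 M)} ≠ ⊤ := by
        intro h
        have h2 := Ideal.absNorm_span_natCast (S := 𝓞 M) p
        rw [h, Ideal.absNorm_top, RingOfIntegers.rank] at h2
        have := (Nat.pow_eq_one.mp h2.symm)
        have h3 : 0 < Module.finrank ℚ M := Module.finrank_pos
        have := hp.one_lt
        omega
      obtain ⟨P, hP, hle⟩ := Ideal.exists_le_maximal _ this
      exact ⟨P, fun _ => ⟨hP, hle (Ideal.mem_span_singleton_self _)⟩⟩
    · exact ⟨⊥, fun h => absurd h hp⟩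
  choose P hP using hex
  have hSp : ∀ p ∈ S, p.Prime := fun p hp => ((hS p).mp hp).1
  haveI : Nonempty (K →+* M) := by
    rw [← Fintype.card_pos_iff, hX, ← hK]; exact Module.finrank_pos
  have ho1 : ∀ p, 1 ≤ oP K (P p) := by
    intro p
    exact Finset.card_pos.mpr (Finset.univ_nonempty.image _)
  have hon : ∀ p, oP K (P p) ≤ n := by
    intro p
    rw [← hX]; exact Finset.card_image_le
  have hdvd : (discr K).natAbs * ∏ p ∈ S, p ^ oP K (P p) ∣ (((Nat.factorial n)^n)^n * ∏ p ∈ S, p ^ (n - oP K (P p))) *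
      ∏ p ∈ S, p ^ oP K (P p) := by
    have h1 := disc_bound K S hS (fun p => rK K (P p)) (fun p hp => rK_p _ (hP p (hSp p hp)).2) (fun p hp x hx => by
      haveI := (hP p (hSp p hp)).1
      exact rK_rad _ x hx)
    have h2 : ∏ p ∈ S, p ^ oP K (P p) ∣ ∏ p ∈ S, Ideal.absNorm (rK K (P p)) := by
      apply Finset.prod_dvd_prod_of_dvd
      intro p hp
      haveI := (hP p (hSp p hp)).1
      exact rK_norm (hSp p hp) _ (hP p (hSp p hp)).2
    refine (mul_dvd_mul_left _ h2).trans (h1.trans (dvd_of_eq ?_))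
    rw [hK, mul_pow, mul_assoc, ← Finset.prod_mul_distrib, ← Finset.prod_pow]
    congr 1
    refine Finset.prod_congr rfl fun p _ => ?_
    rw [← pow_add]; congr 1; have := hon p; omega
  have hpos : 0 < ∏ p ∈ S, p ^ oP K (P p) := Finset.prod_pos fun p hp => pow_pos (hSp p hp).pos _
  have hdvd2 := Nat.dvd_of_mul_dvd_mul_right hpos hdvd
  have hcop : ∀ p ∈ S, ∀ t : ℕ, t ∈ S → p ∣ t → p = t := fun p hp t ht h => (Nat.prime_dvd_prime_iff_eq (hSp p hp) (hSp t ht)).mp h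
  refine ⟨S, fun p => n - oP K (P p), fun p hp => ?_, hdvd2⟩
  obtain ⟨hpp, hpn, hpD⟩ := (hS p).mp hp
  rw [hK] at hpn
  haveI := (hP p hpp).1
  have hk1 : n - oP K (P p) ≠ 0 := by
    intro h0
    have h1 := hpD.trans hdvd2
    rcases (Nat.Prime.dvd_mul hpp).mp h1 with h | h
    · have := (hpp.dvd_factorial).mp (hpp.dvd_of_dvd_pow (hpp.dvd_of_dvd_pow h)); omega
    · obtain ⟨t, ht, h⟩ := (hpp.prime.dvd_finset_prod_iff _).mp h
      have := hcop p hp t ht (hpp.dvd_of_dvd_pow h)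
      subst this
      rw [h0, pow_zero] at h
      exact hpp.one_lt.ne' (Nat.dvd_one.mp h)
  have hk2 : n - oP K (P p) ≠ 1 := by
    intro h1
    obtain ⟨a, b, hab, h⟩ := swap_of_oP (K := K) (P p) (by have := hon p; omega)
    exact hns a b hab h
  have := ho1 p
  have := hon p
  refine ⟨hpp, hpn, show 2 ≤ n - oP K (P p) by omega, show n - oP K (P p) ≤ n - 1 by omega, fun θ h hm hd h0 hinj => ?_⟩
  have h5 := NR_oP (K := K) hpp (P p) (hP p hpp).2 θ h (map_eq_prod hm θ (hd.trans hX.symm) h0 hinj)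
  rwa [show n - (n - oP K (P p)) = oP K (P p) by omega]
end
end

section
open Polynomial NumberField

lemma even_of_prim {X : Type} [Fintype X] [DecidableEq X] (G : Subgroup (Equiv.Perm X)) (hG : MulAction.IsPreprimitive G X)
    (hns : ∀ g ∈ G, ¬ g.IsSwap) (hc : Fintype.card X = 3 ∨ Fintype.card X = 4) : ∀ g ∈ G, Equiv.Perm.sign g = 1 := by
  have h3 : ∀ g ∈ G, g ≠ 1 → g.support.card ≤ 3 → g.IsThreeCycle := by
    intro g hg h1 hle
    have h2 := Equiv.Perm.two_le_card_support_of_ne_one h1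
    have h4 : g.support.card ≠ 2 := fun h => hns g hg (Equiv.Perm.card_support_eq_two.mp h)
    exact card_support_eq_three_iff.mp (by omega)
  rcases hc with hc | hc
  · intro g hg
    by_cases h1 : g = 1
    · rw [h1, Equiv.Perm.sign_one]
    · exact (h3 g hg h1 (hc ▸ Finset.card_le_univ _)).sign
  · haveI : Nontrivial X := Fintype.one_lt_card_iff_nontrivial.mp (by omega)
    obtain ⟨a⟩ : Nonempty X := inferInstance
    have hco := (MulAction.isCoatom_stabilizer_iff_preprimitive G a).mpr hG
    have hne : MulAction.stabilizer G a ≠ ⊥ := by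
      intro hbot
      have hcard : Nat.card G = 4 := by
        have h1 := MulAction.index_stabilizer_of_transitive G a
        rw [hbot, Subgroup.index_bot, Nat.card_eq_fintype_card (α := X), hc] at h1
        exact h1
      haveI : Fact (Nat.Prime 2) := ⟨Nat.prime_two⟩
      obtain ⟨x, hx⟩ := exists_prime_orderOf_dvd_card' (G := G) 2 (by rw [hcard]; norm_num)
      have h1 : Subgroup.zpowers x = ⊤ := by
        apply hco.2
        rw [hbot, bot_lt_iff_ne_bot, Ne, Subgroup.zpowers_eq_bot]
        rintro rfl
        simp at hx
      have h2 := Nat.card_zpowers x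
      rw [h1, hx, Subgroup.card_top, hcard] at h2
      omega
    obtain ⟨⟨⟨h, hh⟩, hst⟩, hne1⟩ := Subgroup.ne_bot_iff_exists_ne_one.mp hne
    have hfix : h a = a := hst
    have h3c : h.IsThreeCycle := by
      apply h3 h hh (fun h1 => hne1 (Subtype.ext (Subtype.ext h1)))
      have h5 : h.support ⊆ Finset.univ.erase a := by
        intro x hx
        rw [Finset.mem_erase]
        exact ⟨fun hxa => by rw [Equiv.Perm.mem_support, hxa] at hx; exact hx hfix, Finset.mem_univ _⟩
      have := Finset.card_le_card h5
      rw [Finset.card_erase_of_mem (Finset.mem_univ _), Finset.card_univ, hc] at this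
      exact this
    have hA := Equiv.Perm.alternatingGroup_le_of_isPreprimitive_of_isThreeCycle_mem hG h3c hh
    intro g hg
    by_contra hs
    have hs2 : Equiv.Perm.sign g = -1 := (Int.units_eq_one_or _).resolve_left hs
    obtain ⟨x, y, hxy⟩ := exists_pair_ne X
    refine hns (Equiv.swap x y) ?_ ⟨x, y, hxy, rfl⟩
    have h6 : Equiv.swap x y * g⁻¹ ∈ G := hA (by
      rw [Equiv.Perm.mem_alternatingGroup, Equiv.Perm.sign_mul, Equiv.Perm.sign_inv, hs2, Equiv.Perm.sign_swap hxy]; rfl)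
    have := G.mul_mem h6 hg
    rwa [inv_mul_cancel_right] at this

section
variable {K M : Type} [Field K] [NumberField K] [Field M] [NumberField M]

noncomputable instance actE : MulAction (M ≃ₐ[ℚ] M) (K →+* M) where
  smul σ φ := (σ : M →+* M).comp φ
  one_smul φ := rfl
  mul_smul σ τ φ := rfl

lemma trans_of_gal [IsGalois ℚ M] : MulAction.IsPretransitive (M ≃ₐ[ℚ] M) (K →+* M) := by
  refine ⟨fun φ₁ φ₂ => ?_⟩
  letI : Algebra K M := φ₁.toAlgebra
  let t := (RingHom.toRatAlgHom φ₂).liftNormal M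
  have ht : Function.Bijective t := AlgHom.normal_bijective ℚ M M t
  refine ⟨AlgEquiv.ofBijective t ht, RingHom.ext fun x => ?_⟩
  exact AlgHom.liftNormal_commutes (RingHom.toRatAlgHom φ₂) M x

lemma prim_of_noint [IsGalois ℚ M] (hX : 1 < Fintype.card (K →+* M))
    (hno : ∀ L : IntermediateField ℚ K, L = ⊥ ∨ L = ⊤) :
    MulAction.IsPreprimitive (M ≃ₐ[ℚ] M) (K →+* M) := by
  haveI : Nontrivial (K →+* M) := Fintype.one_lt_card_iff_nontrivial.mp hX
  haveI := trans_of_gal (K := K) (M := M)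
  obtain ⟨φ⟩ : Nonempty (K →+* M) := inferInstance
  rw [← MulAction.isCoatom_stabilizer_iff_preprimitive _ φ]
  let ψ : K →ₐ[ℚ] M := RingHom.toRatAlgHom φ
  have hst : MulAction.stabilizer (M ≃ₐ[ℚ] M) φ = ψ.fieldRange.fixingSubgroup := by
    ext σ
    rw [MulAction.mem_stabilizer_iff, IntermediateField.mem_fixingSubgroup_iff]
    constructor
    · rintro h _ ⟨x, rfl⟩
      exact congrArg (fun f : K →+* M => f x) h
    · intro h
      exact RingHom.ext fun x => h _ ⟨x, rfl⟩
  rw [hst]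
  refine ⟨fun h => ?_, fun H hH => ?_⟩
  · have h1 : MulAction.stabilizer (M ≃ₐ[ℚ] M) φ = ⊤ := hst.trans h
    obtain ⟨φ', hne⟩ := exists_ne φ
    obtain ⟨σ, hσ⟩ := MulAction.exists_smul_eq (M ≃ₐ[ℚ] M) φ φ'
    have : σ ∈ MulAction.stabilizer (M ≃ₐ[ℚ] M) φ := by rw [h1]; trivial
    exact hne (hσ.symm.trans this)
  · have h1 : IntermediateField.fixedField H ≤ ψ.fieldRange := by
      rw [← IsGalois.fixedField_fixingSubgroup ψ.fieldRange]
      exact IntermediateField.fixedField_antitone hH.le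
    rcases hno ((IntermediateField.fixedField H).comap ψ) with h | h
    · rw [← IntermediateField.fixingSubgroup_fixedField H]
      have : IntermediateField.fixedField H = ⊥ := by
        rw [eq_bot_iff]
        intro x hx
        obtain ⟨y, rfl⟩ := h1 hx
        have hy : y ∈ (IntermediateField.fixedField H).comap ψ := hx
        rw [h] at hy
        obtain ⟨q, rfl⟩ := IntermediateField.mem_bot.mp hy
        exact IntermediateField.mem_bot.mpr ⟨q, (ψ.commutes q).symm⟩
      rw [this, IntermediateField.fixingSubgroup_bot]
    · exfalso
      apply hH.not_ge
      rw [← IntermediateField.fixingSubgroup_fixedField H]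
      apply IntermediateField.fixingSubgroup_antitone
      rintro _ ⟨x, rfl⟩
      have : x ∈ (IntermediateField.fixedField H).comap ψ := by rw [h]; trivial
      exact this
end
end

section
open Polynomial NumberField

section
variable {K M : Type} [Field K] [NumberField K] [Field M] [NumberField M]

lemma prim_range (hp : MulAction.IsPreprimitive (M ≃ₐ[ℚ] M) (K →+* M)) :
    MulAction.IsPreprimitive (MulAction.toPermHom (M ≃ₐ[ℚ] M) (K →+* M)).range (K →+* M) := by
  let F : (K →+* M) →ₑ[(MulAction.toPermHom (M ≃ₐ[ℚ] M) (K →+* M)).rangeRestrict] (K →+* M) := ⟨id, fun σ φ => rfl⟩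
  exact MulAction.IsPreprimitive.of_surjective (f := F) Function.surjective_id

open Classical in
lemma det_int [IsGalois ℚ M] (heven : ∀ σ : M ≃ₐ[ℚ] M, Equiv.Perm.sign (MulAction.toPermHom (M ≃ₐ[ℚ] M) (K →+* M) σ) = 1)
    {ι : Type} [Fintype ι] [DecidableEq ι] (w : ι → 𝓞 K) (e : ι ≃ (K →+* M)) :
    ∃ z : ℤ, (Matrix.of fun i j => e i (w j)).det = (z : M) := by
  set A : Matrix ι ι M := Matrix.of fun i j => e i (w j) with hA
  have h1 : ∀ σ : M ≃ₐ[ℚ] M, σ A.det = A.det := by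
    intro σ
    let π : Equiv.Perm ι := (e.trans (MulAction.toPermHom (M ≃ₐ[ℚ] M) (K →+* M) σ)).trans e.symm
    have h2 : (σ : M →+* M).mapMatrix A = A.submatrix π id := by
      ext i j
      simp only [RingHom.mapMatrix_apply, Matrix.map_apply, Matrix.submatrix_apply, hA, Matrix.of_apply, π, Equiv.trans_apply,
        Equiv.apply_symm_apply, id]
      rfl
    have h3 : σ A.det = ((σ : M →+* M).mapMatrix A).det := RingHom.map_det (σ : M →+* M) A
    have h4 : Equiv.Perm.sign π = 1 := by
      have := Equiv.Perm.sign_symm_trans_trans (MulAction.toPermHom (M ≃ₐ[ℚ] M) (K →+* M) σ) e.symm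
      rw [heven] at this
      exact this
    rw [h3, h2, Matrix.det_permute, h4]
    simp
  have h2 := (IsGalois.mem_bot_iff_fixed (F := ℚ) A.det).mpr h1
  obtain ⟨q, hq⟩ := IntermediateField.mem_bot.mp h2
  have h3 : IsIntegral ℤ A.det := by
    apply IsIntegral.det
    intro i j
    exact (RingOfIntegers.isIntegral_coe (w j)).map (e i).toIntAlgHom
  rw [← hq] at h3 ⊢
  have h4 : IsIntegral ℤ q := (isIntegral_algebraMap_iff (algebraMap ℚ M).injective).mp h3
  obtain ⟨z, hz⟩ := IsIntegrallyClosed.isIntegral_iff.mp h4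
  exact ⟨z, by rw [← hz]; simp⟩

open Classical in
lemma disc_sq [IsGalois ℚ M] (hX : Fintype.card (K →+* M) = Module.finrank ℚ K)
    (heven : ∀ σ : M ≃ₐ[ℚ] M, Equiv.Perm.sign (MulAction.toPermHom (M ≃ₐ[ℚ] M) (K →+* M) σ) = 1) :
    ∃ z : ℤ, discr K = z ^ 2 := by
  obtain ⟨j⟩ : Nonempty (M →+* ℂ) := inferInstance
  let J : (K →+* M) → (K →ₐ[ℚ] ℂ) := fun φ => (j.comp φ).toRatAlgHom
  have hJ : Function.Bijective J := by
    rw [Fintype.bijective_iff_injective_and_card]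
    constructor
    · intro a b hab
      ext x
      exact j.injective (congrArg (fun f : K →ₐ[ℚ] ℂ => f x) hab)
    · rw [hX, AlgHom.card]
  have hc : Fintype.card (Module.Free.ChooseBasisIndex ℤ (𝓞 K)) = Fintype.card (K →+* M) := by
    rw [hX, ← RingOfIntegers.rank, Module.finrank_eq_card_chooseBasisIndex]
  let e := Fintype.equivOfCardEq hc
  obtain ⟨z, hz⟩ := det_int heven (RingOfIntegers.basis K) e
  refine ⟨z, ?_⟩
  have h1 := Algebra.discr_eq_det_embeddingsMatrixReindex_pow_two ℚ ℂ (integralBasis K) (e.trans (Equiv.ofBijective J hJ))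
  rw [← coe_discr] at h1
  have h2 : (Algebra.embeddingsMatrixReindex ℚ ℂ (integralBasis K) (e.trans (Equiv.ofBijective J hJ))).det = (z : ℂ) := by
    have h3 := congrArg j hz
    rw [RingHom.map_det, map_intCast] at h3
    rw [← h3, ← Matrix.det_transpose]
    congr 1
    ext i k
    simp only [Matrix.transpose_apply, Algebra.embeddingsMatrixReindex, Algebra.embeddingsMatrix, Matrix.reindex_apply, Matrix.submatrix_apply,
      integralBasis_apply]
    simp [J]
  rw [h2] at h1
  have h3 : ((discr K : ℤ) : ℂ) = ((z ^ 2 : ℤ) : ℂ) := by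
    push_cast
    rw [← h1]; simp
  exact_mod_cast h3

lemma even_gal [DecidableEq (K →+* M)] (hp : MulAction.IsPreprimitive (M ≃ₐ[ℚ] M) (K →+* M))
    (hne : (MulAction.toPermHom (M ≃ₐ[ℚ] M) (K →+* M)).range ≠ ⊤) :
    (∀ σ : M ≃ₐ[ℚ] M, ¬ (MulAction.toPermHom (M ≃ₐ[ℚ] M) (K →+* M) σ).IsSwap) ∧
    (Fintype.card (K →+* M) = 3 ∨ Fintype.card (K →+* M) = 4 →
      ∀ σ : M ≃ₐ[ℚ] M, Equiv.Perm.sign (MulAction.toPermHom (M ≃ₐ[ℚ] M) (K →+* M) σ) = 1) := by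
  have h1 : ∀ g ∈ (MulAction.toPermHom (M ≃ₐ[ℚ] M) (K →+* M)).range, ¬ g.IsSwap := fun g hg hs =>
    hne (Equiv.Perm.subgroup_eq_top_of_isPreprimitive_of_isSwap_mem (prim_range hp) g hs hg)
  exact ⟨fun σ => h1 _ ⟨σ, rfl⟩, fun hc σ => even_of_prim _ (prim_range hp) h1 hc _ ⟨σ, rfl⟩⟩
end

lemma sq_bound (c : ℕ) (hc : c ≠ 0) (S : Finset ℕ) (k : ℕ → ℕ) (hS : ∀ p ∈ S, p.Prime ∧ ¬ p ∣ c ∧ k p ≤ 3) (e : ℕ) 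
    (h : e ^ 2 ∣ c * ∏ p ∈ S, p ^ k p) : e ≤ c * ∏ p ∈ S, p := by
  have hP : 0 < ∏ p ∈ S, p := Finset.prod_pos fun p hp => (hS p hp).1.pos
  set D := c * ∏ p ∈ S, p ^ k p with hD
  have hD0 : D ≠ 0 := mul_ne_zero hc (Finset.prod_ne_zero_iff.mpr fun p hp => pow_ne_zero _ (hS p hp).1.ne_zero)
  have he : e ≠ 0 := by rintro rfl; exact hD0 (by simpa using h)
  have hfp : ∀ q : ℕ, (∏ p ∈ S, p).factorization q = if q ∈ S then 1 else 0 := by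
    intro q
    rw [Nat.factorization_prod (fun p hp => (hS p hp).1.ne_zero), Finset.sum_congr rfl (fun p hp => (hS p hp).1.factorization)]
    simp [Finsupp.finset_sum_apply, Finsupp.single_apply]
  have hfk : ∀ q : ℕ, (∏ p ∈ S, p ^ k p).factorization q = if q ∈ S then k q else 0 := by
    intro q
    rw [Nat.factorization_prod (fun p hp => pow_ne_zero _ (hS p hp).1.ne_zero), Finset.sum_congr rfl (fun p hp => (hS p hp).1.factorization_pow)]
    simp [Finsupp.finset_sum_apply, Finsupp.single_apply]
  apply Nat.le_of_dvd (by positivity)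
  rw [← Nat.factorization_le_iff_dvd he (by positivity)]
  intro q
  have h1 := (Nat.factorization_le_iff_dvd (pow_ne_zero 2 he) hD0).mpr h q
  rw [hD, Nat.factorization_mul hc (by intro h0; rw [hD, h0, mul_zero] at hD0; exact hD0 rfl), Nat.factorization_pow, Finsupp.add_apply, hfk] at h1
  rw [Nat.factorization_mul hc hP.ne', Finsupp.add_apply, hfp]
  simp only [Finsupp.smul_apply, smul_eq_mul] at h1
  by_cases hq : q ∈ S
  · obtain ⟨_, hq1, hq2⟩ := hS q hq
    rw [Nat.factorization_eq_zero_of_not_dvd hq1, if_pos hq] at h1 ⊢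
    omega
  · rw [if_neg hq] at h1 ⊢
    omega
end

section
open Polynomial NumberField

lemma inj_of_top {K M : Type} [Field K] [NumberField K] [Field M] {β : K} (h : IntermediateField.adjoin ℚ {β} = ⊤) :
    Function.Injective fun φ : K →+* M => φ β := by
  intro φ ψ h1
  ext x
  have h2 := IntermediateField.adjoin_le_subfield ℚ (S := {β}) (K := RingHom.eqLocusField φ ψ) (by
    rintro _ ⟨q, rfl⟩
    change φ _ = ψ _
    simp) (by simpa using h1)
  have h3 : x ∈ (IntermediateField.adjoin ℚ {β}) := by rw [h]; trivial
  exact h2 h3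

lemma mink0 (K : Type) [Field K] [NumberField K] (n : ℕ) (hn : 2 ≤ n) (hK : Module.finrank ℚ K = n) (B : ℝ) (hB1 : 1 ≤ B)
    (hB : B ^ (n - 1) = 2 ^ (n + 1) * Real.sqrt |discr K|) :
    ∃ β : 𝓞 K, (∀ φ : K →+* ℂ, ‖φ β‖ ≤ B + 1) ∧ ∀ m : ℤ, β ≠ m := by
  have hB0 : 0 ≤ B := by linarith
  have hD : 1 ≤ Real.sqrt |discr K| := by
    rw [Real.one_le_sqrt]
    exact_mod_cast Int.one_le_abs (discr_ne_zero K)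
  have hmink : ∀ c : NNReal, 1 ≤ c → mixedEmbedding.minkowskiBound K 1 < (c : ENNReal) * ((B.toNNReal ^ (n - 1) : NNReal) : ENNReal) := by
    intro c hc
    have h1 : mixedEmbedding.minkowskiBound K 1 ≤ ((2 ^ n * NNReal.sqrt ‖discr K‖₊ : NNReal) : ENNReal) := by
      rw [mixedEmbedding.minkowskiBound, mixedEmbedding.volume_fundamentalDomain_fractionalIdealLatticeBasis,
        mixedEmbedding.volume_fundamentalDomain_latticeBasis, mixedEmbedding.finrank, hK]
      simp only [Units.val_one, map_one, Rat.cast_one, ENNReal.ofReal_one, one_mul]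
      rw [ENNReal.coe_mul, mul_comm]
      push_cast
      gcongr
      apply mul_le_of_le_one_left (zero_le)
      apply pow_le_one₀ (zero_le)
      simp
    refine h1.trans_lt ?_
    rw [← ENNReal.coe_mul, ENNReal.coe_lt_coe, ← NNReal.coe_lt_coe]
    push_cast
    rw [Real.coe_toNNReal _ hB0, hB]
    have h2 : (‖(discr K : ℤ)‖ : ℝ) = |((discr K : ℤ) : ℝ)| := rfl
    rw [h2]
    have hc' : (1:ℝ) ≤ c := by exact_mod_cast hc
    have h3 : (0:ℝ) < 2 ^ n := by positivity
    rw [pow_succ]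
    nlinarith [mul_pos h3 (lt_of_lt_of_le one_pos hD), mul_nonneg (sub_nonneg.mpr hc') (mul_pos h3 (lt_of_lt_of_le one_pos hD)).le]
  have hpi : 1 ≤ NNReal.pi := by
    rw [← NNReal.coe_le_coe]; simp only [NNReal.coe_one, NNReal.coe_real_pi]; linarith [Real.pi_gt_three]
  have hB1' : 1 ≤ B.toNNReal := by rw [← NNReal.coe_le_coe, Real.coe_toNNReal _ hB0]; simpa using hB1
  classical
  obtain ⟨w0⟩ : Nonempty (InfinitePlace K) := inferInstance
  have hmult : w0.mult + ∑ w ∈ Finset.univ.erase w0, w.mult = n := by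
    rw [Finset.add_sum_erase _ _ (Finset.mem_univ w0), InfinitePlace.sum_mult_eq, hK]
  have hprod : ∀ a : NNReal, ∏ w : InfinitePlace K, (if w = w0 then a else B.toNNReal) ^ w.mult = a ^ w0.mult * B.toNNReal ^ (n - w0.mult) := by
    intro a
    rw [← Finset.mul_prod_erase _ _ (Finset.mem_univ w0), if_pos rfl]
    congr 1
    rw [Finset.prod_congr rfl (fun w hw => by rw [if_neg (Finset.ne_of_mem_erase hw)]), Finset.prod_pow_eq_pow_sum]
    congr 1; omega
  by_cases hw : w0.IsReal
  · have hm : w0.mult = 1 := by simp [InfinitePlace.mult, hw]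
    obtain ⟨β, hβ0, hβ⟩ := mixedEmbedding.exists_ne_zero_mem_ringOfIntegers_lt K
      (f := fun w => if w = w0 then 1 else B.toNNReal) (by
        rw [mixedEmbedding.convexBodyLT_volume, hprod, hm, one_pow, one_mul]
        exact hmink _ (one_le_mul (one_le_pow₀ one_le_two) (one_le_pow₀ hpi)))
    refine ⟨β, (InfinitePlace.le_iff_le _ _).mp fun w => ?_, fun m hm => ?_⟩
    · have := (hβ w).le
      split_ifs at this
      · simp at this; linarith
      · rw [Real.coe_toNNReal _ hB0] at this; linarith
    · have := hβ w0
      rw [if_pos rfl, hm, ← InfinitePlace.norm_embedding_eq] at this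
      simp only [map_intCast, Complex.norm_intCast, NNReal.coe_one] at this
      have h1 : |m| < 1 := by exact_mod_cast this
      rw [Int.abs_lt_one_iff] at h1
      exact hβ0 (by rw [hm, h1]; simp)
  · have hw' : w0.IsComplex := InfinitePlace.not_isReal_iff_isComplex.mp hw
    have hm : w0.mult = 2 := by simp [InfinitePlace.mult, hw]
    obtain ⟨β, hβ0, hβ, hre, him⟩ := mixedEmbedding.exists_ne_zero_mem_ringOfIntegers_lt' K
      (f := fun w => if w = w0 then NNReal.sqrt B.toNNReal else B.toNNReal) ⟨w0, hw'⟩ (by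
        rw [mixedEmbedding.convexBodyLT'_volume, hprod, hm, NNReal.sq_sqrt, ← pow_succ', show n - 2 + 1 = n - 1 by omega]
        exact hmink _ (one_le_mul (one_le_pow₀ one_le_two) (one_le_pow₀ hpi)))
    simp only [if_true] at him hre
    rw [Real.coe_sqrt, Real.sq_sqrt (NNReal.coe_nonneg _), Real.coe_toNNReal _ hB0] at him
    refine ⟨β, (InfinitePlace.le_iff_le _ _).mp fun w => ?_, fun m hm => ?_⟩
    · by_cases hww : w = w0
      · rw [hww, ← InfinitePlace.norm_embedding_eq]
        have := Complex.norm_le_abs_re_add_abs_im (w0.embedding β)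
        linarith
      · have := (hβ w hww).le
        rw [if_neg hww, Real.coe_toNNReal _ hB0] at this; linarith
    · rw [hm] at hre
      simp only [map_intCast, Complex.intCast_re] at hre
      have h1 : |m| < 1 := by exact_mod_cast hre
      rw [Int.abs_lt_one_iff] at h1
      exact hβ0 (by rw [hm, h1]; simp)

lemma mink (n : ℕ) (hn : 2 ≤ n) : ∃ c : ℝ, 1 ≤ c ∧ ∀ (K : Type) [Field K] [NumberField K], Module.finrank ℚ K = n →
    (∀ L : IntermediateField ℚ K, L = ⊥ ∨ L = ⊤) → ∃ (β : 𝓞 K) (Y : ℝ) (g : ℤ[X]), 1 ≤ Y ∧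
      IntermediateField.adjoin ℚ {(β : K)} = ⊤ ∧ Y ^ (2 * (n - 1)) ≤ c * ((discr K).natAbs : ℝ) ∧ g.Monic ∧ g.natDegree = n ∧
      aeval (β : K) g = 0 ∧ |g.coeff (n - 1)| ≤ n ∧ ∀ i, (|g.coeff i| : ℝ) ≤ 2 ^ n * Y ^ (n - i) := by
  refine ⟨5 ^ (2 * (n - 1)) * (2 ^ (n + 1)) ^ 2, ?_, fun K _ _ hK hno => ?_⟩
  · exact one_le_mul_of_one_le_of_one_le (one_le_pow₀ (by norm_num)) (one_le_pow₀ (one_le_pow₀ (by norm_num)))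
  have hD : 1 ≤ Real.sqrt |discr K| := by
    rw [Real.one_le_sqrt]
    exact_mod_cast Int.one_le_abs (discr_ne_zero K)
  set E : ℝ := 2 ^ (n + 1) * Real.sqrt |discr K| with hE
  have hE1 : 1 ≤ E := one_le_mul_of_one_le_of_one_le (one_le_pow₀ (by norm_num)) hD
  set B : ℝ := E ^ (((n - 1 : ℕ) : ℝ)⁻¹) with hBdef
  have hB1 : 1 ≤ B := Real.one_le_rpow hE1 (by positivity)
  have hB : B ^ (n - 1) = E := Real.rpow_inv_natCast_pow (by linarith) (by omega)
  obtain ⟨β, hβ, hβm⟩ := mink0 K n hn hK B hB1 hB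
  set t : ℤ := Algebra.trace ℤ (𝓞 K) β with ht
  have hn0 : (0:ℤ) < n := by omega
  have hsum : ∀ x : 𝓞 K, ((Algebra.trace ℤ (𝓞 K) x : ℤ) : ℂ) = ∑ φ : K →+* ℂ, φ x := by
    intro x
    have h1 := trace_eq_sum_embeddings (K := ℚ) (L := K) ℂ (x := (x : K))
    rw [← Algebra.coe_trace_int] at h1
    rw [← Equiv.sum_comp (RingHom.equivRatAlgHom (R := K) (S := ℂ)).symm] 
    simpa using h1
  have htB : (|t| : ℝ) ≤ n * (B + 1) := by
    have h1 : ((|t| : ℝ)) = ‖(t : ℂ)‖ := (Complex.norm_intCast t).symm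
    rw [h1, ht, hsum]
    refine (norm_sum_le _ _).trans ((Finset.sum_le_sum fun φ _ => hβ φ).trans ?_)
    rw [Finset.sum_const, Finset.card_univ, Embeddings.card, hK, nsmul_eq_mul]
  set m := t / n with hm
  have hm1 : 0 ≤ t - n * m ∧ t - n * m < n := by
    have h1 := Int.emod_nonneg t hn0.ne'
    have h2 := Int.emod_lt_of_pos t hn0
    have h3 := Int.mul_ediv_add_emod t n
    constructor <;> (rw [hm]; linarith)
  have hmB : (|m| : ℝ) ≤ B + 2 := by
    have h1 : (n * |m| : ℤ) ≤ |t| + n := by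
      have : (n:ℤ) * |m| = |t - (t - n * m)| := by rw [sub_sub_cancel, abs_mul, abs_of_pos hn0]
      rw [this]
      refine (abs_sub _ _).trans ?_
      rw [abs_of_nonneg hm1.1]; linarith
    have h2 : (n * |(m : ℝ)| : ℝ) ≤ |(t : ℝ)| + n := by exact_mod_cast h1
    have h3 : (0:ℝ) < n := by exact_mod_cast hn0
    nlinarith
  set γ : 𝓞 K := β - m with hγ
  have hγB : ∀ φ : K →+* ℂ, ‖φ γ‖ ≤ 5 * B := by
    intro φ
    have h1 : φ γ = φ β - m := by rw [hγ]; simp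
    rw [h1]
    refine (norm_sub_le _ _).trans ?_
    rw [Complex.norm_intCast]
    have := hβ φ
    linarith
  have htop : IntermediateField.adjoin ℚ {(γ : K)} = ⊤ := by
    refine (hno _).resolve_left fun h => ?_
    rw [IntermediateField.adjoin_simple_eq_bot_iff] at h
    obtain ⟨q, hq⟩ := IntermediateField.mem_bot.mp h
    have h4 : IsIntegral ℤ q := by
      have : IsIntegral ℤ (γ : K) := RingOfIntegers.isIntegral_coe γ
      rw [← hq] at this
      exact (isIntegral_algebraMap_iff (algebraMap ℚ K).injective).mp this
    obtain ⟨z, hz⟩ := IsIntegrallyClosed.isIntegral_iff.mp h4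
    apply hβm (z + m)
    have : γ = (z : 𝓞 K) := by
      apply RingOfIntegers.ext
      rw [← hq, ← hz]; simp
    rw [hγ] at this
    rw [Int.cast_add, ← this]; ring
  have hint : IsIntegral ℤ (γ : K) := RingOfIntegers.isIntegral_coe γ
  have hdeg : (minpoly ℤ (γ : K)).natDegree = n := by
    have h1 := (Field.primitive_element_iff_minpoly_natDegree_eq ℚ (γ : K)).mp htop
    rw [minpoly.isIntegrallyClosed_eq_field_fractions' ℚ hint, (minpoly.monic hint).natDegree_map, hK] at h1
    exact h1
  have hmon := minpoly.monic hint
  have hprod := map_eq_prod (M := ℂ) hmon γ (by rw [hdeg, Embeddings.card, hK]) (minpoly.aeval _ _) (inj_of_top htop)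
  refine ⟨γ, 5 * B, minpoly ℤ (γ : K), by linarith, htop, ?_, hmon, hdeg, minpoly.aeval _ _, ?_, fun i => ?_⟩
  · rw [mul_pow, mul_assoc]
    refine mul_le_mul_of_nonneg_left ?_ (by positivity)
    rw [mul_comm 2, pow_mul, hB, hE, mul_pow, Real.sq_sqrt (by positivity), Nat.cast_natAbs, Int.cast_abs]
  · have h1 := prod_X_sub_C_nextCoeff (s := Finset.univ) (fun φ : K →+* ℂ => φ γ)
    rw [← hprod, ← hsum, nextCoeff_map (algebraMap ℤ ℂ).injective_int, nextCoeff_of_natDegree_pos (by omega), hdeg] at h1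
    have h2 : (minpoly ℤ (γ : K)).coeff (n - 1) = - Algebra.trace ℤ (𝓞 K) γ := by
      have : ((algebraMap ℤ ℂ) ((minpoly ℤ (γ : K)).coeff (n - 1))) = ((- Algebra.trace ℤ (𝓞 K) γ : ℤ) : ℂ) := by
        rw [h1]; push_cast; rfl
      exact Int.cast_injective (α := ℂ) this
    have h3 : Algebra.trace ℤ (𝓞 K) γ = t - n * m := by
      have : (m : 𝓞 K) = algebraMap ℤ (𝓞 K) m := by simp
      rw [hγ, map_sub, this, Algebra.trace_algebraMap, RingOfIntegers.rank, hK]; simp [ht]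
    rw [h2, h3, abs_neg, abs_of_nonneg hm1.1]
    exact hm1.2.le
  · have h1 := coeff_le_of_roots_le (f := algebraMap ℤ ℂ) (B := 5 * B) i hmon (IsAlgClosed.splits _) (by
      intro z hz
      rw [hprod] at hz
      have hz2 := (mem_roots'.mp hz).2
      rw [IsRoot, eval_prod, Finset.prod_eq_zero_iff] at hz2
      obtain ⟨φ, _, h⟩ := hz2
      have : z = φ γ := by simpa [sub_eq_zero] using h
      rw [this]; exact hγB φ)
    rw [coeff_map, hdeg] at h1
    have h2 : ‖(algebraMap ℤ ℂ) ((minpoly ℤ (γ : K)).coeff i)‖ = |((minpoly ℤ (γ : K)).coeff i : ℝ)| := Complex.norm_intCast _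
    rw [h2] at h1
    refine h1.trans ?_
    rw [mul_comm]
    gcongr
    exact_mod_cast Nat.choose_le_two_pow n i
end

section
open Polynomial NumberField

def dc (a b c : ℤ) : ℤ := a ^ 2 * b ^ 2 - 4 * b ^ 3 - 4 * a ^ 3 * c - 27 * c ^ 2 + 18 * a * b * c

def PS (n : ℕ) (c : ℝ) (f g : ℤ[X]) (S : Finset ℕ) (k : ℕ → ℕ) (Y : ℝ) : Prop :=
  1 ≤ Y ∧ g.Monic ∧ g.natDegree = n ∧ |g.coeff (n - 1)| ≤ n ∧ (∀ i, (|g.coeff i| : ℝ) ≤ 2 ^ n * Y ^ (n - i)) ∧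
  (∀ p ∈ S, p.Prime ∧ n < p ∧ 2 ≤ k p ∧ k p ≤ n - 1 ∧ NR p f (n - k p) ∧ NR p g (n - k p)) ∧
  Y ^ (2 * (n - 1)) ≤ c * ((∏ p ∈ S, p ^ k p : ℕ) : ℝ) ∧
  (n = 3 ∨ n = 4 → Y ^ (2 * (n - 1)) ≤ c * ((∏ p ∈ S, p : ℕ) : ℝ) ^ 2) ∧
  (n = 3 → ∃ z : ℤ, z ^ 2 = dc (g.coeff 2) (g.coeff 1) (g.coeff 0))

lemma KM_struct (n : ℕ) (hn : 3 ≤ n) : ∃ c : ℝ, 1 ≤ c ∧ ∀ (K M : Type) [Field K] [NumberField K] [Field M] [NumberField M]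
    [IsGalois ℚ M], Module.finrank ℚ K = n → Fintype.card (K →+* M) = n → (∀ L : IntermediateField ℚ K, L = ⊥ ∨ L = ⊤) →
    (MulAction.toPermHom (M ≃ₐ[ℚ] M) (K →+* M)).range ≠ ⊤ →
    ∀ (f : ℤ[X]) (θ : 𝓞 K), f.Monic → f.natDegree = n → aeval (θ : K) f = 0 → IntermediateField.adjoin ℚ {(θ : K)} = ⊤ →
    ∃ (g : ℤ[X]) (β : 𝓞 K) (S : Finset ℕ) (k : ℕ → ℕ) (Y : ℝ), aeval (β : K) g = 0 ∧ IntermediateField.adjoin ℚ {(β : K)} = ⊤ ∧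
      PS n c f g S k Y := by
  classical
  obtain ⟨c, hc1, hmink⟩ := mink n (by omega)
  set F : ℕ := ((Nat.factorial n)^n)^n with hF
  have hF0 : F ≠ 0 := pow_ne_zero _ (pow_ne_zero _ (Nat.factorial_ne_zero _))
  have hF1 : (1:ℝ) ≤ F := by exact_mod_cast Nat.one_le_iff_ne_zero.mpr hF0
  refine ⟨c * F ^ 2, by nlinarith, fun K M _ _ _ _ _ hK hX hno hne f θ hf hfd hf0 hftop => ?_⟩
  obtain ⟨β, Y, g, hY, htop, hYD, hg, hgd, hg0, hg1, hgi⟩ := hmink K hK hno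
  have hprim := prim_of_noint (K := K) (M := M) (by omega) hno
  obtain ⟨hns, heven⟩ := even_gal hprim hne
  obtain ⟨S, k, hS, hD⟩ := K_struct (K := K) (M := M) n hK hX (by
    rintro a b hab ⟨σ, hσ⟩
    refine hns (AlgEquiv.ofRingEquiv (f := σ) (fun r => by simp)) ⟨a, b, hab, ?_⟩
    apply Equiv.ext
    intro φ
    exact hσ φ)
  have hDpos : (0:ℝ) < ((discr K).natAbs : ℝ) := by exact_mod_cast Int.natAbs_pos.mpr (discr_ne_zero K)
  refine ⟨g, β, S, k, Y, hg0, htop, hY, hg, hgd, hg1, hgi, fun p hp => ?_, ?_, fun h34 => ?_, ?_⟩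
  · obtain ⟨h1, h2, h3, h4, h5⟩ := hS p hp
    exact ⟨h1, h2, h3, h4, h5 θ f hf hfd hf0 (inj_of_top hftop), h5 β g hg hgd hg0 (inj_of_top htop)⟩
  · have hpos : 0 < ∏ p ∈ S, p ^ k p := Finset.prod_pos fun p hp => pow_pos (hS p hp).1.pos _
    have h1 := Nat.le_of_dvd (by positivity) hD
    have h2 : ((discr K).natAbs : ℝ) ≤ F * ((∏ p ∈ S, p ^ k p : ℕ) : ℝ) := by exact_mod_cast h1
    refine hYD.trans ?_
    have h3 : (F : ℝ) * ((∏ p ∈ S, p ^ k p : ℕ) : ℝ) ≤ F ^ 2 * ((∏ p ∈ S, p ^ k p : ℕ) : ℝ) := by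
      gcongr; nlinarith
    rw [mul_assoc]
    gcongr
    exact h2.trans h3
  · obtain ⟨e, he⟩ := disc_sq (K := K) (M := M) (hX.trans hK.symm) (heven (by rwa [hX]))
    have he2 : (discr K).natAbs = e.natAbs ^ 2 := by rw [he, Int.natAbs_pow]
    rw [he2] at hD
    have h1 := sq_bound F hF0 S k (fun p hp => ⟨(hS p hp).1, fun hd => by
      have := ((hS p hp).1.dvd_factorial).mp ((hS p hp).1.dvd_of_dvd_pow ((hS p hp).1.dvd_of_dvd_pow hd))
      have := (hS p hp).2.1
      omega, by have := (hS p hp).2.2.2.1; omega⟩) e.natAbs hD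
    refine hYD.trans ?_
    have h1c : (e.natAbs : ℝ) ≤ F * ((∏ p ∈ S, p : ℕ) : ℝ) := by exact_mod_cast h1
    rw [he2, mul_assoc, ← mul_pow, Nat.cast_pow]
    gcongr
  · rintro rfl
    have e := (Fintype.equivFinOfCardEq hX).symm
    obtain ⟨z, hz⟩ := det_int (heven (Or.inl hX)) (fun j : Fin 3 => β ^ (j : ℕ)) e
    refine ⟨z, ?_⟩
    have hp := map_eq_prod (M := M) hg β (hgd.trans hX.symm) hg0 (inj_of_top htop)
    rw [← Equiv.prod_comp e, Fin.prod_univ_three] at hp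
    rw [Matrix.det_fin_three] at hz
    simp only [Matrix.of_apply, map_pow] at hz
    set x := e 0 β
    set y := e 1 β
    set w := e 2 β
    obtain ⟨s1, hs1⟩ : ∃ s, s = x + y + w := ⟨_, rfl⟩
    obtain ⟨s2, hs2⟩ : ∃ s, s = x * y + x * w + y * w := ⟨_, rfl⟩
    obtain ⟨s3, hs3⟩ : ∃ s, s = x * y * w := ⟨_, rfl⟩
    have hexp : (X - C x) * (X - C y) * (X - C w) = X ^ 3 - C s1 * X ^ 2 + C s2 * X - C s3 := by
      simp only [hs1, hs2, hs3, C_add, C_mul]; ring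
    rw [hexp] at hp
    have h2 := congrArg (fun P => coeff P 2) hp
    have h1 := congrArg (fun P => coeff P 1) hp
    have h0 := congrArg (fun P => coeff P 0) hp
    simp [coeff_X, coeff_X_pow, coeff_C, coeff_C_mul] at h0 h1 h2
    subst hs1 hs2 hs3
    have : ((z ^ 2 : ℤ) : M) = ((dc (g.coeff 2) (g.coeff 1) (g.coeff 0) : ℤ) : M) := by
      simp only [dc]
      push_cast
      rw [h0, h1, h2, ← hz]
      simp only [Fin.val_zero, Fin.val_one, Fin.val_two, pow_zero, pow_one]
      ring
    exact_mod_cast this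
end

section
open Polynomial NumberField IntermediateField
attribute [local instance] Polynomial.Gal.splits_ℚ_ℂ

def FullS (n : ℕ) (f : ℤ[X]) : Prop :=
  Fintype.card ((f.map (Int.castRingHom ℚ)).rootSet ℂ) = n ∧
    Function.Surjective (Gal.galActionHom (f.map (Int.castRingHom ℚ)) ℂ)

lemma card_rs {n : ℕ} {f : ℤ[X]} (hf : f.Monic) (hd : f.natDegree = n) (hirr : Irreducible f) :
    Fintype.card ((f.map (Int.castRingHom ℚ)).rootSet ℂ) = n := by
  have hq : Irreducible (f.map (Int.castRingHom ℚ)) := by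
    rw [← algebraMap_int_eq]
    exact (hf.irreducible_iff_irreducible_map_fraction_map).1 hirr
  rw [card_rootSet_eq_natDegree hq.separable (IsAlgClosed.splits _), hf.natDegree_map, hd]

lemma fullS_two {f : ℤ[X]} (hf : f.Monic) (hd : f.natDegree = 2) (hirr : Irreducible f) : FullS 2 f := by
  classical
  have hc := card_rs hf hd hirr
  have hq : Irreducible (f.map (Int.castRingHom ℚ)) := by
    rw [← algebraMap_int_eq]
    exact (hf.irreducible_iff_irreducible_map_fraction_map).1 hirr
  refine ⟨hc, fun σ => ?_⟩
  have ht := Gal.galAction_isPretransitive (f.map (Int.castRingHom ℚ)) ℂ hq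
  have e : Fin 2 ≃ (f.map (Int.castRingHom ℚ)).rootSet ℂ := (Fintype.equivFinOfCardEq hc).symm
  obtain ⟨g, hg⟩ := ht.exists_smul_eq (e 0) (σ (e 0))
  refine ⟨g, ?_⟩
  have hg' : (Gal.galActionHom (f.map (Int.castRingHom ℚ)) ℂ g) (e 0) = σ (e 0) := hg
  generalize Gal.galActionHom (f.map (Int.castRingHom ℚ)) ℂ g = τ at hg'
  have h : ∀ a b : Equiv.Perm (Fin 2), a 0 = b 0 → a = b := by decide
  have := h (e.permCongr.symm τ) (e.permCongr.symm σ) (by simp [Equiv.permCongr_symm, Equiv.permCongr_apply, hg'])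
  exact e.permCongr.symm.injective this

lemma rootEqv {M : Type} [Field M] [CharZero M] [Algebra ℚ M] {α : ℂ} (hint : IsIntegral ℚ α) :
    ∃ e : (ℚ⟮α⟯ →+* M) ≃ (minpoly ℚ α).rootSet M, ∀ φ, (e φ : M) = φ (AdjoinSimple.gen ℚ α) := by
  classical
  let e1 := (RingHom.equivRatAlgHom (R := ℚ⟮α⟯) (S := M)).trans (algHomAdjoinIntegralEquiv ℚ hint)
  let e2 : { x // x ∈ (minpoly ℚ α).aroots M } ≃ (minpoly ℚ α).rootSet M :=
    (Equiv.refl M).subtypeEquiv fun x => by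
      rw [mem_aroots, mem_rootSet]; rfl
  refine ⟨e1.trans e2, fun φ => ?_⟩
  have h : ∀ x : { x // x ∈ (minpoly ℚ α).aroots M }, (e2 x : M) = x := fun x => rfl
  rw [Equiv.trans_apply, h, ← algHomAdjoinIntegralEquiv_symm_apply_gen ℚ hint]
  exact DFunLike.congr_fun ((algHomAdjoinIntegralEquiv ℚ hint).symm_apply_apply (RingHom.equivRatAlgHom ℚ⟮α⟯ M φ)) (AdjoinSimple.gen ℚ α)

lemma nfgal {M : Type} [Field M] [CharZero M] [A : Algebra ℚ M] (q : ℚ[X]) [IsSplittingField ℚ M q] (hs : q.Separable) :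
    NumberField M ∧ @IsGalois ℚ _ M _ DivisionRing.toRatAlgebra := by
  have : A = DivisionRing.toRatAlgebra := Subsingleton.elim _ _
  subst this
  have := IsSplittingField.finiteDimensional M q
  exact ⟨⟨⟩, IsGalois.of_separable_splitting_field hs⟩

lemma link {n : ℕ} {f : ℤ[X]} (hf : f.Monic) (hd : f.natDegree = n) (hirr : Irreducible f) (hbad : ¬ FullS n f)
    {α : ℂ} (hα : aeval α f = 0) [NumberField ℚ⟮α⟯] :
    ∃ (M : Type) (_ : Field M) (_ : NumberField M) (_ : IsGalois ℚ M), Fintype.card (ℚ⟮α⟯ →+* M) = n ∧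
      (MulAction.toPermHom (M ≃ₐ[ℚ] M) (ℚ⟮α⟯ →+* M)).range ≠ ⊤ := by
  classical
  have hc := card_rs hf hd hirr
  have hmp := irr_minpoly hf hirr hα
  have hint : IsIntegral ℚ α := (isIntegral_of_root hf hα).tower_top
  have hns : ¬ Function.Surjective (Gal.galActionHom (f.map (Int.castRingHom ℚ)) ℂ) := fun h => hbad ⟨hc, h⟩
  rw [← hmp] at hc hns
  have hq : Irreducible (minpoly ℚ α) := minpoly.irreducible hint
  let M := (minpoly ℚ α).SplittingField
  obtain ⟨hnf, hgal⟩ := @nfgal M _ _ _ (minpoly ℚ α) (IsSplittingField.splittingField (minpoly ℚ α)) hq.separable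
  obtain ⟨e0, he0⟩ := @rootEqv M _ _ _ α hint
  let e := e0.trans (Gal.rootsEquivRoots (minpoly ℚ α) ℂ)
  refine ⟨M, inferInstance, hnf, hgal, (Fintype.card_congr e).trans hc, fun htop => hns fun τ => ?_⟩
  obtain ⟨σ, hσ⟩ : e.permCongr.symm τ ∈ (MulAction.toPermHom (M ≃ₐ[ℚ] M) (ℚ⟮α⟯ →+* M)).range := htop ▸ trivial
  let σ' : (minpoly ℚ α).Gal := AlgEquiv.ofRingEquiv (f := (σ : M ≃+* M)) (fun r => by simp)
  refine ⟨σ', ?_⟩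
  apply Equiv.ext
  intro x
  obtain ⟨φ, rfl⟩ := e.surjective x
  have h1 : σ • φ = e.symm (τ (e φ)) := by
    have := congrArg (fun s => s φ) hσ
    exact this
  have h2 : τ (e φ) = e (σ • φ) := by rw [h1, Equiv.apply_symm_apply]
  rw [h2]
  change σ' • e φ = _
  rw [Gal.smul_def]
  have h3 : (Gal.rootsEquivRoots (minpoly ℚ α) ℂ).symm (e φ) = e0 φ := by
    simp only [e, Equiv.trans_apply]
    exact Equiv.symm_apply_apply _ _
  rw [h3]
  refine congrArg (Gal.rootsEquivRoots (minpoly ℚ α) ℂ) (Subtype.ext ?_)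
  change σ (e0 φ) = (e0 (σ • φ) : M)
  rw [he0, he0]
  rfl

lemma alg_tr {K : Type} [Field K] (A B : Algebra ℚ K) (h : ∀ L : @IntermediateField ℚ K _ _ A, L = ⊥ ∨ L = ⊤) :
    ∀ L : @IntermediateField ℚ K _ _ B, L = ⊥ ∨ L = ⊤ := by
  have : A = B := Subsingleton.elim _ _
  subst this
  exact h

lemma noint {f : ℤ[X]} (hirr : Irreducible f) (him : ¬ IsImprim f) {α : ℂ} (hα : aeval α f = 0)
    (L : @IntermediateField ℚ ℚ⟮α⟯ _ _ ℚ⟮α⟯.algebra') : L = ⊥ ∨ L = ⊤ := by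
  by_contra! h
  refine him ⟨hirr, α, hα, lift L, lift_le L, fun h' => h.1 ?_, fun h' => h.2 ?_⟩
  · apply lift_injective
    rw [h', lift_bot]
  · apply lift_injective
    rw [h', lift_top]

lemma alg_tr2 {K : Type} [Field K] (A B : Algebra ℚ K) (x : K) (h : @IntermediateField.adjoin ℚ _ K _ A {x} = ⊤) :
    @IntermediateField.adjoin ℚ _ K _ B {x} = ⊤ := by
  have : A = B := Subsingleton.elim _ _
  subst this
  exact h

lemma top_gen (α : ℂ) : @IntermediateField.adjoin ℚ _ ℚ⟮α⟯ _ DivisionRing.toRatAlgebra {AdjoinSimple.gen ℚ α} = ⊤ := by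
  apply alg_tr2 ℚ⟮α⟯.algebra'
  apply lift_injective
  rw [lift_top, lift_adjoin_simple, AdjoinSimple.coe_gen]

lemma gen_top {α : ℂ} (β : ℚ⟮α⟯) (h : @IntermediateField.adjoin ℚ _ ℚ⟮α⟯ _ DivisionRing.toRatAlgebra {β} = ⊤) :
    ℚ⟮α⟯ = ℚ⟮(β : ℂ)⟯ := by
  have h := alg_tr2 _ ℚ⟮α⟯.algebra' β h
  rw [← lift_adjoin_simple, h, lift_top]

lemma prim_struct (n : ℕ) (hn : 3 ≤ n) : ∃ c : ℝ, 1 ≤ c ∧ ∀ f : ℤ[X], f.Monic → f.natDegree = n → Irreducible f →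
    ¬ IsImprim f → ¬ FullS n f → ∃ (α β : ℂ) (g : ℤ[X]) (S : Finset ℕ) (k : ℕ → ℕ) (Y : ℝ),
      aeval α f = 0 ∧ aeval β g = 0 ∧ ℚ⟮α⟯ = ℚ⟮β⟯ ∧ PS n c f g S k Y := by
  obtain ⟨c, hc, H⟩ := KM_struct n hn
  refine ⟨c, hc, fun f hf hd hirr him hbad => ?_⟩
  obtain ⟨α, hα⟩ : ∃ α : ℂ, aeval α f = 0 := by
    apply IsAlgClosed.exists_aeval_eq_zero_of_injective ℂ (by simpa using Int.cast_injective)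
    rw [degree_eq_natDegree hf.ne_zero, hd]
    exact_mod_cast (by omega)
  have hi := isIntegral_of_root hf hα
  have := nf_adjoin hi
  obtain ⟨M, i1, i2, i3, hX, hne⟩ := link hf hd hirr hbad hα
  have hg0 : aeval (AdjoinSimple.gen ℚ α) f = 0 := by
    apply (algebraMap ℚ⟮α⟯ ℂ).injective
    rw [← aeval_algebraMap_apply, AdjoinSimple.algebraMap_gen, hα, map_zero]
  have hgi : IsIntegral ℤ (AdjoinSimple.gen ℚ α) := ⟨f, hf, by rw [← aeval_def]; exact hg0⟩
  have hfr : Module.finrank ℚ ℚ⟮α⟯ = n := by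
    rw [adjoin.finrank hi.tower_top, irr_minpoly hf hirr hα, hf.natDegree_map, hd]
  obtain ⟨g, β, S, k, Y, hg0, htop, hPS⟩ := H ℚ⟮α⟯ M hfr hX (alg_tr _ _ (noint hirr him hα)) hne f ⟨_, hgi⟩ hf hd
    hg0 (top_gen α)
  refine ⟨α, ((β : ℚ⟮α⟯) : ℂ), g, S, k, Y, hα, ?_, ?_, hPS⟩
  · have := congrArg (algebraMap ℚ⟮α⟯ ℂ) hg0
    rwa [← aeval_algebraMap_apply, map_zero] at this
  · exact gen_top (β : ℚ⟮α⟯) htop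
end

section
open Polynomial NumberField IntermediateField

def GC (n : ℕ) : Prop := ∀ c : ℝ, 1 ≤ c → ∃ C : ℝ, 0 ≤ C ∧ ∃ e : ℕ, ∀ N : ℕ, 2 ≤ N → ∀ G : Finset ℤ[X],
  (∀ g ∈ G, ∃ f S k Y, PS n c f g S k Y ∧ ∏ p ∈ S, p ≤ N ∧ ∏ p ∈ S, p ^ k p ≤ N ^ 2) →
  (G.card : ℝ) ≤ C * N ^ (n - 2) * LL N ^ e

lemma count_fib (n : ℕ) (hn : 3 ≤ n) (hG : GC n) (c : ℝ) (hc : 1 ≤ c) :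
    PL n (fun N f => Irreducible f ∧ ∃ (α β : ℂ) (g : ℤ[X]) (S : Finset ℕ) (k : ℕ → ℕ) (Y : ℝ),
      aeval α f = 0 ∧ aeval β g = 0 ∧ ℚ⟮α⟯ = ℚ⟮β⟯ ∧ PS n c f g S k Y ∧ ∏ p ∈ S, p ≤ N ∧ ∏ p ∈ S, p ^ k p ≤ N ^ 2) := by
  classical
  obtain ⟨C, hC, e, H⟩ := hG c hc
  have hL1 := LL_ge_one (n + 1)
  refine ⟨C * (n * (24 ^ n * (n + 1) * (3 * LL (n + 1)) ^ n)), by positivity, e + n, fun N hN T hT => ?_⟩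
  have hLN := LL_ge_one N
  have hst := fun f (hf : f ∈ T) => (hT f hf).2.2
  choose! α β g S k Y h1 h2 h3 h4 h5 h6 using hst
  have hmain := card_le_keys T (T.image g) g (n * (24 ^ n * ((n + 1) * N) * (3 * (LL (n + 1) * LL N)) ^ n))
    (fun f hf => Finset.mem_image_of_mem _ hf) ?_
  · have hGc := H N hN (T.image g) (by
      intro g' hg'
      obtain ⟨f, hf, rfl⟩ := Finset.mem_image.1 hg'
      exact ⟨f, S f, k f, Y f, h4 f hf, h5 f hf, h6 f hf⟩)
    refine hmain.trans ((mul_le_mul_of_nonneg_right hGc (by positivity)).trans (le_of_eq ?_))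
    rw [show n - 1 = (n - 2) + 1 by omega, pow_succ (N:ℝ), pow_add (LL N)]
    rw [mul_pow, mul_pow, mul_pow]
    ring
  intro b hb V hV hVb
  obtain ⟨f0, hf0, rfl⟩ := Finset.mem_image.1 hb
  have hgm := (h4 f0 hf0).2.1
  have hgd := (h4 f0 hf0).2.2.1
  have hbeta : ∀ f ∈ V, β f ∈ ((g f0).aroots ℂ).toFinset := by
    intro f hf
    rw [Multiset.mem_toFinset, mem_aroots]
    exact ⟨hgm.ne_zero, by rw [← hVb f hf]; exact h2 f (hV hf)⟩
  have hcard : (((g f0).aroots ℂ).toFinset.card : ℝ) ≤ n := by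
    have : ((g f0).aroots ℂ).toFinset.card ≤ n :=
      (Multiset.toFinset_card_le _).trans ((card_roots' _).trans ((natDegree_map_le).trans hgd.le))
    exact_mod_cast this
  refine (card_le_keys V _ β (24 ^ n * ((n + 1) * N) * (3 * (LL (n + 1) * LL N)) ^ n) hbeta ?_).trans
    (mul_le_mul_of_nonneg_right hcard (by positivity))
  intro b _ W hW hWb
  have := field_count n ((n + 1) * N) (Nat.mul_pos (by omega) (by omega)) ℚ⟮b⟯ W (by
    intro f hf
    have hfT := hV (hW hf)
    refine ⟨(hT f hfT).1.1, (hT f hfT).1.2.1, (hT f hfT).2.1, ?_, α f, h1 f hfT, ?_⟩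
    · have := mM_box (by omega) (hT f hfT).1
      push_cast
      exact this
    · rw [h3 f hfT, hWb f hf])
  refine this.trans ?_
  have hl := LL_mul_le (n + 1) N (by omega) (by omega)
  have := LL_ge_one ((n+1) * N)
  push_cast at *
  gcongr

lemma count_prim (n : ℕ) (hn : 3 ≤ n) (hG : GC n) :
    PL n (fun _ f => Irreducible f ∧ ¬ IsImprim f ∧ ¬ FullS n f) := by
  obtain ⟨c, hc, H⟩ := prim_struct n hn
  obtain ⟨m, rfl⟩ : ∃ m, n = m + 2 := ⟨n - 2, by omega⟩
  refine ((count_bigC m (by omega)).or ((count_smallC (m + 2) (by omega)).or (count_fib (m + 2) hn hG c hc))).mono ?_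
  rintro N f hN hbox ⟨hirr, him, hS⟩
  obtain ⟨α, β, g, S, k, Y, h1, h2, h3, h4⟩ := H f hbox.1 hbox.2.1 hirr him hS
  have hP := h4.2.2.2.2.2.1
  have hsq : Squarefree (∏ p ∈ S, p) := by
    apply Finset.squarefree_prod_of_pairwise_isCoprime
    · intro a ha b hb hab
      exact Nat.coprime_iff_isRelPrime.1 ((Nat.coprime_primes (hP a ha).1 (hP b hb).1).2 hab)
    · intro p hp
      exact (hP p hp).1.prime.squarefree
  have hpf : (∏ p ∈ S, p).primeFactors = S := Nat.primeFactors_prod fun p hp => (hP p hp).1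
  by_cases hCN : ∏ p ∈ S, p ≤ N
  · by_cases hDN : ∏ p ∈ S, p ^ k p ≤ N ^ 2
    · exact Or.inr (Or.inr ⟨hirr, α, β, g, S, k, Y, h1, h2, h3, h4, hCN, hDN⟩)
    · refine Or.inr (Or.inl ⟨_, k, hsq, hCN, ?_, ?_⟩)
      · rw [hpf]
        intro p hp
        obtain ⟨a1, a2, a3, a4, a5, a6⟩ := hP p hp
        exact ⟨a3, by omega, a5⟩
      · rw [hpf]; omega
  · refine Or.inl ⟨_, hsq, ?_, ?_⟩
    · exact_mod_cast (not_le.1 hCN).le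
    · intro p hp hd
      have hpS : p ∈ S := by
        rw [← hpf, Nat.mem_primeFactors]; exact ⟨hp, hd, hsq.ne_zero⟩
      obtain ⟨a1, a2, a3, a4, a5, a6⟩ := hP p hpS
      exact ⟨a2, NR_mono (by omega) a5⟩
end

section
open Polynomial

lemma LL_mono {a b : ℕ} (ha : 1 ≤ a) (h : a ≤ b) : LL a ≤ LL b := by
  unfold LL
  have : Real.log a ≤ Real.log b := Real.log_le_log (by exact_mod_cast ha) (by exact_mod_cast h)
  linarith

def wt (n i : ℕ) : ℕ := if i + 1 = n then 0 else n - i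

lemma wt_sum (m : ℕ) : 2 * ∑ i : Fin (m + 2), wt (m + 2) i = (m + 1) * (m + 4) := by
  rw [Fin.sum_univ_castSucc]
  have h1 : wt (m + 2) (Fin.last (m + 1) : Fin (m+2)) = 0 := by simp [wt]
  have h2 : ∀ i : Fin (m + 1), wt (m + 2) (i.castSucc : Fin (m + 2)) = m + 2 - i := by
    intro i
    have := i.2
    simp only [wt, Fin.val_castSucc]
    rw [if_neg (by omega)]
  simp only [h1, h2]
  rw [Fin.sum_univ_eq_sum_range (fun i => m + 2 - i) (m + 1), ← Finset.sum_range_reflect]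
  have h3 : ∀ i ∈ Finset.range (m + 1), m + 2 - (m + 1 - 1 - i) = i + 2 := by
    intro i hi
    rw [Finset.mem_range] at hi
    omega
  rw [Finset.sum_congr rfl h3]
  have h4 : ∀ k, 2 * ∑ i ∈ Finset.range k, (i + 2) = k * (k + 3) := by
    intro k
    induction k with
    | zero => simp
    | succ k ih => rw [Finset.sum_range_succ, mul_add, ih]; ring
  rw [add_zero, h4]

lemma GC_four (n : ℕ) (hn : 4 ≤ n) : GC n := by
  classical
  intro c hc
  obtain ⟨m, rfl⟩ : ∃ m, n = m + 2 := ⟨n - 2, by omega⟩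
  obtain ⟨κ, hκ1, hκ2, hκ3⟩ : ∃ κ : ℕ, (κ = 3 ∧ m = 2 ∨ κ = 2 ∧ 3 ≤ m) ∧ κ ≤ m + 1 ∧
      ∑ i : Fin (m + 2), wt (m + 2) i ≤ (m + 1) * m + κ := by
    have := wt_sum m
    by_cases h : m = 2
    · subst h; exact ⟨3, by omega, by omega, by omega⟩
    · refine ⟨2, by omega, by omega, ?_⟩
      obtain ⟨j, rfl⟩ : ∃ j, m = j + 3 := ⟨m - 3, by omega⟩
      nlinarith
  obtain ⟨c0, hc0, f0, H⟩ := boxcount m (by omega)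
  obtain ⟨A, hA⟩ := exists_nat_ge c
  have hA1 : 1 ≤ A := by exact_mod_cast hc.trans hA
  set B : ℕ := 2 ^ (m + 2) * (4 ^ (m + 1) * A) with hB
  have hB1 : 1 ≤ B := Nat.mul_pos (by positivity) (Nat.mul_pos (by positivity) hA1)
  have hLA := LL_ge_one A
  have hLB := LL_ge_one B
  refine ⟨3 * LL A * (c0 * LL B ^ f0 * ((2 ^ (m + 2)) ^ (m + 2) * ((4 ^ (m + 1) * A) ^ m * (4 ^ κ * c + 2)))),
    by positivity, f0 + 1, fun N hN G hG => ?_⟩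
  have hLN := LL_ge_one N
  have hN1 : (1:ℝ) ≤ N := by exact_mod_cast (by omega : 1 ≤ N)
  choose! f S k Y hPS hCN hDN using hG
  have hYN : ∀ g ∈ G, Y g ^ (m + 1) ≤ A * N := by
    intro g hg
    have h1 := (hPS g hg).2.2.2.2.2.2.1
    have hY := (hPS g hg).1
    have h2 : ((∏ p ∈ S g, p ^ k g p : ℕ) : ℝ) ≤ N ^ 2 := by exact_mod_cast hDN g hg
    have h3 : (Y g ^ (m + 1)) ^ 2 ≤ (A * N) ^ 2 := by
      rw [← pow_mul, mul_comm (m + 1), mul_pow]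
      refine h1.trans ?_
      have : c ≤ (A:ℝ) ^ 2 := by
        have : (1:ℝ) ≤ A := by exact_mod_cast hA1
        nlinarith
      gcongr
    exact le_of_sq_le_sq h3 (by positivity)
  have hdy : ∀ g ∈ G, ∃ e ∈ Finset.range (Nat.clog 2 (A * N) + 1), Y g ≤ (2:ℝ) ^ e ∧ (2:ℝ) ^ e ≤ 4 * Y g := by
    intro g hg
    have := exists_dyadic (hPS g hg).1 ((le_self_pow₀ (hPS g hg).1 (by omega)).trans (hYN g hg))
    rwa [show (A * N : ℝ) = ((A * N : ℕ) : ℝ) by push_cast; ring, Nat.ceil_natCast] at this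
  choose! e he1 he2 he3 using hdy
  have hkey := card_le_keys G _ e (c0 * LL B ^ f0 * ((2 ^ (m + 2)) ^ (m + 2) * ((4 ^ (m + 1) * A) ^ m * (4 ^ κ * c + 2))) * N ^ m * LL N ^ f0) he1 ?_
  · refine hkey.trans ?_
    rw [Finset.card_range]
    have h1 := (clog_le_LL (A * N) (Nat.mul_pos hA1 (by omega))).trans
      (mul_le_mul_of_nonneg_left (LL_mul_le A N hA1 (by omega)) (by norm_num))
    refine (mul_le_mul_of_nonneg_right h1 (by positivity)).trans (le_of_eq ?_)
    rw [show m + 2 - 2 = m from rfl, pow_succ]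
    ring
  intro E _ V hV hVE
  rcases V.eq_empty_or_nonempty with rfl | ⟨g0, hg0⟩
  · simp only [Finset.card_empty, Nat.cast_zero]; positivity
  set Q : ℕ := 2 ^ E with hQ
  have hQ1 : 1 ≤ Q := Nat.one_le_two_pow
  have hQr : (1:ℝ) ≤ Q := by exact_mod_cast hQ1
  have hYQ : ∀ g ∈ V, Y g ≤ Q ∧ (Q:ℝ) ≤ 4 * Y g := by
    intro g hg
    have h1 := he2 g (hV hg)
    have h2 := he3 g (hV hg)
    rw [hVE g hg] at h1 h2
    rw [hQ]; push_cast
    exact ⟨h1, h2⟩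
  have hQN : (Q:ℝ) ^ (m + 1) ≤ 4 ^ (m + 1) * A * N := by
    calc (Q:ℝ) ^ (m + 1) ≤ (4 * Y g0) ^ (m + 1) := by gcongr; exact (hYQ g0 hg0).2
      _ = 4 ^ (m + 1) * Y g0 ^ (m + 1) := mul_pow _ _ _
      _ ≤ 4 ^ (m + 1) * (A * N) := by gcongr; exact hYN g0 (hV hg0)
      _ = _ := by ring
  have hQN' : Q ^ (m + 1) ≤ 4 ^ (m + 1) * A * N := by exact_mod_cast hQN
  let s : Fin (m + 2) → ℕ := fun i => 2 ^ (m + 2) * Q ^ wt (m + 2) i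
  have hinj : Set.InjOn (fun h : ℤ[X] => fun i : Fin (m + 2) => h.coeff i) V := by
    intro g hg g' hg' h
    have p1 := hPS g (hV hg)
    have p2 := hPS g' (hV hg')
    rw [← polyOf_coeff_eq p1.2.1 p1.2.2.1, ← polyOf_coeff_eq p2.2.1 p2.2.2.1]
    exact congrArg polyOf h
  have hs1 : s 1 = 2 ^ (m + 2) * Q ^ (m + 1) := by
    simp only [s]
    rw [show ((1 : Fin (m + 2)) : ℕ) = 1 from rfl, wt, if_neg (by omega)]
    rfl
  have hs0 : s 0 = 2 ^ (m + 2) * Q ^ (m + 2) := by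
    simp only [s]
    rw [show ((0 : Fin (m + 2)) : ℕ) = 0 from rfl, wt, if_neg (by omega)]
    rfl
  have hZ : (0:ℝ) < Q ^ κ / (4 ^ κ * c) := by positivity
  have hbox := H s (fun i => Nat.mul_pos (by positivity) (by positivity))
    (by rw [hs1]
        calc 2 ≤ 2 ^ (m + 2) * 1 := by rw [mul_one]; exact le_self_pow₀ (by norm_num) (by omega)
          _ ≤ _ := Nat.mul_le_mul le_rfl (Nat.one_le_pow _ _ hQ1))
    (fun i hi => by
      rw [hs1]
      refine Nat.mul_le_mul le_rfl (Nat.pow_le_pow_right hQ1 ?_)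
      have : 1 ≤ (i : ℕ) := hi
      unfold wt
      split_ifs <;> omega)
    (Q ^ κ / (4 ^ κ * c)) hZ (V.image (fun h : ℤ[X] => fun i : Fin (m + 2) => h.coeff i)) ?_ ?_
  · rw [Finset.card_image_of_injOn hinj] at hbox
    refine hbox.trans ?_
    have hl : LL (s 1) ≤ LL B * LL N := by
      refine le_trans (LL_mono ?_ ?_) (LL_mul_le B N hB1 (by omega))
      · exact Nat.mul_pos (by positivity) (by positivity)
      · rw [hs1, hB, mul_assoc]
        exact Nat.mul_le_mul le_rfl hQN'
    have hp : ∏ i, (s i : ℝ) ≤ (2 ^ (m + 2)) ^ (m + 2) * ((Q ^ (m + 1)) ^ m * Q ^ κ) := by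
      simp only [s]
      push_cast
      rw [Finset.prod_mul_distrib, Finset.prod_const, Finset.card_univ, Fintype.card_fin, Finset.prod_pow_eq_pow_sum,
        ← pow_mul (Q:ℝ), ← pow_add (Q:ℝ)]
      gcongr
    have h01 : 1 / ((Q:ℝ) ^ κ / (4 ^ κ * c)) + 1 / (s 0 : ℝ) + 1 / (s 1 : ℝ) ≤ (4 ^ κ * c + 2) / Q ^ κ := by
      have h2 : (1:ℝ) ≤ 2 ^ (m + 2) := one_le_pow₀ (by norm_num)
      have a0 : 1 / (s 0 : ℝ) ≤ 1 / Q ^ κ := by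
        rw [hs0]; push_cast
        gcongr
        calc (Q:ℝ) ^ κ ≤ Q ^ (m + 2) := pow_le_pow_right₀ hQr (by omega)
          _ ≤ 2 ^ (m + 2) * Q ^ (m + 2) := le_mul_of_one_le_left (by positivity) h2
      have a1 : 1 / (s 1 : ℝ) ≤ 1 / Q ^ κ := by
        rw [hs1]; push_cast
        gcongr
        calc (Q:ℝ) ^ κ ≤ Q ^ (m + 1) := pow_le_pow_right₀ hQr (by omega)
          _ ≤ 2 ^ (m + 2) * Q ^ (m + 1) := le_mul_of_one_le_left (by positivity) h2
      rw [one_div_div]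
      calc _ ≤ 4 ^ κ * c / (Q:ℝ) ^ κ + 1 / Q ^ κ + 1 / Q ^ κ := by gcongr
        _ = _ := by ring
    have hLs := LL_ge_one (s 1)
    have hsum0 : 0 ≤ 1 / ((Q:ℝ) ^ κ / (4 ^ κ * c)) + 1 / (s 0 : ℝ) + 1 / (s 1 : ℝ) := by positivity
    calc c0 * LL (s 1) ^ f0 * (∏ i, (s i : ℝ)) * (1 / ((Q:ℝ) ^ κ / (4 ^ κ * c)) + 1 / (s 0 : ℝ) + 1 / (s 1 : ℝ))
        ≤ c0 * (LL B * LL N) ^ f0 * ((2 ^ (m + 2)) ^ (m + 2) * ((Q ^ (m + 1)) ^ m * Q ^ κ)) * ((4 ^ κ * c + 2) / Q ^ κ) := by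
          gcongr
      _ = c0 * (LL B * LL N) ^ f0 * ((2 ^ (m + 2)) ^ (m + 2) * ((Q ^ (m + 1)) ^ m * (4 ^ κ * c + 2))) := by
          field_simp
      _ ≤ c0 * (LL B * LL N) ^ f0 * ((2 ^ (m + 2)) ^ (m + 2) * ((4 ^ (m + 1) * A * N) ^ m * (4 ^ κ * c + 2))) := by
          gcongr
      _ = _ := by rw [mul_pow, mul_pow (4 ^ (m + 1) * (A:ℝ))]; ring
  · intro a ha i
    obtain ⟨g, hg, rfl⟩ := Finset.mem_image.1 ha
    have p1 := hPS g (hV hg)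
    simp only [s, wt]
    by_cases hi : (i : ℕ) + 1 = m + 2
    · rw [if_pos hi, pow_zero, mul_one]
      have := p1.2.2.2.1
      rw [show (i : ℕ) = m + 2 - 1 by omega]
      refine this.trans ?_
      exact_mod_cast (Nat.lt_two_pow_self).le
    · rw [if_neg hi]
      have h1 := p1.2.2.2.2.1 i
      have hY1 := p1.1
      have h2 : (|g.coeff i| : ℝ) ≤ 2 ^ (m + 2) * Q ^ (m + 2 - i) := by
        refine h1.trans ?_
        gcongr
        exact (hYQ g hg).1
      exact_mod_cast h2
  · intro a ha
    obtain ⟨g, hg, rfl⟩ := Finset.mem_image.1 ha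
    have p1 := hPS g (hV hg)
    rw [polyOf_coeff_eq p1.2.1 p1.2.2.1]
    have hP := p1.2.2.2.2.2.1
    have hsq : Squarefree (∏ p ∈ S g, p) := by
      apply Finset.squarefree_prod_of_pairwise_isCoprime
      · intro a ha b hb hab
        exact Nat.coprime_iff_isRelPrime.1 ((Nat.coprime_primes (hP a ha).1 (hP b hb).1).2 hab)
      · intro p hp
        exact (hP p hp).1.prime.squarefree
    have hpf : (∏ p ∈ S g, p).primeFactors = S g := Nat.primeFactors_prod fun p hp => (hP p hp).1
    refine ⟨_, hsq, ?_, ?_⟩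
    · have hY1 := p1.1
      have hC1 : (0:ℝ) ≤ c * ((∏ p ∈ S g, p : ℕ) : ℝ) := by positivity
      have hYC : Y g ^ κ ≤ c * ((∏ p ∈ S g, p : ℕ) : ℝ) := by
        rcases hκ1 with ⟨rfl, rfl⟩ | ⟨rfl, hm3⟩
        · have := p1.2.2.2.2.2.2.2.1 (Or.inr rfl)
          refine le_of_sq_le_sq (?_ : (Y g ^ 3) ^ 2 ≤ _) hC1
          rw [← pow_mul, mul_pow]
          refine this.trans ?_
          gcongr
          nlinarith
        · have h1 := p1.2.2.2.2.2.2.1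
          rw [show m + 2 - 1 = m + 1 from rfl, pow_mul] at h1
          refine le_of_pow_le_pow_left₀ (n := m + 1) (by omega) hC1 (h1.trans ?_)
          rw [mul_pow]
          have h2 : ((∏ p ∈ S g, p ^ k g p : ℕ) : ℝ) ≤ ((∏ p ∈ S g, p : ℕ) : ℝ) ^ (m + 1) := by
            have : ∏ p ∈ S g, p ^ k g p ≤ (∏ p ∈ S g, p) ^ (m + 1) := by
              rw [← Finset.prod_pow]
              refine Finset.prod_le_prod' fun p hp => Nat.pow_le_pow_right (hP p hp).1.pos ?_
              have := (hP p hp).2.2.2.1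
              omega
            exact_mod_cast this
          gcongr
          exact le_self_pow₀ hc (by omega)
      rw [div_le_iff₀ (by positivity)]
      calc (Q:ℝ) ^ κ ≤ (4 * Y g) ^ κ := by gcongr; exact (hYQ g hg).2
        _ = 4 ^ κ * Y g ^ κ := mul_pow _ _ _
        _ ≤ 4 ^ κ * (c * ((∏ p ∈ S g, p : ℕ) : ℝ)) := by gcongr
        _ = _ := by ring
    · intro p hp hd
      have hpS : p ∈ S g := by
        rw [← hpf, Nat.mem_primeFactors]; exact ⟨hp, hd, hsq.ne_zero⟩
      obtain ⟨a1, a2, a3, a4, a5, a6⟩ := hP p hpS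
      exact ⟨a2, NR_mono (by omega) a6⟩
end

section
open Polynomial

lemma NR_cube {p : ℕ} {g : ℤ[X]} (hm : g.Monic) (hd : g.natDegree = 3) (h : NR p g 1) :
    (p : ℤ) ∣ 9 * g.coeff 1 - 3 * g.coeff 2 ^ 2 ∧
    (p : ℤ) ∣ 2 * g.coeff 2 ^ 3 - 9 * g.coeff 2 * g.coeff 1 + 27 * g.coeff 0 := by
  obtain ⟨F, _, _, s, t, hst, ht, hg⟩ := h
  have hcard : s.card = 3 := by
    have := congrArg natDegree hg
    rw [hm.natDegree_map, hd, natDegree_multiset_prod_X_sub_C_eq_card] at this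
    exact this.symm
  obtain ⟨x, hx⟩ : ∃ x, x ∈ s := Multiset.card_pos_iff_exists_mem.1 (by omega)
  have hrep : s = Multiset.replicate 3 x := by
    rw [Multiset.eq_replicate]
    refine ⟨hcard, fun b hb => ?_⟩
    exact Finset.card_le_one.1 ht b (hst b hb) x (hst x hx)
  rw [hrep, Multiset.map_replicate, Multiset.prod_replicate] at hg
  obtain ⟨s1, hs1⟩ : ∃ s, s = 3 * x := ⟨_, rfl⟩
  obtain ⟨s2, hs2⟩ : ∃ s, s = 3 * x ^ 2 := ⟨_, rfl⟩
  obtain ⟨s3, hs3⟩ : ∃ s, s = x ^ 3 := ⟨_, rfl⟩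
  have hexp : (X - C x) ^ 3 = X ^ 3 - C s1 * X ^ 2 + C s2 * X - C s3 := by
    simp only [hs1, hs2, hs3, C_mul, C_pow]
    rw [show (C (3:F)) = 3 from rfl]
    ring
  rw [hexp] at hg
  have h2 := congrArg (fun P => coeff P 2) hg
  have h1 := congrArg (fun P => coeff P 1) hg
  have h0 := congrArg (fun P => coeff P 0) hg
  simp [coeff_X, coeff_X_pow, coeff_C, coeff_C_mul] at h0 h1 h2
  subst hs1 hs2 hs3
  constructor <;> rw [← CharP.intCast_eq_zero_iff F p] <;> push_cast <;> rw [h2, h1]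
  · ring
  · rw [h0]; ring

lemma cube_key {R : ℤ} {N : ℕ} {a b c z C : ℤ} (hC : 0 < C) (hCN : C ≤ N) (hR : 0 ≤ R) (h2 : C ∣ 9 * b - 3 * a ^ 2)
    (h3 : C ∣ 2 * a ^ 3 - 9 * a * b + 27 * c) (hz : z ^ 2 = dc a b c) (hB : |9 * b - 3 * a ^ 2| ≤ R * C) :
    ∃ u v w : ℤ, |u| ≤ R ∧ v ^ 2 ≤ 4 * R ^ 3 * N ∧ w ^ 2 ≤ 4 * R ^ 3 * N ∧
      9 * b - 3 * a ^ 2 = C * u ∧ 2 * a ^ 3 - 9 * a * b + 27 * c = C * v ∧ 4 * C * u ^ 3 = - (27 * v ^ 2 + w ^ 2) := by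
  obtain ⟨u, hu⟩ := h2
  obtain ⟨v, hv⟩ := h3
  have hid : (27 * z) ^ 2 = - 4 * (9 * b - 3 * a ^ 2) ^ 3 - 27 * (2 * a ^ 3 - 9 * a * b + 27 * c) ^ 2 := by
    rw [mul_pow, hz, dc]; ring
  rw [hu, hv] at hid
  obtain ⟨w, hw⟩ : C ∣ 27 * z := by
    rw [← Int.pow_dvd_pow_iff (n := 2) (by norm_num), hid]
    exact ⟨-4 * C * u ^ 3 - 27 * v ^ 2, by ring⟩
  rw [hw] at hid
  have hrel : 4 * C * u ^ 3 = - (27 * v ^ 2 + w ^ 2) := by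
    have : C ^ 2 * (4 * C * u ^ 3) = C ^ 2 * (- (27 * v ^ 2 + w ^ 2)) := by linarith
    exact mul_left_cancel₀ (by positivity) this
  have hub : |u| ≤ R := by
    rw [hu, abs_mul, abs_of_pos hC, mul_comm] at hB
    exact le_of_mul_le_mul_right hB hC
  have hu3 : - u ^ 3 ≤ R ^ 3 := by
    calc - u ^ 3 ≤ |u ^ 3| := neg_le_abs _
      _ = |u| ^ 3 := abs_pow _ _
      _ ≤ R ^ 3 := by gcongr
  have hbig : 27 * v ^ 2 + w ^ 2 ≤ 4 * R ^ 3 * N := by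
    have h1 : C * (- u ^ 3) ≤ C * R ^ 3 := by gcongr
    have h2 : C * R ^ 3 ≤ N * R ^ 3 := by gcongr
    linarith
  exact ⟨u, v, w, hub, by nlinarith [sq_nonneg v, sq_nonneg w], by nlinarith [sq_nonneg v, sq_nonneg w], hu, hv, hrel⟩

lemma GC_three : GC 3 := by
  classical
  intro c hc
  obtain ⟨A, hA⟩ := exists_nat_ge (99 * c)
  refine ⟨7 * (2 * A + 1) * (16 * (16 * A ^ 3 + 1)), by positivity, 0, fun N hN G hG => ?_⟩
  have hkey : ∀ g ∈ G, ∃ C u v w : ℤ, 0 < C ∧ g.Monic ∧ g.natDegree = 3 ∧ |g.coeff 2| ≤ 3 ∧ |u| ≤ A ∧ v ^ 2 ≤ 4 * A ^ 3 * N ∧ w ^ 2 ≤ 4 * A ^ 3 * N ∧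
      9 * g.coeff 1 - 3 * g.coeff 2 ^ 2 = C * u ∧ 2 * g.coeff 2 ^ 3 - 9 * g.coeff 2 * g.coeff 1 + 27 * g.coeff 0 = C * v ∧
      4 * C * u ^ 3 = - (27 * v ^ 2 + w ^ 2) := by
    intro g hg
    obtain ⟨f, S, k, Y, ⟨hY, hm, hd, h2, hi, hP, -, h3, hz⟩, hCN, -⟩ := hG g hg
    obtain ⟨z, hz⟩ := hz rfl
    have h3 := h3 (Or.inl rfl)
    have hpr : ∀ p ∈ S, Prime (p : ℤ) := fun p hp => Nat.prime_iff_prime_int.1 (hP p hp).1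
    have hnr : ∀ p ∈ S, NR p g 1 := fun p hp => by
      obtain ⟨a1, a2, a3, a4, a5, a6⟩ := hP p hp
      rwa [show k p = 2 by omega] at a6
    have hC0 : 0 < ∏ p ∈ S, p := Finset.prod_pos fun p hp => (hP p hp).1.pos
    have hdvd : ∀ x : ℤ, (∀ p ∈ S, (p : ℤ) ∣ x) → ((∏ p ∈ S, p : ℕ) : ℤ) ∣ x := by
      intro x hx
      rw [Int.natCast_dvd]
      exact Finset.prod_primes_dvd _ (fun p hp => (hP p hp).1.prime) (fun p hp => Int.natCast_dvd.1 (hx p hp))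
    refine ⟨((∏ p ∈ S, p : ℕ) : ℤ), ?_⟩
    obtain ⟨u, v, w, h⟩ := cube_key (R := A) (N := N) (C := ((∏ p ∈ S, p : ℕ) : ℤ)) (by exact_mod_cast hC0)
      (by exact_mod_cast hCN) (by positivity) (hdvd _ fun p hp => (NR_cube hm hd (hnr p hp)).1)
      (hdvd _ fun p hp => (NR_cube hm hd (hnr p hp)).2) hz (by
        have e1 : Y ^ 2 ≤ c * ((∏ p ∈ S, p : ℕ) : ℝ) := by
          refine le_of_sq_le_sq ?_ (by positivity)
          rw [← pow_mul, mul_pow]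
          refine h3.trans ?_
          gcongr
          nlinarith
        have e2 := hi 1
        have e3 : (|g.coeff 2| : ℝ) ≤ 3 := by exact_mod_cast h2
        have e4 : (g.coeff 2 : ℝ) ^ 2 ≤ 9 := by
          have := abs_le.1 e3
          nlinarith
        have e5 : (1:ℝ) ≤ Y ^ 2 := one_le_pow₀ hY
        norm_num at e2
        have e6 : |9 * (g.coeff 1 : ℝ) - 3 * (g.coeff 2 : ℝ) ^ 2| ≤ 99 * Y ^ 2 := by
          have := abs_le.1 e2
          rw [abs_le]
          constructor <;> nlinarith [sq_nonneg (g.coeff 2 : ℝ)]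
        have e7 : |9 * (g.coeff 1 : ℝ) - 3 * (g.coeff 2 : ℝ) ^ 2| ≤ A * ((∏ p ∈ S, p : ℕ) : ℝ) := by
          refine e6.trans ?_
          calc 99 * Y ^ 2 ≤ 99 * (c * ((∏ p ∈ S, p : ℕ) : ℝ)) := by gcongr
            _ = (99 * c) * ((∏ p ∈ S, p : ℕ) : ℝ) := by ring
            _ ≤ _ := by gcongr
        exact_mod_cast e7)
    exact ⟨u, v, w, by exact_mod_cast hC0, hm, hd, by exact_mod_cast h2, h⟩
  choose! C u v w k1 k2 k3 k4 k5 k6 k7 k8 k9 k10 using hkey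
  set L : ℕ := Nat.sqrt (4 * A ^ 3 * N) with hL
  have hsq : ∀ x : ℤ, x ^ 2 ≤ 4 * A ^ 3 * N → x ∈ Finset.Icc (-(L:ℤ)) L := by
    intro x hx
    rw [Finset.mem_Icc, ← abs_le]
    have : x.natAbs ≤ L := by
      rw [hL, Nat.le_sqrt']
      have : ((x.natAbs ^ 2 : ℕ) : ℤ) ≤ ((4 * A ^ 3 * N : ℕ) : ℤ) := by
        push_cast
        rw [sq_abs]
        exact hx
      exact_mod_cast this
    rw [Int.abs_eq_natAbs]
    exact_mod_cast this
  have hle : G.card ≤ (Finset.Icc (-3:ℤ) 3 ×ˢ (Finset.Icc (-(A:ℤ)) A ×ˢ (Finset.Icc (-(L:ℤ)) L ×ˢ Finset.Icc (-(L:ℤ)) L))).card := by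
    refine Finset.card_le_card_of_injOn (fun g => (g.coeff 2, u g, v g, w g)) ?_ ?_
    · intro g hg
      simp only [Finset.coe_product, Set.mem_prod, Finset.mem_coe]
      refine ⟨?_, ?_, hsq _ (k6 g hg), hsq _ (k7 g hg)⟩
      · rw [Finset.mem_Icc, ← abs_le]; exact k4 g hg
      · rw [Finset.mem_Icc, ← abs_le]; exact k5 g hg
    · intro g hg g' hg' heq
      simp only [Prod.mk.injEq] at heq
      obtain ⟨q2, qu, qv, qw⟩ := heq
      have r8 := k8 g hg
      have r9 := k9 g hg
      have r10 := k10 g hg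
      have s8 := k8 g' hg'
      have s9 := k9 g' hg'
      have s10 := k10 g' hg'
      rw [← q2, ← qu] at s8
      rw [← q2, ← qv] at s9
      rw [← qu, ← qv, ← qw] at s10
      have hCu : C g * u g = C g' * u g ∧ C g * v g = C g' * v g := by
        by_cases hu : u g = 0
        · have : v g = 0 := by
            rw [hu] at r10
            have : v g ^ 2 = 0 := by nlinarith [sq_nonneg (v g), sq_nonneg (w g)]
            exact pow_eq_zero_iff (by norm_num) |>.1 this
          rw [hu, this]; simp
        · have : C g = C g' := by
            have h : 4 * u g ^ 3 ≠ 0 := mul_ne_zero (by norm_num) (pow_ne_zero _ hu)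
            apply mul_right_cancel₀ h
            linarith
          rw [this]; simp
      have c1 : g.coeff 1 = g'.coeff 1 := by linarith [hCu.1]
      have c0 : g.coeff 0 = g'.coeff 0 := by
        rw [c1] at r9
        linarith [hCu.2]
      rw [← polyOf_coeff_eq (k2 g hg) (k3 g hg), ← polyOf_coeff_eq (k2 g' hg') (k3 g' hg')]
      congr 1
      funext i
      fin_cases i
      · exact c0
      · exact c1
      · exact q2
  have hL2 : L * L ≤ 4 * A ^ 3 * N := Nat.sqrt_le _
  have hcard : (Finset.Icc (-3:ℤ) 3 ×ˢ (Finset.Icc (-(A:ℤ)) A ×ˢ (Finset.Icc (-(L:ℤ)) L ×ˢ Finset.Icc (-(L:ℤ)) L))).card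
      = 7 * ((2 * A + 1) * ((2 * L + 1) * (2 * L + 1))) := by
    simp only [Finset.card_product, Int.card_Icc]
    rw [show ((A:ℤ) + 1 - -A).toNat = 2 * A + 1 by omega, show ((L:ℤ) + 1 - -L).toNat = 2 * L + 1 by omega]
    rfl
  rw [hcard] at hle
  have hfin : 7 * ((2 * A + 1) * ((2 * L + 1) * (2 * L + 1))) ≤ 7 * (2 * A + 1) * (16 * (16 * A ^ 3 + 1)) * N := by
    have : (2 * L + 1) * (2 * L + 1) ≤ 16 * (16 * A ^ 3 + 1) * N := by nlinarith [Nat.zero_le (A ^ 3 * N), sq_nonneg ((L:ℤ) - 1)]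
    calc _ = 7 * (2 * A + 1) * ((2 * L + 1) * (2 * L + 1)) := by ring
      _ ≤ 7 * (2 * A + 1) * (16 * (16 * A ^ 3 + 1) * N) := Nat.mul_le_mul le_rfl this
      _ = _ := by ring
  have : (G.card : ℝ) ≤ ((7 * (2 * A + 1) * (16 * (16 * A ^ 3 + 1)) * N : ℕ) : ℝ) := by exact_mod_cast hle.trans hfin
  refine this.trans (le_of_eq ?_)
  push_cast
  norm_num
end

open Polynomial Polynomial.Gal

attribute [local instance] Polynomial.Gal.splits_ℚ_ℂ

lemma count_all (d : ℕ) (hd : 2 ≤ d) : PL d (fun _ f => ¬ FullS d f) := by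
  have hprim : PL d (fun _ f => Irreducible f ∧ ¬ IsImprim f ∧ ¬ FullS d f) := by
    rcases (by omega : d = 2 ∨ d = 3 ∨ 4 ≤ d) with rfl | rfl | h
    · refine (count_imprim 2).mono fun N p _ hb h => ?_
      exact absurd (fullS_two hb.1 hb.2.1 h.1) h.2.2
    · exact count_prim 3 le_rfl GC_three
    · exact count_prim d (by omega) (GC_four d h)
  refine ((count_reducible d (by omega)).or ((count_imprim d).or hprim)).mono fun N p _ hb h => ?_
  by_cases hr : IsRed p
  · exact Or.inl hr
  by_cases hi : IsImprim p
  · exact Or.inr (Or.inl hi)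
  refine Or.inr (Or.inr ⟨?_, hi, h⟩)
  rw [hb.1.irreducible_iff_natDegree]
  refine ⟨by rintro rfl; have := hb.2.1; simp at this; omega, ?_⟩
  intro f g hf hg hfg
  by_contra! hc
  exact hr ⟨f, g, hf, hg, by omega, by omega, hfg.symm⟩

/-- For `d ≥ 2`, the number of monic integer polynomials of degree `d` with coefficients
bounded by `N` whose Galois group is not the full symmetric group `S_d` is
`O(N ^ (d-1) * (log N) ^ f)`; i.e. a random polynomial in `P_d(N)` fails to have Galois
group `S_d` with probability `O((log N) ^ f / N)`. -/
theorem galois_group_not_symmetric_count (d : ℕ) (hd : 2 ≤ d) :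
    ∃ C : ℝ, 0 < C ∧ ∃ f : ℕ, 0 < f ∧
      ∀ N : ℕ, 2 ≤ N →
        (Set.ncard {p : Polynomial ℤ |
            p.Monic ∧ p.natDegree = d ∧
            (∀ i < d, |p.coeff i| ≤ (N : ℤ)) ∧
            ¬ (Fintype.card ((p.map (Int.castRingHom ℚ)).rootSet ℂ) = d ∧
              Function.Surjective (galActionHom (p.map (Int.castRingHom ℚ)) ℂ))} : ℝ) ≤
          C * (N : ℝ) ^ (d - 1) * Real.log N ^ f := by
  classical
  obtain ⟨C, hC, f, H⟩ := count_all d hd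
  have hl2 : 0 < Real.log 2 := Real.log_pos (by norm_num)
  refine ⟨(C + 1) * (1 + 1 / Real.log 2) ^ (f + 1), by positivity, f + 1, by omega, fun N hN => ?_⟩
  have hN2 : (2:ℝ) ≤ N := by exact_mod_cast hN
  have hlN : Real.log 2 ≤ Real.log N := Real.log_le_log (by norm_num) hN2
  have hlN0 : 0 < Real.log N := hl2.trans_le hlN
  have hLL : LL N ≤ (1 + 1 / Real.log 2) * Real.log N := by
    unfold LL
    have : 1 ≤ 1 / Real.log 2 * Real.log N := by
      rw [one_div, inv_mul_eq_div, one_le_div hl2]; exact hlN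
    linarith
  have hL1 := LL_ge_one N
  by_cases hfin : Set.Finite {p : Polynomial ℤ | p.Monic ∧ p.natDegree = d ∧ (∀ i < d, |p.coeff i| ≤ (N : ℤ)) ∧
            ¬ (Fintype.card ((p.map (Int.castRingHom ℚ)).rootSet ℂ) = d ∧
              Function.Surjective (galActionHom (p.map (Int.castRingHom ℚ)) ℂ))}
  · rw [Set.ncard_eq_toFinset_card _ hfin]
    refine (H N hN hfin.toFinset ?_).trans ?_
    · intro p hp
      rw [Set.Finite.mem_toFinset] at hp
      exact ⟨⟨hp.1, hp.2.1, hp.2.2.1⟩, hp.2.2.2⟩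
    · calc C * (N:ℝ) ^ (d - 1) * LL N ^ f ≤ (C + 1) * (N:ℝ) ^ (d - 1) * LL N ^ (f + 1) := by
            gcongr
            · linarith
            · omega
        _ ≤ (C + 1) * (N:ℝ) ^ (d - 1) * ((1 + 1 / Real.log 2) * Real.log N) ^ (f + 1) := by gcongr
        _ = _ := by rw [mul_pow]; ring
  · rw [Set.Infinite.ncard hfin]
    simp only [Nat.cast_zero]
    positivity
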